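/- There is an absolute constant c > 0 with the following property. Let P ⊆ ℝ² be a finite set with |P| ≥ 2, and let Δ(P) := {(p₁−q₁)² − (p₂−q₂)² : p,q ∈ P} be the set of squared Minkowski distances determined by P. If Δ(P) ≠ {0}, then |Δ(P)| ≥ c·|P|/log|P|. -/

import Mathlib

namespace Minkowski

open MvPolynomial

/-- Real polynomials in three variables `t, x, y`. -/
abbrev Poly3 := MvPolynomial (Fin 3) ℝ

/-- A line, parametrised by `t`, attached to a pair of points in null coordinates. -/
abbrev Line := (ℝ × ℝ) × (ℝ × ℝ)

/-- Polynomials whose degree in the `i`-th variable is at most `e i`. -/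
noncomputable def box (e : Fin 3 → ℕ) : Submodule ℝ Poly3 :=
  restrictSupport ℝ {s | ∀ i, s i ≤ e i}

lemma mem_box {e : Fin 3 → ℕ} {f : Poly3} : f ∈ box e ↔ ∀ i, degreeOf i f ≤ e i := by
  rw [box, mem_restrictSupport_iff]
  simp only [degreeOf_le_iff]
  constructor
  · intro h i s hs
    exact h hs i
  · intro h s hs i
    exact h i s hs

noncomputable def boxIndexEquiv (e : Fin 3 → ℕ) :
    {s : Fin 3 →₀ ℕ | ∀ i, s i ≤ e i} ≃ ((i : Fin 3) → Fin (e i + 1)) where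
  toFun s i := ⟨s.1 i, Nat.lt_succ_of_le (s.2 i)⟩
  invFun s := ⟨Finsupp.equivFunOnFinite.symm fun i => (s i : ℕ), fun i => by
    simpa using Nat.lt_succ_iff.mp (s i).2⟩
  left_inv s := by ext; simp
  right_inv s := by ext; simp

noncomputable def boxBasis (e : Fin 3 → ℕ) :
    Module.Basis ((i : Fin 3) → Fin (e i + 1)) ℝ (box e) :=
  (basisRestrictSupport ℝ {s : Fin 3 →₀ ℕ | ∀ i, s i ≤ e i}).reindex (boxIndexEquiv e)

instance (e : Fin 3 → ℕ) : FiniteDimensional ℝ (box e) := (boxBasis e).finiteDimensional_of_finite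

lemma finrank_box (e : Fin 3 → ℕ) : Module.finrank ℝ (box e) = ∏ i, (e i + 1) := by
  rw [Module.finrank_eq_card_basis (boxBasis e)]
  simp

lemma mul_mem_box {e e' : Fin 3 → ℕ} {f g : Poly3} (hf : f ∈ box e) (hg : g ∈ box e') :
    f * g ∈ box (e + e') := by
  rw [mem_box] at *
  intro i
  exact (degreeOf_mul_le i f g).trans (add_le_add (hf i) (hg i))

lemma box_mono {e e' : Fin 3 → ℕ} (h : e ≤ e') : box e ≤ box e' := by
  intro f hf
  rw [mem_box] at *
  exact fun i => (hf i).trans (h i)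

lemma totalDegree_le_of_mem_box {e : ℕ} {f : Poly3} (hf : f ∈ box (fun _ => e)) :
    f.totalDegree ≤ 3 * e := by
  rw [totalDegree]
  refine Finset.sup_le fun s hs => ?_
  rw [mem_box] at hf
  rw [Finsupp.sum_fintype _ _ (by simp), Fin.sum_univ_three]
  have := fun i => (le_degreeOf_of_mem_support i hs).trans (hf i)
  have h0 := this 0
  have h1 := this 1
  have h2 := this 2
  omega

lemma prod_mem_box {ι : Type*} (s : Finset ι) (F : ι → Poly3) (e : Fin 3 → ℕ)
    (h : ∀ i ∈ s, F i ∈ box e) : ∏ i ∈ s, F i ∈ box (s.card • e) := by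
  classical
  induction s using Finset.induction_on with
  | empty =>
    rw [mem_box]; intro i; simp [degreeOf_one]
  | insert a s ha ih =>
    rw [Finset.prod_insert ha, Finset.card_insert_of_notMem ha, add_smul, one_smul, add_comm]
    exact mul_mem_box (h _ (by simp)) (ih fun i hi => h i (by simp [hi]))

/-- The part of the ideal `(f, g)` of the shape `α f + β g` with controlled degrees. -/
noncomputable def combMap (e : Fin 3 → ℕ) (f g : Poly3) (d d' : Fin 3 → ℕ) :
    (box (e - d) × box (e - d')) →ₗ[ℝ] Poly3 :=
  LinearMap.coprod ((LinearMap.mulRight ℝ f).comp (box (e - d)).subtype)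
    ((LinearMap.mulRight ℝ g).comp (box (e - d')).subtype)

lemma combMap_apply (e : Fin 3 → ℕ) (f g : Poly3) (d d' : Fin 3 → ℕ)
    (z : box (e - d) × box (e - d')) :
    combMap e f g d d' z = z.1 * f + z.2 * g := by
  simp [combMap]

lemma box_dimension_arith (n d d' : ℕ) (a b : Fin 3 → ℕ) (ha : ∀ i, a i ≤ d) (hb : ∀ i, b i ≤ d')
    (h : ∀ i, a i + b i ≤ n) :
    n ^ 3 + ∏ i, (n - (a i + b i)) ≤ ∏ i, (n - a i) + ∏ i, (n - b i) + 6 * d * d' * n := by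
  simp only [Fin.prod_univ_three]
  have h0 := h 0
  have h1 := h 1
  have h2 := h 2
  zify [h0, h1, h2, (Nat.le_add_right _ _).trans h0, (Nat.le_add_right _ _).trans h1,
    (Nat.le_add_right _ _).trans h2, (Nat.le_add_left _ _).trans h0,
    (Nat.le_add_left _ _).trans h1, (Nat.le_add_left _ _).trans h2]
  have key : ∀ i j, (a i * b j : ℤ) ≤ d * d' := fun i j => by
    exact_mod_cast Nat.mul_le_mul (ha i) (hb j)
  have k1 := key 0 1
  have k2 := key 0 2
  have k3 := key 1 0
  have k4 := key 1 2
  have k5 := key 2 0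
  have k6 := key 2 1
  have hs : ((a 0 * b 1 + a 0 * b 2 + a 1 * b 0 + a 1 * b 2 + a 2 * b 0 + a 2 * b 1 : ℤ)) * n
      ≤ 6 * d * d' * n := by
    apply mul_le_mul_of_nonneg_right _ (by positivity)
    linarith
  have hpos : (0 : ℤ) ≤ (a 0 + b 0) * (a 1 + b 1) * (a 2 + b 2) - a 0 * a 1 * a 2
      - b 0 * b 1 * b 2 := by
    have : (0 : ℤ) ≤ a 0 * a 1 * b 2 + a 0 * b 1 * a 2 + a 0 * b 1 * b 2 + b 0 * a 1 * a 2
      + b 0 * a 1 * b 2 + b 0 * b 1 * a 2 := by positivity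
    linarith
  nlinarith [hs, hpos]

lemma finrank_range_combMap {f g : Poly3} (hf : Irreducible f) (hfg : ¬ f ∣ g) {n : ℕ}
    (hn : f.totalDegree + g.totalDegree < n) :
    n ^ 3 ≤ Module.finrank ℝ (LinearMap.range (combMap (fun _ => n - 1) f g
      (fun i => degreeOf i f) (fun i => degreeOf i g))) + 6 * f.totalDegree * g.totalDegree * n := by
  set φ := combMap (fun _ => n - 1) f g (fun i => degreeOf i f) (fun i => degreeOf i g) with hφ
  have hf0 : f ≠ 0 := hf.ne_zero
  have hg0 : g ≠ 0 := by rintro rfl; exact hfg (dvd_zero f)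
  have hda : ∀ i, degreeOf i f ≤ f.totalDegree := fun i => degreeOf_le_totalDegree f i
  have hdb : ∀ i, degreeOf i g ≤ g.totalDegree := fun i => degreeOf_le_totalDegree g i
  let E : Fin 3 → ℕ := fun i => n - 1 - (degreeOf i f + degreeOf i g)
  have hrn := LinearMap.finrank_range_add_finrank_ker φ
  have hker : Module.finrank ℝ (LinearMap.ker φ) ≤ Module.finrank ℝ (box E) := by
    let ψ : box E →ₗ[ℝ] (box ((fun _ => n - 1) - fun i => degreeOf i f) ×
        box ((fun _ => n - 1) - fun i => degreeOf i g)) :=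
      LinearMap.prod
        (LinearMap.codRestrict _ (-(LinearMap.mulRight ℝ g).comp (box E).subtype) (by
          intro c
          have := mul_mem_box c.2 (mem_box.2 (fun i => le_refl (degreeOf i g)))
          refine neg_mem (box_mono ?_ this)
          intro i
          have := hda i; have := hdb i
          simp [E]; omega))
        (LinearMap.codRestrict _ ((LinearMap.mulRight ℝ f).comp (box E).subtype) (by
          intro c
          have := mul_mem_box c.2 (mem_box.2 (fun i => le_refl (degreeOf i f)))
          refine box_mono ?_ this
          intro i
          have := hda i; have := hdb i
          simp [E]; omega))
    have hle : LinearMap.ker φ ≤ LinearMap.range ψ := by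
      rintro ⟨α, β⟩ hz
      rw [LinearMap.mem_ker, hφ, combMap_apply] at hz
      simp only at hz
      have hdvd : f ∣ (β : Poly3) * g := ⟨-α, by linear_combination hz⟩
      have hp : Prime f := hf.prime
      obtain ⟨c, hc⟩ := (hp.dvd_or_dvd hdvd).resolve_right hfg
      have hα : (α : Poly3) = -(c * g) := by
        have : f * ((α : Poly3) + c * g) = 0 := by rw [hc] at hz; linear_combination hz
        rcases mul_eq_zero.1 this with h | h
        · exact absurd h hf0
        · linear_combination h
      have hcE : c ∈ box E := by
        rw [mem_box]
        intro i
        by_cases hc0 : c = 0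
        · simp [hc0]
        have h1 := mem_box.1 β.2 i
        rw [hc, degreeOf_mul_eq hf0 hc0] at h1
        have := hda i; have := hdb i
        simp at h1
        simp [E]; omega
      refine ⟨⟨c, hcE⟩, ?_⟩
      ext1
      · apply Subtype.ext
        simp [ψ, hα]
      · apply Subtype.ext
        simp [ψ, hc, mul_comm]
    exact (Submodule.finrank_mono hle).trans (LinearMap.finrank_range_le ψ)
  rw [Module.finrank_prod, finrank_box, finrank_box] at hrn
  rw [finrank_box] at hker
  have harith := box_dimension_arith n f.totalDegree g.totalDegree (fun i => degreeOf i f)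
    (fun i => degreeOf i g) hda hdb (fun i => by have := hda i; have := hdb i; omega)
  have e1 : ∏ i, ((((fun _ => n - 1) - fun i => degreeOf i f : Fin 3 → ℕ)) i + 1) =
      ∏ i, (n - degreeOf i f) := by
    refine Finset.prod_congr rfl fun i _ => ?_
    have := hda i; simp; omega
  have e2 : ∏ i, ((((fun _ => n - 1) - fun i => degreeOf i g : Fin 3 → ℕ)) i + 1) =
      ∏ i, (n - degreeOf i g) := by
    refine Finset.prod_congr rfl fun i _ => ?_
    have := hdb i; simp; omega
  have e3 : ∏ i, (E i + 1) = ∏ i, (n - (degreeOf i f + degreeOf i g)) := by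
    refine Finset.prod_congr rfl fun i _ => ?_
    have := hda i; have := hdb i; simp [E]; omega
  rw [e1, e2] at hrn
  rw [e3] at hker
  omega

lemma range_combMap_le (f g : Poly3) (n : ℕ) (hn : f.totalDegree + g.totalDegree < n) :
    LinearMap.range (combMap (fun _ => n - 1) f g (fun i => degreeOf i f) (fun i => degreeOf i g))
      ≤ box (fun _ => n - 1) := by
  rintro _ ⟨z, rfl⟩
  rw [combMap_apply]
  have hda : ∀ i, degreeOf i f ≤ f.totalDegree := fun i => degreeOf_le_totalDegree f i
  have hdb : ∀ i, degreeOf i g ≤ g.totalDegree := fun i => degreeOf_le_totalDegree g i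
  refine add_mem (box_mono ?_ (mul_mem_box z.1.2 (mem_box.2 (fun i => le_refl (degreeOf i f)))))
    (box_mono ?_ (mul_mem_box z.2.2 (mem_box.2 (fun i => le_refl (degreeOf i g)))))
  · intro i; have := hda i; simp; omega
  · intro i; have := hdb i; simp; omega

/-- A subspace of `box` disjoint from the `combMap` part of `(f, g)` is small. -/
lemma finrank_le_of_disjoint {f g : Poly3} (hf : Irreducible f) (hfg : ¬ f ∣ g) {n : ℕ}
    (hn : f.totalDegree + g.totalDegree < n) (V : Submodule ℝ Poly3)
    (hV : V ≤ box (fun _ => n - 1))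
    (hdisj : ∀ α β : Poly3, α * f + β * g ∈ V → α * f + β * g = 0) :
    Module.finrank ℝ V ≤ 6 * f.totalDegree * g.totalDegree * n := by
  have h1 := finrank_range_combMap hf hfg hn
  have h2 := range_combMap_le f g n hn
  set K := LinearMap.range (combMap (fun _ => n - 1) f g (fun i => degreeOf i f)
    (fun i => degreeOf i g))
  have hd : V ⊓ K = ⊥ := by
    rw [eq_bot_iff]
    rintro z ⟨hz, ⟨w, hw⟩⟩
    rw [combMap_apply] at hw
    rw [Submodule.mem_bot, ← hw]
    exact hdisj _ _ (hw ▸ hz)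
  have : FiniteDimensional ℝ V := Submodule.finiteDimensional_of_le hV
  have h3 := Submodule.finrank_sup_add_finrank_inf_eq V K
  rw [hd, finrank_bot] at h3
  have h4 : Module.finrank ℝ ↥(V ⊔ K) ≤ Module.finrank ℝ (box (fun _ => n - 1)) :=
    Submodule.finrank_mono (sup_le hV h2)
  rw [finrank_box] at h4
  have e1 : ∏ i : Fin 3, ((fun _ : Fin 3 => n - 1) i + 1) = n ^ 3 := by
    simp; omega
  rw [e1] at h4
  omega

/-- Elimination of the last variable from two coprime polynomials. -/
lemma exists_elimination {f g : Poly3} (hf : Irreducible f) (hfg : ¬ f ∣ g) :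
    ∃ α β : Poly3, α * f + β * g ≠ 0 ∧ degreeOf 2 (α * f + β * g) = 0 := by
  by_contra! hcon
  set n := f.totalDegree + g.totalDegree + 6 * f.totalDegree * g.totalDegree + 1 with hn
  let e : Fin 3 → ℕ := ![n - 1, n - 1, 0]
  have h := finrank_le_of_disjoint hf hfg (n := n) (by omega) (box e)
    (box_mono (by intro i; fin_cases i <;> simp [e]))
    (by
      intro α β hV
      by_contra h0
      have := mem_box.1 hV 2
      exact hcon α β h0 (by simpa [e] using this))
  rw [finrank_box] at h
  simp only [Fin.prod_univ_three, e] at h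
  simp at h
  have hn1 : n - 1 + 1 = n := by omega
  rw [hn1] at h
  have : n ≤ 6 * f.totalDegree * g.totalDegree := Nat.le_of_mul_le_mul_right h (by omega)
  omega

/-- Restriction of a polynomial to a line. -/
noncomputable def res (ℓ : Line) : Poly3 →ₐ[ℝ] Polynomial ℝ :=
  aeval ![Polynomial.X, Polynomial.C ℓ.2.1 - Polynomial.X * Polynomial.C ℓ.1.1,
    Polynomial.X * Polynomial.C ℓ.2.2 - Polynomial.C ℓ.1.2]

/-- The point with first coordinate `t` of a line. -/
def pt (ℓ : Line) (t : ℝ) : Fin 3 → ℝ := ![t, ℓ.2.1 - t * ℓ.1.1, t * ℓ.2.2 - ℓ.1.2]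

lemma eval_res (ℓ : Line) (f : Poly3) (t : ℝ) : (res ℓ f).eval t = eval (pt ℓ t) f := by
  have h : (Polynomial.evalRingHom t).comp (res ℓ).toRingHom = eval (pt ℓ t) := by
    apply MvPolynomial.ringHom_ext
    · intro r; simp [res]
    · intro i; fin_cases i <;> simp [res, pt] <;> ring
  exact congrArg (fun F => F f) h

@[simp] lemma res_X0 (ℓ : Line) : res ℓ (X 0) = Polynomial.X := by simp [res]
@[simp] lemma res_X1 (ℓ : Line) :
    res ℓ (X 1) = Polynomial.C ℓ.2.1 - Polynomial.X * Polynomial.C ℓ.1.1 := by simp [res]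
@[simp] lemma res_X2 (ℓ : Line) :
    res ℓ (X 2) = Polynomial.X * Polynomial.C ℓ.2.2 - Polynomial.C ℓ.1.2 := by simp [res]
@[simp] lemma res_C (ℓ : Line) (c : ℝ) : res ℓ (C c) = Polynomial.C c := by
  simp [res]

lemma natDegree_res_le (ℓ : Line) (f : Poly3) : (res ℓ f).natDegree ≤ f.totalDegree := by
  rw [res, aeval_def, eval₂_eq']
  refine Polynomial.natDegree_sum_le_of_forall_le _ _ fun s hs => ?_
  refine (Polynomial.natDegree_C_mul_le _ _).trans ?_
  have hd : s.sum (fun _ e => e) ≤ f.totalDegree := le_totalDegree hs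
  refine le_trans ?_ hd
  rw [Finsupp.sum_fintype _ _ (by simp)]
  refine (Polynomial.natDegree_prod_le _ _).trans (Finset.sum_le_sum fun i _ => ?_)
  refine (Polynomial.natDegree_pow_le).trans ?_
  have : (![Polynomial.X, Polynomial.C ℓ.2.1 - Polynomial.X * Polynomial.C ℓ.1.1,
    Polynomial.X * Polynomial.C ℓ.2.2 - Polynomial.C ℓ.1.2] i : Polynomial ℝ).natDegree ≤ 1 := by
    fin_cases i
    · simp
    · show (Polynomial.C ℓ.2.1 - Polynomial.X * Polynomial.C ℓ.1.1 : Polynomial ℝ).natDegree ≤ 1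
      compute_degree
    · show (Polynomial.X * Polynomial.C ℓ.2.2 - Polynomial.C ℓ.1.2 : Polynomial ℝ).natDegree ≤ 1
      compute_degree
  calc s i * _ ≤ s i * 1 := Nat.mul_le_mul_left _ this
    _ = s i := mul_one _

/-- A linear form vanishing on the second line and not on the first. -/
lemma exists_separating_form {ℓ ℓ' : Line} (h : ℓ ≠ ℓ') :
    ∃ w : Poly3, w ∈ box (fun _ => 1) ∧ res ℓ' w = 0 ∧ res ℓ w ≠ 0 := by
  have hX : ∀ i j : Fin 3, degreeOf i (X j : Poly3) ≤ 1 := fun i j => by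
    rw [degreeOf_X]; split_ifs <;> simp
  by_cases h1 : ℓ.1.1 = ℓ'.1.1 ∧ ℓ.2.1 = ℓ'.2.1
  · refine ⟨X 2 - C ℓ'.2.2 * X 0 + C ℓ'.1.2, ?_, ?_, ?_⟩
    · refine add_mem (sub_mem ?_ ?_) ?_ <;> rw [mem_box] <;> intro i
      · exact hX _ _
      · exact (degreeOf_C_mul_le _ _ _).trans (hX _ _)
      · simp
    · simp
    · intro h0
      have e0 := congrArg (Polynomial.eval 0) h0
      have e1 := congrArg (Polynomial.eval 1) h0
      simp at e0 e1
      apply h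
      ext
      · exact h1.1
      · linarith
      · exact h1.2
      · linarith
  · refine ⟨X 1 + C ℓ'.1.1 * X 0 - C ℓ'.2.1, ?_, ?_, ?_⟩
    · refine sub_mem (add_mem ?_ ?_) ?_ <;> rw [mem_box] <;> intro i
      · exact hX _ _
      · exact (degreeOf_C_mul_le _ _ _).trans (hX _ _)
      · simp
    · simp
    · intro h0
      have e0 := congrArg (Polynomial.eval 0) h0
      have e1 := congrArg (Polynomial.eval 1) h0
      simp at e0 e1
      exact h1 ⟨by linarith, by linarith⟩

/-- Bezout-type bound for the number of lines in the intersection of two surfaces. -/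
lemma card_lines_le {f g : Poly3} (hf : Irreducible f) (hfg : ¬ f ∣ g) (F : Finset Line)
    (hF : ∀ ℓ ∈ F, res ℓ f = 0) (hG : ∀ ℓ ∈ F, res ℓ g = 0) :
    F.card ≤ 6 * f.totalDegree * g.totalDegree := by
  classical
  by_contra! hcon
  choose! w hw using fun (ℓ ℓ' : Line) (h : ℓ ≠ ℓ') => exists_separating_form h
  let G : Line → Poly3 := fun ℓ => ∏ ℓ' ∈ F.erase ℓ, w ℓ ℓ'
  set L := F.card with hL
  set n := L * L + f.totalDegree + g.totalDegree + 1 with hn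
  have hLn : L ≤ n := by nlinarith
  let ι : Polynomial.degreeLT ℝ (n - L) →ₗ[ℝ] Poly3 :=
    (Polynomial.aeval (X 0 : Poly3)).toLinearMap.comp (Polynomial.degreeLT ℝ (n - L)).subtype
  have hres : ∀ ℓ (p : Polynomial ℝ), res ℓ (Polynomial.aeval (X 0 : Poly3) p) = p := by
    intro ℓ p
    rw [← Polynomial.aeval_algHom_apply, res_X0, Polynomial.aeval_X_left_apply]
  have hGne : ∀ ℓ ∈ F, res ℓ (G ℓ) ≠ 0 := by
    intro ℓ _
    simp only [G, map_prod]
    rw [Finset.prod_ne_zero_iff]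
    intro ℓ' h'
    exact (hw ℓ ℓ' (Finset.ne_of_mem_erase h').symm).2.2
  have hGz : ∀ ℓ ∈ F, ∀ ℓ' ∈ F, ℓ' ≠ ℓ → res ℓ (G ℓ') = 0 := by
    intro ℓ h ℓ' _ hne
    simp only [G, map_prod]
    exact Finset.prod_eq_zero (i := ℓ) (by simp [hne.symm, h]) (hw ℓ' ℓ hne).2.1
  let Φ : (F → Polynomial.degreeLT ℝ (n - L)) →ₗ[ℝ] Poly3 :=
    ∑ ℓ : F, ((LinearMap.mulRight ℝ (G ℓ)).comp ι).comp (LinearMap.proj ℓ)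
  have hΦ : ∀ p, Φ p = ∑ ℓ : F, Polynomial.aeval (X 0 : Poly3) (p ℓ : Polynomial ℝ) * G ℓ := by
    intro p; simp [Φ, ι]
  have hresΦ : ∀ p (ℓ : F), res ℓ (Φ p) = (p ℓ : Polynomial ℝ) * res ℓ (G ℓ) := by
    intro p ℓ
    rw [hΦ, map_sum, Finset.sum_eq_single ℓ]
    · rw [map_mul, hres]
    · intro ℓ' _ hne
      rw [map_mul, hGz ℓ ℓ.2 ℓ' ℓ'.2 (fun h => hne (Subtype.ext h)), mul_zero]
    · simp
  have hzero : ∀ p, (∀ ℓ : F, res ℓ (Φ p) = 0) → p = 0 := by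
    intro p hp
    funext ℓ
    have := hp ℓ
    rw [hresΦ] at this
    exact Subtype.ext ((mul_eq_zero.1 this).resolve_right (hGne ℓ ℓ.2))
  have hinj : Function.Injective Φ := by
    rw [injective_iff_map_eq_zero]
    intro p hp
    exact hzero p fun ℓ => by rw [hp, map_zero]
  have hbox : LinearMap.range Φ ≤ box (fun _ => n - 1) := by
    rintro _ ⟨p, rfl⟩
    rw [hΦ]
    refine sum_mem fun ℓ _ => ?_
    have h1 : G ℓ ∈ box ((F.erase ℓ.1).card • fun _ => 1) :=
      prod_mem_box _ _ _ fun ℓ' h' => (hw ℓ ℓ' (Finset.ne_of_mem_erase h').symm).1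
    have h2 : Polynomial.aeval (X 0 : Poly3) (p ℓ : Polynomial ℝ) ∈ box (fun _ => n - L) := by
      rw [Polynomial.aeval_eq_sum_range]
      refine sum_mem fun k hk => Submodule.smul_mem _ _ ?_
      rw [mem_box]
      intro i
      have hk' : k ≤ n - L := by
        have := Polynomial.mem_degreeLT.1 (p ℓ).2
        rw [Finset.mem_range] at hk
        by_cases h0 : (p ℓ : Polynomial ℝ) = 0
        · rw [h0] at hk; simp at hk; omega
        · rw [← Polynomial.natDegree_lt_iff_degree_lt h0] at this
          omega
      refine (degreeOf_pow_le _ _ _).trans ?_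
      rw [degreeOf_X]
      split_ifs <;> simp [hk']
    refine box_mono ?_ (mul_mem_box h2 h1)
    intro i
    have hpos : 0 < L := Finset.card_pos.2 ⟨ℓ.1, ℓ.2⟩
    simp [Finset.card_erase_of_mem ℓ.2]
    omega
  have hfin := finrank_le_of_disjoint hf hfg (n := n) (by omega) (LinearMap.range Φ) hbox (by
    rintro α β ⟨p, hp⟩
    rw [← hp]
    have : p = 0 := hzero p fun ℓ => by
      rw [hp, map_add, map_mul, map_mul, hF ℓ ℓ.2, hG ℓ ℓ.2]; simp
    rw [this, map_zero])
  rw [LinearMap.finrank_range_of_inj hinj, Module.finrank_pi_fintype] at hfin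
  have hdl : Module.finrank ℝ (Polynomial.degreeLT ℝ (n - L)) = n - L := by
    rw [LinearEquiv.finrank_eq (Polynomial.degreeLTEquiv ℝ (n - L))]; simp
  rw [hdl] at hfin
  simp only [Finset.sum_const, Finset.card_univ, Fintype.card_coe, smul_eq_mul, ← hL] at hfin
  have h7 : (6 * f.totalDegree * g.totalDegree + 1) * n ≤ L * n := Nat.mul_le_mul_right _ hcon
  have h8 : L * (n - L) = L * n - L * L := Nat.mul_sub _ _ _
  have h9 : L * L ≤ L * n := Nat.mul_le_mul_left _ hLn
  have h10 : (6 * f.totalDegree * g.totalDegree + 1) * n =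
    6 * f.totalDegree * g.totalDegree * n + n := by ring
  omega

section HamSandwich

open Filter Topology

variable {α : Type*} {n : ℕ}

/-- The determinant whose first row is `ψ` and whose other rows are `a`. -/
noncomputable def rowDet (a : Fin n → Fin (n + 1) → ℝ) (ψ : Fin (n + 1) → ℝ) : ℝ :=
  Matrix.det (Matrix.of (Fin.cons ψ a : Fin (n + 1) → Fin (n + 1) → ℝ))

/-- The vector of cofactors of the first row. -/
noncomputable def cofVec (a : Fin n → Fin (n + 1) → ℝ) (j : Fin (n + 1)) : ℝ :=
  (-1) ^ (j : ℕ) * Matrix.det ((Matrix.of a).submatrix id j.succAbove)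

lemma rowDet_eq (a : Fin n → Fin (n + 1) → ℝ) (ψ : Fin (n + 1) → ℝ) :
    rowDet a ψ = ψ ⬝ᵥ cofVec a := by
  rw [rowDet, Matrix.det_succ_row_zero]
  unfold dotProduct cofVec
  refine Finset.sum_congr rfl fun j _ => ?_
  have : Matrix.submatrix (Matrix.of (Fin.cons ψ a : Fin (n + 1) → Fin (n + 1) → ℝ)) Fin.succ j.succAbove
      = (Matrix.of a).submatrix id j.succAbove := by
    ext i k; simp [Matrix.submatrix]
  rw [this]
  have h0 : (Matrix.of (Fin.cons ψ a : Fin (n + 1) → Fin (n + 1) → ℝ)) 0 j = ψ j := rfl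
  rw [h0]
  ring

lemma rowDet_update_swap (a : Fin n → Fin (n + 1) → ℝ) (i : Fin n) (x y : Fin (n + 1) → ℝ) :
    rowDet (Function.update a i y) x = - rowDet (Function.update a i x) y := by
  unfold rowDet
  have h : Matrix.of (Fin.cons x (Function.update a i y) : Fin (n + 1) → Fin (n + 1) → ℝ) =
      Matrix.submatrix (Matrix.of (Fin.cons y (Function.update a i x) :
        Fin (n + 1) → Fin (n + 1) → ℝ))
        (Equiv.swap 0 i.succ) id := by
    ext j k
    refine Fin.cases ?_ (fun j => ?_) j
    · simp [Matrix.submatrix, -Fin.cons_update]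
    · by_cases hj : j = i
      · subst hj
        rw [Matrix.submatrix_apply, Equiv.swap_apply_right]
        simp [-Fin.cons_update]
      · have h1 : (j.succ : Fin (n + 1)) ≠ i.succ := fun h => hj (Fin.succ_injective _ h)
        simp [Matrix.submatrix, Equiv.swap_apply_of_ne_of_ne (Fin.succ_ne_zero j) h1, hj]
  rw [h, Matrix.det_permute, Equiv.Perm.sign_swap (Fin.succ_ne_zero i).symm]
  simp

open Classical in
lemma ham_sandwich_average (S : Fin n → Finset α) (a : α → Fin (n + 1) → ℝ) (i : Fin n) :
    3 * ∑ χ ∈ Fintype.piFinset S, (((S i ×ˢ S i).filter fun p =>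
      0 < rowDet (a ∘ χ) (a p.1) * rowDet (a ∘ χ) (a p.2)).card) ≤
    2 * ((Fintype.piFinset S).card * (S i).card ^ 2) := by
  let X := Fintype.piFinset S ×ˢ (S i ×ˢ S i)
  let G : (Fin n → α) × (α × α) → ℕ := fun q =>
    if 0 < rowDet (a ∘ q.1) (a q.2.1) * rowDet (a ∘ q.1) (a q.2.2) then 1 else 0
  let σ : (Fin n → α) × (α × α) → (Fin n → α) × (α × α) := fun q =>
    (Function.update q.1 i q.2.1, (q.1 i, q.2.2))
  let τ : (Fin n → α) × (α × α) → (Fin n → α) × (α × α) := fun q =>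
    (Function.update q.1 i q.2.2, (q.2.1, q.1 i))
  have hX : ∀ q, q ∈ X ↔ (∀ j, q.1 j ∈ S j) ∧ q.2.1 ∈ S i ∧ q.2.2 ∈ S i := by
    intro q; simp [X, Fintype.mem_piFinset]
  have hupd : ∀ (χ : Fin n → α) (s : α), (∀ j, χ j ∈ S j) → s ∈ S i →
      ∀ j, Function.update χ i s j ∈ S j := by
    intro χ s h hs j
    by_cases hj : j = i
    · subst hj; simpa
    · simpa [hj] using h j
  have hσ : ∑ q ∈ X, G (σ q) = ∑ q ∈ X, G q := by
    refine Finset.sum_bij (fun q _ => σ q) ?_ ?_ ?_ (fun _ _ => rfl)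
    · intro q hq
      rw [hX] at hq ⊢
      exact ⟨hupd _ _ hq.1 hq.2.1, hq.1 i, hq.2.2⟩
    · intro q _ q' _ h
      have : σ (σ q) = σ (σ q') := by rw [h]
      simpa [σ] using this
    · intro q hq
      refine ⟨σ q, ?_, by simp [σ]⟩
      rw [hX] at hq ⊢
      exact ⟨hupd _ _ hq.1 hq.2.1, hq.1 i, hq.2.2⟩
  have hτ : ∑ q ∈ X, G (τ q) = ∑ q ∈ X, G q := by
    refine Finset.sum_bij (fun q _ => τ q) ?_ ?_ ?_ (fun _ _ => rfl)
    · intro q hq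
      rw [hX] at hq ⊢
      exact ⟨hupd _ _ hq.1 hq.2.2, hq.2.1, hq.1 i⟩
    · intro q _ q' _ h
      have : τ (τ q) = τ (τ q') := by rw [h]
      simpa [τ] using this
    · intro q hq
      refine ⟨τ q, ?_, by simp [τ]⟩
      rw [hX] at hq ⊢
      exact ⟨hupd _ _ hq.1 hq.2.2, hq.2.1, hq.1 i⟩
  have hpt : ∀ q, G q + G (σ q) + G (τ q) ≤ 2 := by
    rintro ⟨χ, s, s'⟩
    by_contra! hcon
    have key : ∀ x y : α, rowDet (a ∘ Function.update χ i y) (a x) =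
        - rowDet (a ∘ Function.update χ i x) (a y) := by
      intro x y
      rw [Function.comp_update, Function.comp_update]
      exact rowDet_update_swap _ _ _ _
    have h1 : 0 < rowDet (a ∘ χ) (a s) * rowDet (a ∘ χ) (a s') := by
      by_contra h; simp only [G, σ, τ, if_neg h] at hcon; split_ifs at hcon <;> omega
    have h2 : 0 < rowDet (a ∘ Function.update χ i s) (a (χ i)) *
        rowDet (a ∘ Function.update χ i s) (a s') := by
      by_contra h; simp only [G, σ, τ, if_neg h] at hcon; split_ifs at hcon <;> omega
    have h3 : 0 < rowDet (a ∘ Function.update χ i s') (a s) *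
        rowDet (a ∘ Function.update χ i s') (a (χ i)) := by
      by_contra h; simp only [G, σ, τ, if_neg h] at hcon; split_ifs at hcon <;> omega
    have e1 := key (χ i) s
    have e2 := key (χ i) s'
    have e3 := key s s'
    rw [Function.update_eq_self] at e1 e2
    rw [e1] at h2
    rw [e2, e3] at h3
    have h4 := mul_pos (mul_pos h1 h2) h3
    nlinarith [sq_nonneg (rowDet (a ∘ χ) (a s) * rowDet (a ∘ χ) (a s') *
      rowDet (a ∘ Function.update χ i s) (a s'))]
  have hsum : ∑ χ ∈ Fintype.piFinset S, (((S i ×ˢ S i).filter fun p =>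
      0 < rowDet (a ∘ χ) (a p.1) * rowDet (a ∘ χ) (a p.2)).card) = ∑ q ∈ X, G q := by
    rw [Finset.sum_product]
    refine Finset.sum_congr rfl fun χ _ => ?_
    rw [Finset.card_filter]
  have hcard : X.card = (Fintype.piFinset S).card * (S i).card ^ 2 := by
    simp only [X, Finset.card_product]; ring
  calc 3 * _ = ∑ q ∈ X, G q + ∑ q ∈ X, G (σ q) + ∑ q ∈ X, G (τ q) := by
        rw [hsum, hσ, hτ]; ring
    _ = ∑ q ∈ X, (G q + G (σ q) + G (τ q)) := by rw [Finset.sum_add_distrib, Finset.sum_add_distrib]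
    _ ≤ ∑ q ∈ X, 2 := Finset.sum_le_sum fun q _ => hpt q
    _ = _ := by rw [Finset.sum_const, hcard, smul_eq_mul, mul_comm]

open Classical in
lemma ham_sandwich_generic (S : Fin n → Finset α) (hS : ∀ i, (S i).Nonempty)
    (a : α → Fin (n + 1) → ℝ) (hgen : ∀ χ ∈ Fintype.piFinset S, ∃ ψ, rowDet (a ∘ χ) ψ ≠ 0) :
    ∃ v : Fin (n + 1) → ℝ, v ≠ 0 ∧ 3 * ∑ i, (((S i ×ˢ S i).filter fun p =>
      0 < (a p.1 ⬝ᵥ v) * (a p.2 ⬝ᵥ v)).card) ≤ 2 * ∑ i, (S i).card ^ 2 := by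
  have hne : (Fintype.piFinset S).Nonempty := by
    choose f hf using hS
    exact ⟨f, Fintype.mem_piFinset.2 hf⟩
  have h : ∑ χ ∈ Fintype.piFinset S, 3 * ∑ i, (((S i ×ˢ S i).filter fun p =>
      0 < rowDet (a ∘ χ) (a p.1) * rowDet (a ∘ χ) (a p.2)).card) ≤
      ∑ χ ∈ Fintype.piFinset S, 2 * ∑ i, (S i).card ^ 2 := by
    rw [← Finset.mul_sum, Finset.sum_comm, Finset.mul_sum, Finset.sum_const, smul_eq_mul,
      mul_left_comm, Finset.mul_sum, Finset.mul_sum]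
    exact Finset.sum_le_sum fun i _ => ham_sandwich_average S a i
  obtain ⟨χ, hχ, hle⟩ := Finset.exists_le_of_sum_le hne h
  refine ⟨cofVec (a ∘ χ), ?_, ?_⟩
  · intro h0
    obtain ⟨ψ, hψ⟩ := hgen χ hχ
    rw [rowDet_eq, h0] at hψ
    simp at hψ
  · simpa only [rowDet_eq] using hle

lemma eventually_generic (S : Fin n → Finset α) (hd : ∀ i j, i ≠ j → Disjoint (S i) (S j))
    (a : α → Fin (n + 1) → ℝ) : ∃ w : α → Fin (n + 1) → ℝ, ∀ᶠ ε : ℝ in 𝓝[≠] 0,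
      ∀ χ ∈ Fintype.piFinset S, ∃ ψ, rowDet ((fun s => a s + ε • w s) ∘ χ) ψ ≠ 0 := by
  classical
  obtain ⟨lab, hlab⟩ : ∃ lab : α → ℝ, Set.InjOn lab (Finset.univ.biUnion S : Finset α) ∧
      ∀ s ∈ Finset.univ.biUnion S, lab s ≠ -1 := by
    let e := (Finset.univ.biUnion S).equivFin
    refine ⟨fun s => if h : s ∈ Finset.univ.biUnion S then (e ⟨s, h⟩ : ℕ) else 0, ?_, ?_⟩
    · intro s hs s' hs' h
      have hs2 : s ∈ Finset.univ.biUnion S := hs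
      have hs2' : s' ∈ Finset.univ.biUnion S := hs'
      simp only [hs2, hs2', dif_pos] at h
      have := e.injective (Fin.ext (Nat.cast_injective h))
      exact congrArg Subtype.val this
    · intro s hs
      simp only [hs, dif_pos]
      have : (0 : ℝ) ≤ (e ⟨s, hs⟩ : ℕ) := Nat.cast_nonneg _
      linarith
  refine ⟨fun s j => lab s ^ (j : ℕ), ?_⟩
  rw [Filter.eventually_all_finset]
  intro χ hχ
  rw [Fintype.mem_piFinset] at hχ
  let p : Fin (n + 1) → ℝ := Fin.cons (-1) (lab ∘ χ)
  let W : Matrix (Fin (n + 1)) (Fin (n + 1)) ℝ := Matrix.vandermonde p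
  let M : Matrix (Fin (n + 1)) (Fin (n + 1)) ℝ :=
    Matrix.of (Fin.cons 0 (a ∘ χ) : Fin (n + 1) → Fin (n + 1) → ℝ)
  have hmem : ∀ i, χ i ∈ Finset.univ.biUnion S := fun i =>
    Finset.mem_biUnion.2 ⟨i, Finset.mem_univ _, hχ i⟩
  have hp : Function.Injective p := by
    rw [Fin.cons_injective_iff]
    constructor
    · rintro ⟨i, hi⟩
      exact hlab.2 _ (hmem i) hi
    · intro i j hij
      by_contra hne
      have := hlab.1 (hmem i) (hmem j) hij
      exact Finset.disjoint_left.1 (hd i j hne) (hχ i) (this ▸ hχ j)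
  have hW : W.det ≠ 0 := Matrix.det_vandermonde_ne_zero_iff.2 hp
  let Q : Polynomial ℝ := Matrix.det ((Polynomial.X : Polynomial ℝ) • W.map Polynomial.C + M.map Polynomial.C)
  have hQ : Q ≠ 0 := by
    intro h0
    have := Polynomial.coeff_det_X_add_C_card W M
    rw [show Matrix.det ((Polynomial.X : Polynomial ℝ) • W.map Polynomial.C + M.map Polynomial.C)
      = Q from rfl, h0] at this
    exact hW this.symm
  have hev : ∀ᶠ ε : ℝ in 𝓝[≠] 0, Q.eval ε ≠ 0 := by
    have hfin : {ε : ℝ | Q.eval ε = 0}.Finite := by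
      refine (Q.roots.toFinset.finite_toSet).subset fun ε h => ?_
      simp only [Finset.mem_coe, Multiset.mem_toFinset]
      exact (Polynomial.mem_roots hQ).2 h
    have : ({ε : ℝ | Q.eval ε = 0} \ {0})ᶜ ∈ 𝓝 (0 : ℝ) :=
      (hfin.subset Set.sdiff_subset).isClosed.isOpen_compl.mem_nhds (by simp)
    rw [eventually_nhdsWithin_iff]
    filter_upwards [this] with ε h1 h2 h3
    exact h1 ⟨h3, h2⟩
  filter_upwards [hev, self_mem_nhdsWithin] with ε hε hε0
  refine ⟨ε • (fun j : Fin (n + 1) => (-1 : ℝ) ^ (j : ℕ)), ?_⟩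
  have : Q.eval ε = rowDet ((fun s => a s + ε • fun j : Fin (n + 1) => lab s ^ (j : ℕ)) ∘ χ)
      (ε • (fun j : Fin (n + 1) => (-1 : ℝ) ^ (j : ℕ))) := by
    rw [← Polynomial.coe_evalRingHom, RingHom.map_det, rowDet]
    congr 1
    ext i j
    refine Fin.cases ?_ (fun i => ?_) i
    · have e1 : W 0 j = (-1 : ℝ) ^ (j : ℕ) := rfl
      have e2 : M 0 j = 0 := rfl
      simp [e1, e2]
    · have e1 : W i.succ j = lab (χ i) ^ (j : ℕ) := rfl
      have e2 : M i.succ j = a (χ i) j := rfl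
      simp [e1, e2, add_comm]
  rwa [← this]

open Classical in
/-- Hyperplane bisection on average: a nonzero `v` roughly splitting every `S i`. -/
lemma ham_sandwich (S : Fin n → Finset α) (hS : ∀ i, (S i).Nonempty)
    (hd : ∀ i j, i ≠ j → Disjoint (S i) (S j)) (a : α → Fin (n + 1) → ℝ) :
    ∃ v : Fin (n + 1) → ℝ, v ≠ 0 ∧ 3 * ∑ i, (((S i ×ˢ S i).filter fun p =>
      0 < (a p.1 ⬝ᵥ v) * (a p.2 ⬝ᵥ v)).card) ≤ 2 * ∑ i, (S i).card ^ 2 := by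
  obtain ⟨w, hw⟩ := eventually_generic S hd a
  have h1 : ∀ᶠ ε : ℝ in 𝓝[≠] 0, ∃ v : Fin (n + 1) → ℝ, v ∈ Metric.sphere (0 : Fin (n + 1) → ℝ) 1 ∧
      3 * ∑ i, (((S i ×ˢ S i).filter fun p =>
      0 < ((a p.1 + ε • w p.1) ⬝ᵥ v) * ((a p.2 + ε • w p.2) ⬝ᵥ v)).card) ≤
        2 * ∑ i, (S i).card ^ 2 := by
    filter_upwards [hw] with ε hε
    obtain ⟨v, hv, hle⟩ := ham_sandwich_generic S hS _ hε
    have hn : 0 < ‖v‖ := norm_pos_iff.2 hv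
    refine ⟨‖v‖⁻¹ • v, ?_, ?_⟩
    · simp [norm_smul, hn.ne']
    · refine le_of_eq_of_le (congrArg _ (Finset.sum_congr rfl fun i _ => congrArg _
        (Finset.filter_congr fun p _ => ?_))) hle
      rw [dotProduct_smul, dotProduct_smul, smul_eq_mul, smul_eq_mul]
      rw [show ‖v‖⁻¹ * ((a p.1 + ε • w p.1) ⬝ᵥ v) * (‖v‖⁻¹ * ((a p.2 + ε • w p.2) ⬝ᵥ v)) =
        (‖v‖⁻¹ * ‖v‖⁻¹) * (((a p.1 + ε • w p.1) ⬝ᵥ v) * ((a p.2 + ε • w p.2) ⬝ᵥ v)) by ring]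
      rw [mul_pos_iff_of_pos_left (by positivity)]
  obtain ⟨u, hu⟩ := Filter.exists_seq_tendsto (𝓝[≠] (0 : ℝ))
  have h2 := hu.eventually h1
  choose! V hV using fun (k : ℕ) (h : ∃ v : Fin (n + 1) → ℝ,
      v ∈ Metric.sphere (0 : Fin (n + 1) → ℝ) 1 ∧ 3 * ∑ i, (((S i ×ˢ S i).filter fun p =>
      0 < ((a p.1 + u k • w p.1) ⬝ᵥ v) * ((a p.2 + u k • w p.2) ⬝ᵥ v)).card) ≤
        2 * ∑ i, (S i).card ^ 2) => h
  obtain ⟨v, hv, φ, hφ, hlim⟩ := (isCompact_sphere (0 : Fin (n + 1) → ℝ) 1).tendsto_subseq'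
    (x := V) (h2.mono fun k hk => (hV k hk).1).frequently
  refine ⟨v, ?_, ?_⟩
  · rintro rfl; simp at hv
  have hu0 : Tendsto (u ∘ φ) atTop (𝓝 0) :=
    (tendsto_nhdsWithin_iff.1 hu).1.comp hφ.tendsto_atTop
  have hdot : ∀ s, Tendsto (fun k => (a s + u (φ k) • w s) ⬝ᵥ V (φ k)) atTop (𝓝 (a s ⬝ᵥ v)) := by
    intro s
    have h3 : Tendsto (fun k => a s + u (φ k) • w s) atTop (𝓝 (a s)) := by
      have := (tendsto_const_nhds (x := a s)).add (hu0.smul_const (w s))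
      simpa using this
    unfold dotProduct
    refine tendsto_finsetSum _ fun j _ => ?_
    exact ((tendsto_pi_nhds.1 h3) j).mul ((tendsto_pi_nhds.1 hlim) j)
  have hpos : ∀ᶠ k in atTop, ∀ i ∈ (Finset.univ : Finset (Fin n)), ∀ p ∈ S i ×ˢ S i,
      0 < (a p.1 ⬝ᵥ v) * (a p.2 ⬝ᵥ v) →
      0 < ((a p.1 + u (φ k) • w p.1) ⬝ᵥ V (φ k)) * ((a p.2 + u (φ k) • w p.2) ⬝ᵥ V (φ k)) := by
    rw [Filter.eventually_all_finset]
    intro i _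
    rw [Filter.eventually_all_finset]
    intro p _
    by_cases h : 0 < (a p.1 ⬝ᵥ v) * (a p.2 ⬝ᵥ v)
    · filter_upwards [((hdot p.1).mul (hdot p.2)).eventually (lt_mem_nhds h)] with k hk _
      exact hk
    · exact Eventually.of_forall fun k h' => absurd h' h
  obtain ⟨k, hk1, hk2⟩ := (hpos.and (hφ.tendsto_atTop.eventually h2)).exists
  refine le_trans ?_ (hV (φ k) hk2).2
  refine Nat.mul_le_mul_left _ (Finset.sum_le_sum fun i hi => Finset.card_le_card ?_)
  intro p hp
  rw [Finset.mem_filter] at hp ⊢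
  exact ⟨hp.1, hk1 i hi p hp.1 hp.2⟩

end HamSandwich

/-- Two points lie strictly on the same side of every surface of the list. -/
def SameCell (l : List Poly3) (p q : Fin 3 → ℝ) : Prop := ∀ f ∈ l, 0 < eval p f * eval q f

lemma SameCell.symm {l : List Poly3} {p q : Fin 3 → ℝ} (h : SameCell l p q) : SameCell l q p :=
  fun f hf => by rw [mul_comm]; exact h f hf

lemma SameCell.trans {l : List Poly3} {p q r : Fin 3 → ℝ} (h : SameCell l p q)
    (h' : SameCell l q r) : SameCell l p r := fun f hf => by
  have h1 := h f hf
  have h2 := h' f hf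
  rcases pos_and_pos_or_neg_and_neg_of_mul_pos h1 with h3 | h3 <;>
  rcases pos_and_pos_or_neg_and_neg_of_mul_pos h2 with h4 | h4
  · exact mul_pos h3.1 h4.2
  · linarith [h3.2, h4.1]
  · linarith [h3.2, h4.1]
  · exact mul_pos_of_neg_of_neg h3.1 h4.2

lemma sameCell_cons {f : Poly3} {l : List Poly3} {p q : Fin 3 → ℝ} :
    SameCell (f :: l) p q ↔ 0 < eval p f * eval q f ∧ SameCell l p q := by
  simp [SameCell]

open Classical in
/-- The ordered pairs of points of `S` in a common cell. -/
noncomputable def cellPairs (S : Finset (Fin 3 → ℝ)) (l : List Poly3) :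
    Finset ((Fin 3 → ℝ) × (Fin 3 → ℝ)) := (S ×ˢ S).filter fun p => SameCell l p.1 p.2

lemma mem_cellPairs {S : Finset (Fin 3 → ℝ)} {l : List Poly3} {p : (Fin 3 → ℝ) × (Fin 3 → ℝ)} :
    p ∈ cellPairs S l ↔ (p.1 ∈ S ∧ p.2 ∈ S) ∧ SameCell l p.1 p.2 := by
  simp [cellPairs]

lemma partition_step (S : Finset (Fin 3 → ℝ)) (l : List Poly3) (e : ℕ)
    (he : 4 * S.card ^ 2 < (e + 1) ^ 3 * (cellPairs S l).card) :
    ∃ f : Poly3, f ≠ 0 ∧ f.totalDegree ≤ 3 * e ∧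
      4 * (cellPairs S (f :: l)).card ≤ 3 * (cellPairs S l).card := by
  classical
  set Ψ := (cellPairs S l).card with hΨ
  let cell : (Fin 3 → ℝ) → Finset (Fin 3 → ℝ) := fun p => S.filter fun q => SameCell l p q
  let T := S.filter fun p => SameCell l p p
  have hcell : ∀ p q, SameCell l p q → cell p = cell q := by
    intro p q h
    refine Finset.filter_congr fun r _ => ⟨fun h' => h.symm.trans h', fun h' => h.trans h'⟩
  let Big := (T.image cell).filter fun c => Ψ < 4 * S.card * c.card
  have hBigS : ∀ c ∈ Big, c ⊆ S := by
    intro c hc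
    simp only [Big, Finset.mem_filter, Finset.mem_image] at hc
    obtain ⟨⟨p, _, rfl⟩, _⟩ := hc
    exact Finset.filter_subset _ _
  have hBigcell : ∀ c ∈ Big, ∀ p ∈ c, cell p = c := by
    intro c hc p hp
    simp only [Big, Finset.mem_filter, Finset.mem_image] at hc
    obtain ⟨⟨p', _, rfl⟩, _⟩ := hc
    exact (hcell _ _ (Finset.mem_filter.1 hp).2).symm
  have hdisj : ∀ c ∈ Big, ∀ c' ∈ Big, c ≠ c' → Disjoint c c' := by
    intro c hc c' hc' hne
    rw [Finset.disjoint_left]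
    intro p hp hp'
    exact hne ((hBigcell c hc p hp).symm.trans (hBigcell c' hc' p hp'))
  have hBigne : ∀ c ∈ Big, c.Nonempty := by
    intro c hc
    simp only [Big, Finset.mem_filter] at hc
    rw [← Finset.card_pos]
    by_contra h
    have : c.card = 0 := by omega
    rw [this] at hc
    omega
  set n := Big.card with hn
  have hnlt : n < (e + 1) ^ 3 := by
    have h1 : ∑ c ∈ Big, c.card ≤ S.card := by
      rw [← Finset.card_biUnion (fun c hc c' hc' hne => hdisj c hc c' hc' hne)]
      exact Finset.card_le_card (Finset.biUnion_subset.2 hBigS)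
    have h2 : n * Ψ ≤ 4 * S.card * ∑ c ∈ Big, c.card := by
      rw [Finset.mul_sum, hn, ← smul_eq_mul, ← Finset.sum_const]
      exact Finset.sum_le_sum fun c hc => (Finset.mem_filter.1 hc).2.le
    have h3 : 4 * S.card * ∑ c ∈ Big, c.card ≤ 4 * S.card * S.card := Nat.mul_le_mul_left _ h1
    have h4 : n * Ψ < (e + 1) ^ 3 * Ψ := by nlinarith
    exact Nat.lt_of_mul_lt_mul_right h4
  let en := Big.equivFin
  obtain ⟨emb⟩ : Nonempty (Fin (n + 1) ↪ ((i : Fin 3) → Fin ((fun _ => e : Fin 3 → ℕ) i + 1))) := by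
    rw [Function.Embedding.nonempty_iff_card_le]
    simp
    omega
  let b : Fin (n + 1) → Poly3 := fun j => (boxBasis (fun _ => e) (emb j) : Poly3)
  obtain ⟨v, hv, hle⟩ := ham_sandwich (n := n) (fun i => (en.symm i : Finset (Fin 3 → ℝ)))
    (fun i => hBigne _ (en.symm i).2)
    (fun i j hij => hdisj _ (en.symm i).2 _ (en.symm j).2 fun h => hij
      (en.symm.injective (Subtype.ext h)))
    (fun p j => eval p (b j))
  let f : Poly3 := ∑ j, v j • b j
  have hfe : ∀ p, (fun j => eval p (b j)) ⬝ᵥ v = eval p f := by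
    intro p
    simp [f, dotProduct, map_sum, smul_eval, mul_comm]
  have hfbox : f ∈ box (fun _ => e) := sum_mem fun j _ => Submodule.smul_mem _ _ (Subtype.mem _)
  refine ⟨f, ?_, ?_, ?_⟩
  · intro h0
    apply hv
    have hli : LinearIndependent ℝ b := by
      have := (boxBasis (fun _ => e)).linearIndependent.comp emb emb.injective
      exact this.map' (box (fun _ => e)).subtype (Submodule.ker_subtype _)
    exact funext fun j => Fintype.linearIndependent_iff.1 hli v h0 j
  · exact totalDegree_le_of_mem_box hfbox
  · have hle' : 3 * ∑ c ∈ Big, ((c ×ˢ c).filter fun p => 0 < eval p.1 f * eval p.2 f).card ≤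
        2 * ∑ c ∈ Big, c.card ^ 2 := by
      simp only [hfe] at hle
      rw [← Finset.sum_coe_sort Big, ← Finset.sum_coe_sort Big,
        ← Equiv.sum_comp en.symm, ← Equiv.sum_comp en.symm]
      exact hle
    have hsmall : 4 * ((cellPairs S l).filter fun p => cell p.1 ∉ Big).card ≤ Ψ := by
      have h1 : ((cellPairs S l).filter fun p => cell p.1 ∉ Big) ⊆
          ((T.filter fun p => cell p ∉ Big).sigma (fun p => cell p)).image
            (fun x => (x.1, x.2)) := by
        rintro ⟨p, q⟩ hp
        rw [Finset.mem_filter, mem_cellPairs] at hp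
        simp only [Finset.mem_image, Finset.mem_sigma, Finset.mem_filter]
        refine ⟨⟨p, q⟩, ⟨⟨?_, hp.2⟩, ?_⟩, rfl⟩
        · exact Finset.mem_filter.2 ⟨hp.1.1.1, hp.1.2.trans hp.1.2.symm⟩
        · exact Finset.mem_filter.2 ⟨hp.1.1.2, hp.1.2⟩
      have h2 := (Finset.card_le_card h1).trans Finset.card_image_le
      rw [Finset.card_sigma] at h2
      have h3 : 4 * S.card * ∑ p ∈ T.filter (fun p => cell p ∉ Big), (cell p).card ≤
          S.card * Ψ := by
        rw [Finset.mul_sum]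
        refine (Finset.sum_le_card_nsmul _ _ Ψ ?_).trans ?_
        · intro p hp
          rw [Finset.mem_filter] at hp
          by_contra! h
          exact hp.2 (Finset.mem_filter.2 ⟨Finset.mem_image_of_mem _ hp.1, h⟩)
        · rw [smul_eq_mul]
          exact Nat.mul_le_mul_right _ (Finset.card_le_card
            ((Finset.filter_subset _ _).trans (Finset.filter_subset _ _)))
      rcases Nat.eq_zero_or_pos S.card with h0 | h0
      · have hT : S = ∅ := Finset.card_eq_zero.1 h0
        simp [cellPairs, hT]
      · have h4 : S.card * (4 * ∑ p ∈ T.filter (fun p => cell p ∉ Big), (cell p).card) ≤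
          S.card * Ψ := by linarith
        have := Nat.le_of_mul_le_mul_left h4 h0
        omega
    have hbig : ∑ c ∈ Big, c.card ^ 2 + ((cellPairs S l).filter fun p => cell p.1 ∉ Big).card
        ≤ Ψ := by
      rw [hΨ, ← Finset.card_filter_add_card_filter_not (s := cellPairs S l)
        (fun p => cell p.1 ∈ Big)]
      refine Nat.add_le_add_right ?_ _
      have : ∑ c ∈ Big, c.card ^ 2 = (Big.biUnion fun c => c ×ˢ c).card := by
        rw [Finset.card_biUnion]
        · exact Finset.sum_congr rfl fun c _ => by rw [Finset.card_product, sq]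
        · intro c hc c' hc' hne
          exact Finset.disjoint_product.2 (Or.inl (hdisj c hc c' hc' hne))
      rw [this]
      apply Finset.card_le_card
      rintro ⟨p, q⟩ hp
      rw [Finset.mem_biUnion] at hp
      obtain ⟨c, hc, hpq⟩ := hp
      rw [Finset.mem_product] at hpq
      have hcp := hBigcell c hc p hpq.1
      rw [Finset.mem_filter, mem_cellPairs]
      refine ⟨⟨⟨hBigS c hc hpq.1, hBigS c hc hpq.2⟩, ?_⟩, ?_⟩
      · have : q ∈ cell p := by rw [hcp]; exact hpq.2
        exact (Finset.mem_filter.1 this).2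
      · simpa only [hcp] using hc
    have hnew : (cellPairs S (f :: l)).card ≤
        ((cellPairs S l).filter fun p => cell p.1 ∉ Big).card +
        ∑ c ∈ Big, ((c ×ˢ c).filter fun p => 0 < eval p.1 f * eval p.2 f).card := by
      refine le_trans (Finset.card_le_card (t := ((cellPairs S l).filter fun p => cell p.1 ∉ Big) ∪
        Big.biUnion fun c => ((c ×ˢ c).filter fun p => 0 < eval p.1 f * eval p.2 f)) ?_)
        ((Finset.card_union_le _ _).trans (Nat.add_le_add_left Finset.card_biUnion_le _))
      rintro ⟨p, q⟩ hp
      rw [mem_cellPairs, sameCell_cons] at hp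
      rw [Finset.mem_union]
      by_cases hb : cell p ∈ Big
      · right
        rw [Finset.mem_biUnion]
        refine ⟨cell p, hb, ?_⟩
        rw [Finset.mem_filter, Finset.mem_product]
        exact ⟨⟨Finset.mem_filter.2 ⟨hp.1.1, hp.2.2.trans hp.2.2.symm⟩,
          Finset.mem_filter.2 ⟨hp.1.2, hp.2.2⟩⟩, hp.2.1⟩
      · left
        rw [Finset.mem_filter, mem_cellPairs]
        exact ⟨⟨hp.1, hp.2.2⟩, hb⟩
    omega

/-- Total degree of the surfaces of a list. -/
noncomputable def listDeg (l : List Poly3) : ℕ := (l.map totalDegree).sum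

lemma partition_iterate (S : Finset (Fin 3 → ℝ)) (j : ℕ) :
    ∃ l : List Poly3, (∀ f ∈ l, f ≠ 0) ∧
      ((cellPairs S l).card : ℝ) * ((11 / 10 : ℝ) ^ j) ^ 3 ≤ (S.card : ℝ) ^ 2 ∧
      (listDeg l : ℝ) ≤ 66 * (11 / 10 : ℝ) ^ j := by
  induction j with
  | zero =>
    refine ⟨[], by simp, ?_, by simp [listDeg]⟩
    have : (cellPairs S []).card ≤ S.card ^ 2 := by
      rw [sq, ← Finset.card_product]
      classical
      exact Finset.card_le_card (Finset.filter_subset _ _)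
    simp only [pow_zero, one_pow, mul_one]
    exact_mod_cast this
  | succ j ih =>
    obtain ⟨l, hl, h1, h2⟩ := ih
    set B : ℝ := (11 / 10 : ℝ) ^ (j + 1) with hB
    have hBj : B = 11 / 10 * (11 / 10 : ℝ) ^ j := by rw [hB, pow_succ]; ring
    have hBpos : 0 < (11 / 10 : ℝ) ^ j := by positivity
    have hB1 : 0 < B := by positivity
    by_cases hdone : ((cellPairs S l).card : ℝ) * B ^ 3 ≤ (S.card : ℝ) ^ 2
    · exact ⟨l, hl, hdone, h2.trans (by rw [hBj]; linarith)⟩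
    push Not at hdone
    set e := ⌊2 * B⌋₊ with he
    have he1 : 2 * B < e + 1 := Nat.lt_floor_add_one _
    have he2 : (e : ℝ) ≤ 2 * B := Nat.floor_le (by positivity)
    have hcube : 8 * B ^ 3 ≤ ((e : ℝ) + 1) ^ 3 := by
      have := pow_le_pow_left₀ (by positivity) he1.le 3
      nlinarith
    obtain ⟨f, hf0, hfd, hfΨ⟩ := partition_step S l e (by
      have hΨ : (0 : ℝ) ≤ (cellPairs S l).card := Nat.cast_nonneg _
      have : (4 : ℝ) * (S.card : ℝ) ^ 2 < ((e : ℝ) + 1) ^ 3 * (cellPairs S l).card := by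
        nlinarith [mul_le_mul_of_nonneg_right hcube hΨ]
      exact_mod_cast this)
    refine ⟨f :: l, ?_, ?_, ?_⟩
    · intro g hg
      rcases List.mem_cons.1 hg with rfl | hg
      · exact hf0
      · exact hl g hg
    · have hfΨ' : (4 : ℝ) * (cellPairs S (f :: l)).card ≤ 3 * (cellPairs S l).card := by
        exact_mod_cast hfΨ
      have : B ^ 3 = 1331 / 1000 * ((11 / 10 : ℝ) ^ j) ^ 3 := by rw [hBj]; ring
      rw [this]
      have hp : 0 < ((11 / 10 : ℝ) ^ j) ^ 3 := by positivity
      have := mul_le_mul_of_nonneg_right hfΨ' hp.le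
      have hq : 0 ≤ ((cellPairs S l).card : ℝ) * ((11 / 10 : ℝ) ^ j) ^ 3 := by positivity
      nlinarith
    · have : (listDeg (f :: l) : ℝ) = f.totalDegree + listDeg l := by simp [listDeg]
      have hfd' : (f.totalDegree : ℝ) ≤ 3 * e := by exact_mod_cast hfd
      rw [this, hBj]
      rw [hBj] at he2
      linarith

lemma exists_partition (S : Finset (Fin 3 → ℝ)) {x : ℝ} (hx : 1 ≤ x) :
    ∃ l : List Poly3, (∀ f ∈ l, f ≠ 0) ∧
      ((cellPairs S l).card : ℝ) * x ^ 3 ≤ (S.card : ℝ) ^ 2 ∧ (listDeg l : ℝ) ≤ 73 * x := by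
  obtain ⟨j, hj1, hj2⟩ := exists_nat_pow_near hx (by norm_num : (1 : ℝ) < 11 / 10)
  obtain ⟨l, hl, h1, h2⟩ := partition_iterate S (j + 1)
  refine ⟨l, hl, le_trans ?_ h1, h2.trans ?_⟩
  · have := pow_le_pow_left₀ (by linarith) hj2.le 3
    exact mul_le_mul_of_nonneg_left this (Nat.cast_nonneg _)
  · rw [pow_succ]; linarith

lemma natDegree_prod_res_le (ℓ : Line) (l : List Poly3) :
    ((l.map (res ℓ)).prod).natDegree ≤ listDeg l := by
  induction l with
  | nil => simp [listDeg]
  | cons f l ih =>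
    simp only [List.map_cons, List.prod_cons, listDeg, List.sum_cons] at *
    exact (Polynomial.natDegree_mul_le).trans (add_le_add (natDegree_res_le ℓ f) ih)

lemma line_cells_pigeonhole (ℓ : Line) (l : List Poly3) (T : Finset ℝ)
    (hT : ∀ t ∈ T, ∀ f ∈ l, eval (pt ℓ t) f ≠ 0) (hcard : listDeg l + 1 < T.card) :
    ∃ t ∈ T, ∃ t' ∈ T, t ≠ t' ∧ SameCell l (pt ℓ t) (pt ℓ t') := by
  classical
  set g := (l.map (res ℓ)).prod with hg
  have hne : T.Nonempty := Finset.card_pos.1 (by omega)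
  have hg0 : g ≠ 0 := by
    obtain ⟨t, ht⟩ := hne
    rw [hg]
    intro h0
    rw [List.prod_eq_zero_iff] at h0
    obtain ⟨f, hf, h0⟩ := List.mem_map.1 h0
    have := hT t ht f hf
    rw [← eval_res, h0] at this
    simp at this
  let cnt : ℝ → ℕ := fun t => (g.roots.toFinset.filter fun r => r < t).card
  have hmaps : ∀ t ∈ T, cnt t ∈ Finset.range (listDeg l + 1) := by
    intro t _
    rw [Finset.mem_range, Nat.lt_succ_iff]
    exact (Finset.card_filter_le _ _).trans ((Multiset.toFinset_card_le _).trans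
      ((Polynomial.card_roots' g).trans (natDegree_prod_res_le ℓ l)))
  obtain ⟨t, ht, t', ht', hne', heq⟩ := Finset.exists_ne_map_eq_of_card_lt_of_maps_to
    (by simpa using hcard) hmaps
  wlog hlt : t < t' generalizing t t'
  · exact this t' ht' t ht hne'.symm heq.symm (lt_of_le_of_ne (not_lt.1 hlt) hne'.symm)
  refine ⟨t, ht, t', ht', hne', fun f hf => ?_⟩
  have hnoroot : ∀ r, t ≤ r → r ≤ t' → eval (pt ℓ r) f ≠ 0 := by
    intro r h1 h2 h0
    have hr1 : r ≠ t' := by rintro rfl; exact hT _ ht' f hf h0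
    have hgr : r ∈ g.roots.toFinset := by
      rw [Multiset.mem_toFinset, Polynomial.mem_roots hg0, Polynomial.IsRoot, hg,
        ← Polynomial.coe_evalRingHom, map_list_prod, List.prod_eq_zero_iff]
      rw [List.map_map]
      exact List.mem_map.2 ⟨f, hf, by simp [eval_res, h0]⟩
    have : cnt t < cnt t' := by
      apply Finset.card_lt_card
      rw [Finset.ssubset_iff_of_subset]
      · refine ⟨r, Finset.mem_filter.2 ⟨hgr, lt_of_le_of_ne h2 hr1⟩, ?_⟩
        simp [not_lt.2 h1]
      · intro s hs
        rw [Finset.mem_filter] at hs ⊢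
        exact ⟨hs.1, hs.2.trans hlt⟩
    omega
  by_contra hcon
  have hle : eval (pt ℓ t) f * eval (pt ℓ t') f ≤ 0 := not_lt.1 hcon
  have hcont : ContinuousOn (fun r => (res ℓ f).eval r) (Set.Icc t t') :=
    (res ℓ f).continuous.continuousOn
  simp only [← eval_res] at hle hnoroot
  have h0 : (0 : ℝ) ∈ Set.uIcc ((res ℓ f).eval t) ((res ℓ f).eval t') := by
    rw [Set.mem_uIcc]
    rcases mul_nonpos_iff.1 hle with h | h
    · right; exact ⟨h.2, h.1⟩
    · left; exact ⟨h.1, h.2⟩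
  rw [← Set.uIcc_of_le hlt.le] at hcont
  obtain ⟨r, hr, hr0⟩ := intermediate_value_uIcc hcont h0
  rw [Set.uIcc_of_le hlt.le] at hr
  exact hnoroot r hr.1 hr.2 hr0

open Classical in
/-- Points of a line avoiding the surfaces are few unless many pairs share a cell. -/
lemma line_cells (ℓ : Line) (l : List Poly3) (T : Finset ℝ)
    (hT : ∀ t ∈ T, ∀ f ∈ l, eval (pt ℓ t) f ≠ 0) :
    T.card ≤ listDeg l + 1 +
      ((T ×ˢ T).filter fun p => p.1 ≠ p.2 ∧ SameCell l (pt ℓ p.1) (pt ℓ p.2)).card := by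
  induction T using Finset.strongInduction with
  | H T ih =>
    by_cases hc : T.card ≤ listDeg l + 1
    · omega
    obtain ⟨t, ht, t', ht', hne, hs⟩ := line_cells_pigeonhole ℓ l T hT (by omega)
    have h1 := ih (T.erase t) (Finset.erase_ssubset ht)
      fun r hr => hT r (Finset.mem_of_mem_erase hr)
    rw [Finset.card_erase_of_mem ht] at h1
    have h2 : (((T.erase t) ×ˢ (T.erase t)).filter fun p =>
        p.1 ≠ p.2 ∧ SameCell l (pt ℓ p.1) (pt ℓ p.2)).card <
        ((T ×ˢ T).filter fun p => p.1 ≠ p.2 ∧ SameCell l (pt ℓ p.1) (pt ℓ p.2)).card := by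
      apply Finset.card_lt_card
      rw [Finset.ssubset_iff_of_subset]
      · exact ⟨(t, t'), by simp [ht, ht', hne, hs], by simp⟩
      · exact Finset.filter_subset_filter _ (Finset.product_subset_product
          (Finset.erase_subset _ _) (Finset.erase_subset _ _))
    omega

section Removal

variable {ι : Type*} [DecidableEq ι]

/-- The average of `φ 0, …, φ d`. -/
noncomputable def avg (φ : ℕ → ℝ) (d : ℕ) : ℝ := (∑ j ∈ Finset.range (d + 1), φ j) / (d + 1)

lemma avg_rec (φ : ℕ → ℝ) (d : ℕ) : φ d - avg φ d + d * (avg φ (d - 1) - avg φ d) = 0 := by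
  cases d with
  | zero => simp [avg]
  | succ d =>
    have h1 : ((d : ℝ) + 1) ≠ 0 := by positivity
    have h2 : ((d : ℝ) + 1 + 1) ≠ 0 := by positivity
    simp only [avg, Nat.add_sub_cancel]
    rw [Finset.sum_range_succ _ (d + 1)]
    push_cast
    field_simp
    ring

/-- Removing elements in a good order bounds a function controlled by out-degrees. -/
lemma removal_bound (Γ : ι → Finset ι) (φ : ℕ → ℝ) (ρ : Finset ι → ℝ) (h0 : ρ ∅ ≤ 0)
    (T : Finset ι) (hΓ : ∀ v ∈ T, v ∉ Γ v)
    (hstep : ∀ U ⊆ T, ∀ v ∈ U, ρ U ≤ ρ (U.erase v) + φ (Γ v ∩ U).card) :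
    ρ T ≤ ∑ v ∈ T, avg φ (Γ v ∩ T).card := by
  induction T using Finset.strongInduction with
  | H T ih =>
    rcases T.eq_empty_or_nonempty with rfl | hne
    · simpa using h0
    let d : ι → ℕ := fun v => (Γ v ∩ T).card
    have hcard : ∀ v ∈ T, ∀ w, (Γ w ∩ T.erase v).card = if v ∈ Γ w then d w - 1 else d w := by
      intro v hv w
      rw [Finset.inter_erase]
      split_ifs with h
      · exact Finset.card_erase_of_mem (Finset.mem_inter.2 ⟨h, hv⟩)
      · rw [Finset.erase_eq_of_notMem]
        exact fun h' => h (Finset.mem_inter.1 h').1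
    have hsum : ∑ v ∈ T, (φ (d v) + ∑ w ∈ T.erase v, avg φ (Γ w ∩ T.erase v).card) =
        ∑ v ∈ T, ∑ w ∈ T, avg φ (d w) := by
      have e1 : ∀ v ∈ T, ∑ w ∈ T.erase v, avg φ (Γ w ∩ T.erase v).card =
          ∑ w ∈ T, avg φ (d w) - avg φ (d v) +
            ∑ w ∈ T, (if v ∈ Γ w then (avg φ (d w - 1) - avg φ (d w)) else 0) := by
        intro v hv
        rw [← Finset.add_sum_erase _ _ hv, ← Finset.add_sum_erase T
          (fun w => if v ∈ Γ w then (avg φ (d w - 1) - avg φ (d w)) else 0) hv, if_neg (hΓ v hv)]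
        rw [zero_add, add_sub_cancel_left, ← Finset.sum_add_distrib]
        refine Finset.sum_congr rfl fun w _ => ?_
        rw [hcard v hv w]
        split_ifs <;> ring
      have e2 : ∑ v ∈ T, ∑ w ∈ T, (if v ∈ Γ w then (avg φ (d w - 1) - avg φ (d w)) else 0) =
          ∑ w ∈ T, (d w : ℝ) * (avg φ (d w - 1) - avg φ (d w)) := by
        rw [Finset.sum_comm]
        refine Finset.sum_congr rfl fun w _ => ?_
        rw [← Finset.sum_filter, Finset.sum_const, nsmul_eq_mul]
        congr 3
        ext v
        simp [and_comm]
      rw [Finset.sum_congr rfl fun v hv => congrArg (φ (d v) + ·) (e1 v hv)]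
      simp only [Finset.sum_add_distrib, Finset.sum_sub_distrib]
      rw [e2]
      have e3 : ∑ v ∈ T, (φ (d v) - avg φ (d v) + d v * (avg φ (d v - 1) - avg φ (d v))) = 0 :=
        Finset.sum_eq_zero fun v _ => avg_rec φ (d v)
      simp only [Finset.sum_add_distrib, Finset.sum_sub_distrib] at e3
      linarith
    obtain ⟨v, hv, hle⟩ := Finset.exists_le_of_sum_le hne hsum.le
    calc ρ T ≤ ρ (T.erase v) + φ (d v) := hstep T subset_rfl v hv
      _ ≤ ∑ w ∈ T.erase v, avg φ (Γ w ∩ T.erase v).card + φ (d v) := by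
        gcongr
        refine ih _ (Finset.erase_ssubset hv) (fun w hw => hΓ w (Finset.mem_of_mem_erase hw)) ?_
        exact fun U hU => hstep U (hU.trans (Finset.erase_subset _ _))
      _ ≤ _ := by linarith

end Removal

/-- Polynomials of the box vanishing on all lines of `T`. -/
noncomputable def vanishing (e : ℕ) (T : Finset Line) : Submodule ℝ Poly3 :=
  box (fun _ => e) ⊓ ⨅ ℓ ∈ T, LinearMap.ker (res ℓ).toLinearMap

lemma mem_vanishing {e : ℕ} {T : Finset Line} {f : Poly3} :
    f ∈ vanishing e T ↔ f ∈ box (fun _ => e) ∧ ∀ ℓ ∈ T, res ℓ f = 0 := by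
  simp [vanishing, Submodule.mem_iInf]

instance (e : ℕ) (T : Finset Line) : FiniteDimensional ℝ (vanishing e T) :=
  Submodule.finiteDimensional_of_le inf_le_left

lemma finrank_vanishing_erase {e : ℕ} {T : Finset Line} {ℓ : Line} (hℓ : ℓ ∈ T)
    (R : Finset ℝ) (hR : ∀ t ∈ R, ∃ ℓ' ∈ T.erase ℓ, pt ℓ t = pt ℓ' t) :
    Module.finrank ℝ (vanishing e (T.erase ℓ)) ≤
      Module.finrank ℝ (vanishing e T) + (3 * e + 1 - R.card) := by
  classical
  let ψ : vanishing e (T.erase ℓ) →ₗ[ℝ] Polynomial ℝ :=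
    (res ℓ).toLinearMap.comp (vanishing e (T.erase ℓ)).subtype
  have hψ : ∀ f, ψ f = res ℓ (f : Poly3) := fun f => rfl
  have hrn := LinearMap.finrank_range_add_finrank_ker ψ
  have hker : Module.finrank ℝ (LinearMap.ker ψ) ≤ Module.finrank ℝ (vanishing e T) := by
    let j : LinearMap.ker ψ →ₗ[ℝ] Poly3 :=
      (vanishing e (T.erase ℓ)).subtype.comp (LinearMap.ker ψ).subtype
    have hj : ∀ f, j f ∈ vanishing e T := by
      intro f
      have h1 := (mem_vanishing.1 f.1.2)
      refine mem_vanishing.2 ⟨h1.1, fun ℓ' h' => ?_⟩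
      by_cases h : ℓ' = ℓ
      · subst h; exact f.2
      · exact h1.2 ℓ' (Finset.mem_erase.2 ⟨h, h'⟩)
    refine LinearMap.finrank_le_finrank_of_injective (f := j.codRestrict _ hj) ?_
    intro a b hab
    have h : j a = j b := congrArg (fun x : vanishing e T => (x : Poly3)) hab
    exact Subtype.ext (Subtype.ext h)
  have hrange : Module.finrank ℝ (LinearMap.range ψ) ≤ 3 * e + 1 - R.card := by
    let g : Polynomial ℝ := ∏ t ∈ R, (Polynomial.X - Polynomial.C t)
    have hgm : g.Monic := Polynomial.monic_prod_of_monic _ _ fun t _ => Polynomial.monic_X_sub_C t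
    have hgd : g.natDegree = R.card := by simp [g]
    let μ : Polynomial.degreeLT ℝ (3 * e + 1 - R.card) →ₗ[ℝ] Polynomial ℝ :=
      (LinearMap.mulLeft ℝ g).comp (Submodule.subtype _)
    have hle : LinearMap.range ψ ≤ LinearMap.range μ := by
      rintro _ ⟨f, rfl⟩
      have hf := mem_vanishing.1 f.2
      have hdvd : g ∣ ψ f := by
        refine Finset.prod_dvd_of_coprime ?_ ?_
        · intro t _ t' _ hne
          exact Polynomial.isCoprime_X_sub_C_of_isUnit_sub (sub_ne_zero.2 hne).isUnit
        · intro t ht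
          rw [Polynomial.dvd_iff_isRoot, Polynomial.IsRoot, hψ, eval_res]
          obtain ⟨ℓ', h', heq⟩ := hR t ht
          rw [heq, ← eval_res, hf.2 ℓ' h', Polynomial.eval_zero]
      obtain ⟨q, hq⟩ := hdvd
      by_cases hq0 : q = 0
      · rw [hq, hq0, mul_zero]; exact zero_mem _
      have hdeg : (ψ f).natDegree ≤ 3 * e :=
        (natDegree_res_le ℓ f).trans (totalDegree_le_of_mem_box hf.1)
      rw [hq, hgm.natDegree_mul' hq0, hgd] at hdeg
      refine ⟨⟨q, ?_⟩, hq.symm⟩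
      rw [Polynomial.mem_degreeLT, ← Polynomial.natDegree_lt_iff_degree_lt hq0]
      omega
    have h1 := (Submodule.finrank_mono hle).trans (LinearMap.finrank_range_le μ)
    rwa [LinearEquiv.finrank_eq (Polynomial.degreeLTEquiv ℝ _), Module.finrank_fin_fun] at h1
  omega

lemma sum_truncated_le (M d : ℕ) :
    ∑ j ∈ Finset.range d, ((M - j : ℕ) : ℝ) ≤ M * (M + 1) / 2 := by
  have key : ∀ d, d ≤ M → ∑ j ∈ Finset.range d, ((M - j : ℕ) : ℝ) =
      M * (M + 1) / 2 - (M - d) * (M - d + 1) / 2 := by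
    intro d hd
    induction d with
    | zero => simp
    | succ d ih =>
      rw [Finset.sum_range_succ, ih (by omega), Nat.cast_sub (by omega)]
      push_cast
      ring
  rcases le_total d M with h | h
  · rw [key d h]
    have : (d : ℝ) ≤ M := by exact_mod_cast h
    nlinarith
  · obtain ⟨k, rfl⟩ := Nat.exists_eq_add_of_le h
    rw [Finset.sum_range_add, key M le_rfl]
    simp

/-- Degree reduction: many lines, each meeting many of the others, lie on a surface of
small degree. -/
lemma degree_reduction (𝓛 : Finset Line) (m e : ℕ) (Γ : Line → Finset Line)
    (τ : Line → Line → ℝ) (hsub : ∀ ℓ ∈ 𝓛, Γ ℓ ⊆ 𝓛) (hself : ∀ ℓ ∈ 𝓛, ℓ ∉ Γ ℓ)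
    (hm : ∀ ℓ ∈ 𝓛, m ≤ (Γ ℓ).card) (hinj : ∀ ℓ ∈ 𝓛, Set.InjOn (τ ℓ) (Γ ℓ))
    (hmeet : ∀ ℓ ∈ 𝓛, ∀ ℓ' ∈ Γ ℓ, pt ℓ (τ ℓ ℓ') = pt ℓ' (τ ℓ ℓ'))
    (hlarge : 9 * 𝓛.card < 2 * (m + 1) * (e + 1)) :
    ∃ f : Poly3, f ≠ 0 ∧ f.totalDegree ≤ 3 * e ∧ ∀ ℓ ∈ 𝓛, res ℓ f = 0 := by
  classical
  let φ : ℕ → ℝ := fun j => ((3 * e + 1 - j : ℕ) : ℝ)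
  let ρ : Finset Line → ℝ := fun T =>
    (Module.finrank ℝ (box (fun _ => e)) : ℝ) - Module.finrank ℝ (vanishing e T)
  have hρ0 : ρ ∅ ≤ 0 := by
    have : vanishing e ∅ = box (fun _ => e) := by simp [vanishing]
    simp only [ρ]
    rw [this, sub_self]
  have hb := removal_bound Γ φ ρ hρ0 𝓛 hself (by
    intro U hU v hv
    have := finrank_vanishing_erase (e := e) hv ((Γ v ∩ U).image (τ v)) (by
      intro t ht
      obtain ⟨ℓ', h', rfl⟩ := Finset.mem_image.1 ht
      rw [Finset.mem_inter] at h'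
      refine ⟨ℓ', Finset.mem_erase.2 ⟨?_, h'.2⟩, hmeet v (hU hv) ℓ' h'.1⟩
      rintro rfl
      exact hself _ (hU hv) h'.1)
    rw [Finset.card_image_of_injOn ((hinj v (hU hv)).mono (by
      intro x hx
      exact (Finset.mem_inter.1 hx).1))] at this
    have h2 : (Module.finrank ℝ (vanishing e (U.erase v)) : ℝ) ≤
      Module.finrank ℝ (vanishing e U) + φ (Γ v ∩ U).card := by
        simp only [φ]; exact_mod_cast this
    simp only [ρ]
    linarith)
  have hF : ∀ v ∈ 𝓛, avg φ (Γ v ∩ 𝓛).card ≤ 9 * ((e : ℝ) + 1) ^ 2 / (2 * (m + 1)) := by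
    intro v hv
    rw [Finset.inter_eq_left.2 (hsub v hv), avg]
    have h1 : ∑ j ∈ Finset.range ((Γ v).card + 1), φ j ≤ 9 * ((e : ℝ) + 1) ^ 2 / 2 := by
      refine (sum_truncated_le (3 * e + 1) _).trans ?_
      push_cast
      have : (0 : ℝ) ≤ e := Nat.cast_nonneg e
      nlinarith
    have h2 : ((m : ℝ) + 1) ≤ (Γ v).card + 1 := by
      have : (m : ℝ) ≤ (Γ v).card := by exact_mod_cast hm v hv
      linarith
    have h3 : (0 : ℝ) < m + 1 := by positivity
    calc _ ≤ (9 * ((e : ℝ) + 1) ^ 2 / 2) / ((Γ v).card + 1) := by gcongr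
      _ ≤ (9 * ((e : ℝ) + 1) ^ 2 / 2) / (m + 1) := by gcongr
      _ = _ := by rw [div_div]
  have hb2 := hb.trans (Finset.sum_le_card_nsmul _ _ _ hF)
  have hpos : 0 < Module.finrank ℝ (vanishing e 𝓛) := by
    by_contra h0
    have h0' : Module.finrank ℝ (vanishing e 𝓛) = 0 := by omega
    simp only [ρ, h0', finrank_box, nsmul_eq_mul] at hb2
    simp at hb2
    have h3 : (0 : ℝ) < m + 1 := by positivity
    have h4 : (9 * (𝓛.card : ℝ)) < 2 * (m + 1) * (e + 1) := by exact_mod_cast hlarge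
    have h5 : (𝓛.card : ℝ) * (9 * ((e : ℝ) + 1) ^ 2 / (2 * (m + 1))) < (e + 1) ^ 3 := by
      rw [← mul_div_assoc, div_lt_iff₀ (by positivity)]
      have h6 : (0 : ℝ) < ((e : ℝ) + 1) ^ 2 := by positivity
      nlinarith
    linarith
  obtain ⟨f, hf⟩ := Module.finrank_pos_iff_exists_ne_zero.1 hpos
  have hfv := mem_vanishing.1 f.2
  exact ⟨f, fun h => hf (Subtype.ext h), totalDegree_le_of_mem_box hfv.1, hfv.2⟩

section Cartan

variable {O : Type*} [CommRing O] [Algebra ℝ O]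

lemma derivation_mem_span (D : Derivation ℝ O O) (S : Set O)
    (h : ∀ z ∈ S, D z ∈ Ideal.span S) : ∀ z ∈ Ideal.span S, D z ∈ Ideal.span S := by
  intro z hz
  induction hz using Submodule.span_induction with
  | mem z hz => exact h z hz
  | zero => simp
  | add a b _ _ ha hb => rw [map_add]; exact add_mem ha hb
  | smul a b hb hDb =>
    rw [smul_eq_mul, Derivation.leibniz, smul_eq_mul, smul_eq_mul]
    exact add_mem (Ideal.mul_mem_left _ _ hDb) (Ideal.mul_mem_right _ _ hb)

/-- A surface `y = y(t, x)` whose derivatives satisfy the integrability system of a quadric lies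
on a quadric, formally at the point `ev`. -/
theorem exists_quadric_ideal (D₁ D₂ : Derivation ℝ O O) (t x y : O)
    (ht1 : D₁ t = 1) (ht2 : D₂ t = 0) (hx1 : D₁ x = 0) (hx2 : D₂ x = 1)
    (hc : ∀ z, D₁ (D₂ z) = D₂ (D₁ z)) {h₁ h₂ h₁₁ h₁₂ h₂₂ : O}
    (hy1 : D₁ y = h₁) (hy2 : D₂ y = h₂) (hy11 : D₁ h₁ = h₁₁) (hy12 : D₂ h₁ = h₁₂)
    (hy22 : D₂ h₂ = h₂₂) (s₁ s₂ ν : O)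
    (r111 : D₁ h₁₁ = -(3 * h₁₁ * s₁)) (r112 : D₂ h₁₁ = -(h₁₁ * s₂ + 2 * h₁₂ * s₁))
    (r122 : D₁ h₂₂ = -(h₂₂ * s₁ + 2 * h₁₂ * s₂)) (r222 : D₂ h₂₂ = -(3 * h₂₂ * s₂))
    (e11 : D₁ s₁ = ν * h₁₁ - s₁ * s₁) (e12 : D₂ s₁ = ν * h₁₂ - s₁ * s₂)
    (e21 : D₁ s₂ = ν * h₁₂ - s₁ * s₂) (e22 : D₂ s₂ = ν * h₂₂ - s₂ * s₂)
    (n1 : D₁ ν = -(ν * s₁)) (n2 : D₂ ν = -(ν * s₂)) (ev : O →ₐ[ℝ] ℝ) :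
    ∃ c : Fin 10 → ℝ, c ≠ 0 ∧ ∃ I : Ideal O, (∀ z ∈ I, ev z = 0) ∧
      (∀ z ∈ I, D₁ z ∈ I) ∧ (∀ z ∈ I, D₂ z ∈ I) ∧
      ∑ i, c i • (![y ^ 2, y, y * t, y * x, 1, t, x, t ^ 2, t * x, x ^ 2] : Fin 10 → O) i ∈ I := by
  have hy21 : D₁ h₂ = h₁₂ := by rw [← hy2, hc, hy1, hy12]
  have r121 : D₁ h₁₂ = -(h₁₁ * s₂ + 2 * h₁₂ * s₁) := by
    have := hc h₁
    rwa [hy11, hy12, r112] at this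
  have r221 : D₂ h₁₂ = -(h₂₂ * s₁ + 2 * h₁₂ * s₂) := by
    have := hc h₂
    rwa [hy21, hy22, r122, eq_comm] at this
  let ψ : (Fin 10 → ℝ) →ₗ[ℝ] O := Fintype.linearCombination ℝ
    (![y ^ 2, y, y * t, y * x, 1, t, x, t ^ 2, t * x, x ^ 2] : Fin 10 → O)
  let σ : (Fin 10 → ℝ) →ₗ[ℝ] O := Fintype.linearCombination ℝ
    (![2 * y, 1, t, x, 0, 0, 0, 0, 0, 0] : Fin 10 → O)
  let α : (Fin 10 → ℝ) →ₗ[ℝ] O := Fintype.linearCombination ℝ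
    (![2, 0, 0, 0, 0, 0, 0, 0, 0, 0] : Fin 10 → O)
  let d₁ : O →ₗ[ℝ] O := D₁
  let d₂ : O →ₗ[ℝ] O := D₂
  let χ₁ : (Fin 10 → ℝ) →ₗ[ℝ] O := d₁.comp σ - (LinearMap.mulLeft ℝ s₁).comp σ
  let χ₂ : (Fin 10 → ℝ) →ₗ[ℝ] O := d₂.comp σ - (LinearMap.mulLeft ℝ s₂).comp σ
  let ω : (Fin 10 → ℝ) →ₗ[ℝ] O := α - (LinearMap.mulLeft ℝ ν).comp σ
  let G : Fin 9 → ((Fin 10 → ℝ) →ₗ[ℝ] O) := ![ψ, d₁.comp ψ, d₂.comp ψ, d₁.comp (d₁.comp ψ),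
    d₂.comp (d₁.comp ψ), d₂.comp (d₂.comp ψ), χ₁, χ₂, ω]
  let Λ : (Fin 10 → ℝ) →ₗ[ℝ] (Fin 9 → ℝ) := LinearMap.pi fun i => ev.toLinearMap.comp (G i)
  have hker : LinearMap.ker Λ ≠ ⊥ := LinearMap.ker_ne_bot_of_finrank_lt (by simp)
  obtain ⟨c, hcker, hc0⟩ := Submodule.exists_mem_ne_zero_of_ne_bot hker
  have hev : ∀ i, ev (G i c) = 0 := fun i => congrFun (LinearMap.mem_ker.1 hcker) i
  let a : Fin 10 → O := fun i => algebraMap ℝ O (c i)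
  have ha1 : ∀ i, D₁ (a i) = 0 := fun i => D₁.map_algebraMap _
  have ha2 : ∀ i, D₂ (a i) = 0 := fun i => D₂.map_algebraMap _
  have hψ : ψ c = a 0 * y ^ 2 + y * (a 1 + a 2 * t + a 3 * x) +
      (a 4 + a 5 * t + a 6 * x + a 7 * t ^ 2 + a 8 * (t * x) + a 9 * x ^ 2) := by
    simp only [ψ, Fintype.linearCombination_apply, Fin.sum_univ_succ, Algebra.smul_def, a]
    simp
    ring
  have hσ : σ c = 2 * a 0 * y + (a 1 + a 2 * t + a 3 * x) := by
    simp only [σ, Fintype.linearCombination_apply, Fin.sum_univ_succ, Algebra.smul_def, a]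
    simp
    ring
  have hα : α c = 2 * a 0 := by
    simp only [α, Fintype.linearCombination_apply, Fin.sum_univ_succ, Algebra.smul_def, a]
    simp
    ring
  have two1 : D₁ (2 : O) = 0 := by simpa using D₁.map_natCast 2
  have two2 : D₂ (2 : O) = 0 := by simpa using D₂.map_natCast 2
  have hσ1 : D₁ (σ c) = 2 * a 0 * h₁ + a 2 := by
    rw [hσ]
    simp only [map_add, Derivation.leibniz, smul_eq_mul, ha1, two1, ht1, hx1, hy1]
    ring
  have hσ2 : D₂ (σ c) = 2 * a 0 * h₂ + a 3 := by
    rw [hσ]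
    simp only [map_add, Derivation.leibniz, smul_eq_mul, ha2, two2, ht2, hx2, hy2]
    ring
  have hψ1 : D₁ (ψ c) = σ c * h₁ + a 2 * y + (a 5 + 2 * a 7 * t + a 8 * x) := by
    rw [hψ, hσ]
    simp only [map_add, Derivation.leibniz, smul_eq_mul, ha1, pow_two, ht1, hx1, hy1]
    ring
  have hψ2 : D₂ (ψ c) = σ c * h₂ + a 3 * y + (a 6 + a 8 * t + 2 * a 9 * x) := by
    rw [hψ, hσ]
    simp only [map_add, Derivation.leibniz, smul_eq_mul, ha2, pow_two, ht2, hx2, hy2]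
    ring
  have hψ11 : D₁ (D₁ (ψ c)) = 2 * a 0 * h₁ * h₁ + 2 * a 2 * h₁ + σ c * h₁₁ + 2 * a 7 := by
    rw [hψ1]
    simp only [map_add, Derivation.leibniz, smul_eq_mul, ha1, two1, ht1, hx1, hy1, hσ1, hy11]
    ring
  have hψ12 : D₂ (D₁ (ψ c)) = 2 * a 0 * h₁ * h₂ + a 2 * h₂ + a 3 * h₁ + σ c * h₁₂ + a 8 := by
    rw [hψ1]
    simp only [map_add, Derivation.leibniz, smul_eq_mul, ha2, two2, ht2, hx2, hy2, hσ2, hy12]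
    ring
  have hψ22 : D₂ (D₂ (ψ c)) = 2 * a 0 * h₂ * h₂ + 2 * a 3 * h₂ + σ c * h₂₂ + 2 * a 9 := by
    rw [hψ2]
    simp only [map_add, Derivation.leibniz, smul_eq_mul, ha2, two2, ht2, hx2, hy2, hσ2, hy22]
    ring
  have hχ1 : χ₁ c = D₁ (σ c) - s₁ * σ c := rfl
  have hχ2 : χ₂ c = D₂ (σ c) - s₂ * σ c := rfl
  have hω : ω c = 2 * a 0 - ν * σ c := by rw [← hα]; rfl
  let gen : Fin 9 → O := fun i => G i c
  have hmem : ∀ i, gen i ∈ Ideal.span (Set.range gen) := fun i =>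
    Ideal.subset_span (Set.mem_range_self i)
  set I := Ideal.span (Set.range gen) with hI
  have m0 : ψ c ∈ I := hmem 0
  have m1 : D₁ (ψ c) ∈ I := hmem 1
  have m2 : D₂ (ψ c) ∈ I := hmem 2
  have m3 : D₁ (D₁ (ψ c)) ∈ I := hmem 3
  have m4 : D₂ (D₁ (ψ c)) ∈ I := hmem 4
  have m5 : D₂ (D₂ (ψ c)) ∈ I := hmem 5
  have m6 : χ₁ c ∈ I := hmem 6
  have m7 : χ₂ c ∈ I := hmem 7
  have m8 : ω c ∈ I := hmem 8
  have comb : ∀ p q : O, p * χ₁ c + q * χ₂ c ∈ I := fun p q =>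
    add_mem (Ideal.mul_mem_left _ _ m6) (Ideal.mul_mem_left _ _ m7)
  have combω : ∀ p q r : O, p * ω c + q * χ₁ c + r * χ₂ c ∈ I := fun p q r => by
    rw [add_assoc]; exact add_mem (Ideal.mul_mem_left _ _ m8) (comb q r)
  have k111 : D₁ (D₁ (D₁ (ψ c))) ∈ I := by
    have : D₁ (D₁ (D₁ (ψ c))) = (3 * h₁₁) * χ₁ c + 0 * χ₂ c := by
      rw [hψ11, hχ1]
      simp only [map_add, Derivation.leibniz, smul_eq_mul, ha1, two1, hσ1, hy11, r111]
      ring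
    rw [this]; exact comb _ _
  have k112 : D₂ (D₁ (D₁ (ψ c))) ∈ I := by
    have : D₂ (D₁ (D₁ (ψ c))) = (2 * h₁₂) * χ₁ c + h₁₁ * χ₂ c := by
      rw [hψ11, hχ1, hχ2]
      simp only [map_add, Derivation.leibniz, smul_eq_mul, ha2, two2, hσ2, hσ1, hy12, r112]
      ring
    rw [this]; exact comb _ _
  have k122 : D₂ (D₂ (D₁ (ψ c))) ∈ I := by
    have : D₂ (D₂ (D₁ (ψ c))) = h₂₂ * χ₁ c + (2 * h₁₂) * χ₂ c := by
      rw [hψ12, hχ1, hχ2]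
      simp only [map_add, Derivation.leibniz, smul_eq_mul, ha2, two2, hσ2, hσ1, hy12, hy22, r221]
      ring
    rw [this]; exact comb _ _
  have k222 : D₂ (D₂ (D₂ (ψ c))) ∈ I := by
    have : D₂ (D₂ (D₂ (ψ c))) = 0 * χ₁ c + (3 * h₂₂) * χ₂ c := by
      rw [hψ22, hχ2]
      simp only [map_add, Derivation.leibniz, smul_eq_mul, ha2, two2, hσ2, hy22, r222]
      ring
    rw [this]; exact comb _ _
  have kχ11 : D₁ (χ₁ c) ∈ I := by
    have : D₁ (χ₁ c) = h₁₁ * ω c + (-s₁) * χ₁ c + 0 * χ₂ c := by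
      rw [hω, hχ1, map_sub, Derivation.leibniz, smul_eq_mul, smul_eq_mul, hσ1, e11]
      simp only [map_add, Derivation.leibniz, smul_eq_mul, ha1, two1, hy11]
      ring
    rw [this]; exact combω _ _ _
  have kχ12 : D₂ (χ₁ c) ∈ I := by
    have : D₂ (χ₁ c) = h₁₂ * ω c + 0 * χ₁ c + (-s₁) * χ₂ c := by
      rw [hω, hχ1, hχ2, map_sub, Derivation.leibniz, smul_eq_mul, smul_eq_mul, hσ1, hσ2, e12]
      simp only [map_add, Derivation.leibniz, smul_eq_mul, ha2, two2, hy12]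
      ring
    rw [this]; exact combω _ _ _
  have kχ21 : D₁ (χ₂ c) ∈ I := by
    have : D₁ (χ₂ c) = h₁₂ * ω c + (-s₂) * χ₁ c + 0 * χ₂ c := by
      rw [hω, hχ1, hχ2, map_sub, Derivation.leibniz, smul_eq_mul, smul_eq_mul, hσ1, hσ2, e21]
      simp only [map_add, Derivation.leibniz, smul_eq_mul, ha1, two1, hy21]
      ring
    rw [this]; exact combω _ _ _
  have kχ22 : D₂ (χ₂ c) ∈ I := by
    have : D₂ (χ₂ c) = h₂₂ * ω c + 0 * χ₁ c + (-s₂) * χ₂ c := by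
      rw [hω, hχ2, map_sub, Derivation.leibniz, smul_eq_mul, smul_eq_mul, hσ2, e22]
      simp only [map_add, Derivation.leibniz, smul_eq_mul, ha2, two2, hy22]
      ring
    rw [this]; exact combω _ _ _
  have kω1 : D₁ (ω c) ∈ I := by
    have : D₁ (ω c) = (-ν) * χ₁ c + 0 * χ₂ c := by
      rw [hω, hχ1, map_sub, Derivation.leibniz, Derivation.leibniz, n1, ha1, two1]
      simp only [smul_eq_mul]
      ring
    rw [this]; exact comb _ _
  have kω2 : D₂ (ω c) ∈ I := by
    have : D₂ (ω c) = 0 * χ₁ c + (-ν) * χ₂ c := by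
      rw [hω, hχ2, map_sub, Derivation.leibniz, Derivation.leibniz, n2, ha2, two2]
      simp only [smul_eq_mul]
      ring
    rw [this]; exact comb _ _
  refine ⟨c, hc0, I, ?_, ?_, ?_, m0⟩
  · intro z hz
    have hle : I ≤ RingHom.ker ev := by
      rw [hI, Ideal.span_le]
      rintro _ ⟨i, rfl⟩
      exact hev i
    exact hle hz
  · refine derivation_mem_span D₁ _ ?_
    rintro _ ⟨i, rfl⟩
    fin_cases i
    · exact m1
    · exact m3
    · change D₁ (D₂ (ψ c)) ∈ I; rw [hc]; exact m4
    · exact k111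
    · change D₁ (D₂ (D₁ (ψ c))) ∈ I; rw [hc]; exact k112
    · change D₁ (D₂ (D₂ (ψ c))) ∈ I; rw [hc, hc]; exact k122
    · exact kχ11
    · exact kχ21
    · exact kω1
  · refine derivation_mem_span D₂ _ ?_
    rintro _ ⟨i, rfl⟩
    fin_cases i
    · exact m2
    · exact m4
    · exact m5
    · exact k112
    · exact k122
    · exact k222
    · exact kχ12
    · exact kχ22
    · exact kω2

/-- The integrability system follows from the cubic relations when the Hessian is a unit. -/
lemma integrability (D₁ D₂ : Derivation ℝ O O) (hc : ∀ z, D₁ (D₂ z) = D₂ (D₁ z))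
    {h₁₁ h₁₂ h₂₂ s₁ s₂ : O} (hH : IsUnit (h₁₁ * h₂₂ - h₁₂ * h₁₂))
    (r111 : D₁ h₁₁ = -(3 * h₁₁ * s₁)) (r112 : D₂ h₁₁ = -(h₁₁ * s₂ + 2 * h₁₂ * s₁))
    (r121 : D₁ h₁₂ = -(h₁₁ * s₂ + 2 * h₁₂ * s₁)) (r221 : D₂ h₁₂ = -(h₂₂ * s₁ + 2 * h₁₂ * s₂))
    (r122 : D₁ h₂₂ = -(h₂₂ * s₁ + 2 * h₁₂ * s₂)) (r222 : D₂ h₂₂ = -(3 * h₂₂ * s₂)) :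
    ∃ ν : O, D₁ s₁ = ν * h₁₁ - s₁ * s₁ ∧ D₂ s₁ = ν * h₁₂ - s₁ * s₂ ∧
      D₁ s₂ = ν * h₁₂ - s₁ * s₂ ∧ D₂ s₂ = ν * h₂₂ - s₂ * s₂ ∧
      D₁ ν = -(ν * s₁) ∧ D₂ ν = -(ν * s₂) := by
  obtain ⟨H, hH⟩ := hH
  have two1 : D₁ (2 : O) = 0 := by simpa using D₁.map_natCast 2
  have two2 : D₂ (2 : O) = 0 := by simpa using D₂.map_natCast 2
  have three1 : D₁ (3 : O) = 0 := by simpa using D₁.map_natCast 3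
  have three2 : D₂ (3 : O) = 0 := by simpa using D₂.map_natCast 3
  have hinj : ∀ z : O, (H : O) * z = 0 → z = 0 := fun z hz => by
    simpa using congrArg (fun w => (↑H⁻¹ : O) * w) hz
  have hfour : ∀ z : O, 4 * z = 0 → z = 0 := fun z hz => by
    have h4 : algebraMap ℝ O (1 / 4) * 4 = 1 := by
      have : (4 : O) = algebraMap ℝ O 4 := (map_ofNat _ 4).symm
      rw [this, ← map_mul]; norm_num
    calc z = algebraMap ℝ O (1 / 4) * 4 * z := by rw [h4, one_mul]
      _ = 0 := by rw [mul_assoc, hz, mul_zero]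
  obtain ⟨S11, hS11⟩ : ∃ S, S = D₁ s₁ + s₁ * s₁ := ⟨_, rfl⟩
  obtain ⟨S12, hS12⟩ : ∃ S, S = D₂ s₁ + s₁ * s₂ := ⟨_, rfl⟩
  obtain ⟨S21, hS21⟩ : ∃ S, S = D₁ s₂ + s₁ * s₂ := ⟨_, rfl⟩
  obtain ⟨S22, hS22⟩ : ∃ S, S = D₂ s₂ + s₂ * s₂ := ⟨_, rfl⟩
  have E1 : 3 * h₁₁ * S12 = h₁₁ * S21 + 2 * h₁₂ * S11 := by
    have := hc h₁₁
    rw [r111, r112] at this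
    simp only [map_neg, map_add, Derivation.leibniz, smul_eq_mul, two1, three2, r111, r112,
      r121] at this
    rw [hS12, hS21, hS11]
    linear_combination this
  have E2 : h₁₁ * S22 + 2 * h₁₂ * S12 = h₂₂ * S11 + 2 * h₁₂ * S21 := by
    have := hc h₁₂
    rw [r121, r221] at this
    simp only [map_neg, map_add, Derivation.leibniz, smul_eq_mul, two1, two2, r221, r112,
      r121, r122] at this
    rw [hS12, hS21, hS11, hS22]
    linear_combination this
  have E3 : h₂₂ * S12 + 2 * h₁₂ * S22 = 3 * h₂₂ * S21 := by
    have := hc h₂₂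
    rw [r122, r222] at this
    simp only [map_neg, map_add, Derivation.leibniz, smul_eq_mul, two2, three1, r221, r222,
      r122] at this
    rw [hS12, hS21, hS22]
    linear_combination this
  have hδ : S12 = S21 := by
    rw [← sub_eq_zero]
    apply hfour
    apply hinj
    rw [hH]
    linear_combination h₂₂ * E1 - 2 * h₁₂ * E2 + h₁₁ * E3
  subst hδ
  have htwo : ∀ z : O, 2 * z = 0 → z = 0 := fun z hz => hfour z (by linear_combination 2 * hz)
  have F1 : h₁₁ * S12 = h₁₂ * S11 := by
    rw [← sub_eq_zero]; apply htwo; linear_combination E1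
  have F3 : h₂₂ * S12 = h₁₂ * S22 := by
    rw [← sub_eq_zero]; apply htwo; linear_combination -E3
  have F2 : h₁₁ * S22 = h₂₂ * S11 := by linear_combination E2
  obtain ⟨ν, hν⟩ : ∃ ν : O, (H : O) * ν = h₂₂ * S11 - h₁₂ * S12 :=
    ⟨(↑H⁻¹ : O) * (h₂₂ * S11 - h₁₂ * S12), by simp⟩
  have G11 : S11 = ν * h₁₁ := by
    rw [← sub_eq_zero]; apply hinj
    linear_combination -h₁₁ * hν + S11 * hH + h₁₂ * F1
  have G12 : S12 = ν * h₁₂ := by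
    rw [← sub_eq_zero]; apply hinj
    linear_combination -h₁₂ * hν + S12 * hH + h₂₂ * F1
  have G22 : S22 = ν * h₂₂ := by
    rw [← sub_eq_zero]; apply hinj
    linear_combination -h₂₂ * hν + S22 * hH + h₂₂ * F2 + h₁₂ * F3
  have d11 : D₁ s₁ = ν * h₁₁ - s₁ * s₁ := by rw [← G11, hS11]; ring
  have d12 : D₂ s₁ = ν * h₁₂ - s₁ * s₂ := by rw [← G12, hS12]; ring
  have d21 : D₁ s₂ = ν * h₁₂ - s₁ * s₂ := by rw [← G12, hS21]; ring
  have d22 : D₂ s₂ = ν * h₂₂ - s₂ * s₂ := by rw [← G22, hS22]; ring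
  have c1 := hc s₁
  rw [d11, d12] at c1
  simp only [map_sub, Derivation.leibniz, smul_eq_mul, r112, r121, d11, d12, d21] at c1
  have c2 := hc s₂
  rw [d21, d22] at c2
  simp only [map_sub, Derivation.leibniz, smul_eq_mul, r122, r221, d12, d22, d21] at c2
  have q1 : h₁₂ * (D₁ ν + ν * s₁) = h₁₁ * (D₂ ν + ν * s₂) := by linear_combination c1
  have q2 : h₂₂ * (D₁ ν + ν * s₁) = h₁₂ * (D₂ ν + ν * s₂) := by linear_combination c2
  refine ⟨ν, d11, d12, d21, d22, ?_, ?_⟩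
  · rw [eq_neg_iff_add_eq_zero]; apply hinj; rw [hH]; linear_combination h₁₁ * q2 - h₁₂ * q1
  · rw [eq_neg_iff_add_eq_zero]; apply hinj; rw [hH]; linear_combination h₁₂ * q2 - h₂₂ * q1

end Cartan

lemma exists_derivation_quotient {A : Type} [CommRing A] [Algebra ℝ A] (J : Ideal A)
    (D : Derivation ℝ A A) (hD : ∀ z ∈ J, D z ∈ J) :
    ∃ D' : Derivation ℝ (A ⧸ J) (A ⧸ J), ∀ a,
      D' (Ideal.Quotient.mk J a) = Ideal.Quotient.mk J (D a) := by
  have hwd : ∀ a b, Ideal.Quotient.mk J a = Ideal.Quotient.mk J b →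
      Ideal.Quotient.mk J (D a) = Ideal.Quotient.mk J (D b) := fun a b h => by
    rw [Ideal.Quotient.eq] at h ⊢
    rw [← map_sub]
    exact hD _ h
  have hs := Ideal.Quotient.mk_surjective (I := J)
  choose σ hσ using hs
  have hkey : ∀ a, Ideal.Quotient.mk J (D (σ (Ideal.Quotient.mk J a))) =
      Ideal.Quotient.mk J (D a) := fun a => hwd _ _ (hσ _)
  refine ⟨Derivation.mk' { toFun := fun q => Ideal.Quotient.mk J (D (σ q)),
                           map_add' := ?_, map_smul' := ?_ } ?_, hkey⟩
  · intro p q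
    rw [← map_add, ← map_add]
    exact hwd _ _ (by rw [hσ, map_add, hσ, hσ])
  · intro c p
    change Ideal.Quotient.mkₐ ℝ J _ = c • Ideal.Quotient.mkₐ ℝ J _
    rw [← map_smul, ← Derivation.map_smul]
    refine hwd _ _ ?_
    rw [hσ]
    change _ = Ideal.Quotient.mkₐ ℝ J (c • σ p)
    rw [map_smul]
    exact congrArg _ (hσ p).symm
  · intro p q
    change Ideal.Quotient.mk J _ = p * Ideal.Quotient.mk J _ + q * Ideal.Quotient.mk J _
    have : Ideal.Quotient.mk J (D (σ (p * q))) = Ideal.Quotient.mk J (D (σ p * σ q)) :=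
      hwd _ _ (by rw [hσ, map_mul, hσ, hσ])
    rw [this, Derivation.leibniz, map_add, smul_eq_mul, smul_eq_mul, map_mul, map_mul, hσ, hσ]

abbrev Poly4 := MvPolynomial (Fin 4) ℝ

lemma pderiv_comm (i j : Fin 3) (f : Poly3) :
    pderiv i (pderiv j f) = pderiv j (pderiv i f) := by
  have : ⁅(pderiv i : Derivation ℝ Poly3 Poly3), (pderiv j : Derivation ℝ Poly3 Poly3)⁆ = 0 := by
    refine MvPolynomial.derivation_ext fun k => ?_
    rw [Derivation.commutator_apply]
    fin_cases i <;> fin_cases j <;> fin_cases k <;> simp [pderiv_X]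
  have := DFunLike.congr_fun this f
  rwa [Derivation.commutator_apply, Derivation.zero_apply, sub_eq_zero] at this

/-- A ring with two commuting derivations, modelling functions of `(t, x)` on the surface `f = 0`
near `z₀`. -/
theorem exists_model (f g : Poly3) (z₀ : Fin 3 → ℝ) (hf : eval z₀ f = 0)
    (hg : eval z₀ (pderiv 2 f * g) ≠ 0) :
    ∃ (O : Type) (_ : CommRing O) (_ : Algebra ℝ O) (θ : Poly3 →ₐ[ℝ] O) (D₁ D₂ : Derivation ℝ O O)
      (_ : O →ₐ[ℝ] ℝ), θ f = 0 ∧ IsUnit (θ (pderiv 2 f * g)) ∧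
      (∀ z, D₁ (D₂ z) = D₂ (D₁ z)) ∧
      (∀ p, θ (pderiv 2 f) * D₁ (θ p) =
        θ (pderiv 2 f * pderiv 0 p - pderiv 0 f * pderiv 2 p)) ∧
      (∀ p, θ (pderiv 2 f) * D₂ (θ p) =
        θ (pderiv 2 f * pderiv 1 p - pderiv 1 f * pderiv 2 p)) := by
  let ι : Poly3 →ₐ[ℝ] Poly4 := aeval ![X 0, X 1, X 2]
  obtain ⟨s, hs⟩ : ∃ s, s = pderiv 2 f * g := ⟨_, rfl⟩
  let w : Poly4 := X 3
  let J : Ideal Poly4 := Ideal.span {w * ι s - 1, ι f}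
  have hdir : ∀ a b : ℝ, ∃ (D : Derivation ℝ (Poly4 ⧸ J) (Poly4 ⧸ J)) (h : Poly4 ⧸ J), ∀ p,
      D (Ideal.Quotient.mk J (ι p)) = algebraMap ℝ _ a * Ideal.Quotient.mk J (ι (pderiv 0 p)) +
        algebraMap ℝ _ b * Ideal.Quotient.mk J (ι (pderiv 1 p)) +
        h * Ideal.Quotient.mk J (ι (pderiv 2 p)) := by
    intro a b
    let h : Poly4 := -(C a * ι (pderiv 0 f) + C b * ι (pderiv 1 f)) * ι g * w
    let D : Derivation ℝ Poly4 Poly4 := mkDerivation ℝ ![C a, C b, h,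
      -w ^ 2 * (C a * ι (pderiv 0 s) + C b * ι (pderiv 1 s) + h * ι (pderiv 2 s))]
    have hD : ∀ p, D (ι p) = C a * ι (pderiv 0 p) + C b * ι (pderiv 1 p) + h * ι (pderiv 2 p) := by
      intro p
      induction p using MvPolynomial.induction_on with
      | C c => simp [ι, D]
      | add p q hp hq => simp only [map_add, hp, hq]; ring
      | mul_X p i hp =>
        rw [map_mul, Derivation.leibniz, hp]
        have hX : D (ι (X i)) = ![C a, C b, h] i := by
          fin_cases i <;> simp only [ι, aeval_X] <;> exact mkDerivation_X _ _ _
        rw [hX]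
        fin_cases i <;> simp [pderiv_X, ι] <;> ring
    have hDw : D w = -w ^ 2 * D (ι s) := by rw [hD]; exact mkDerivation_X _ _ _
    have hJ : ∀ z ∈ J, D z ∈ J := by
      refine derivation_mem_span D _ ?_
      rintro z (rfl | rfl)
      · have : D (w * ι s - 1) = -(w * D (ι s)) * (w * ι s - 1) := by
          rw [map_sub, Derivation.leibniz, hDw, Derivation.map_one_eq_zero, smul_eq_mul,
            smul_eq_mul]
          ring
        rw [this]
        exact Ideal.mul_mem_left _ _ (Ideal.subset_span (by simp))
      · have : D (ι f) = -(C a * ι (pderiv 0 f) + C b * ι (pderiv 1 f)) * (w * ι s - 1) := by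
          rw [hD, hs, map_mul]
          simp only [h]
          ring
        rw [this]
        exact Ideal.mul_mem_left _ _ (Ideal.subset_span (by simp))
    obtain ⟨D', hD'⟩ := exists_derivation_quotient J D hJ
    refine ⟨D', Ideal.Quotient.mk J h, fun p => ?_⟩
    rw [hD', hD]
    simp only [map_add, map_mul]
    rfl
  obtain ⟨D₁, h₁, hD₁⟩ := hdir 1 0
  obtain ⟨D₂, h₂, hD₂⟩ := hdir 0 1
  let θ : Poly3 →ₐ[ℝ] Poly4 ⧸ J := (Ideal.Quotient.mkₐ ℝ J).comp ι
  replace hD₁ : ∀ p, D₁ (θ p) = θ (pderiv 0 p) + h₁ * θ (pderiv 2 p) := fun p => by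
    have := hD₁ p
    rw [map_one, map_zero, one_mul, zero_mul, add_zero] at this
    exact this
  replace hD₂ : ∀ p, D₂ (θ p) = θ (pderiv 1 p) + h₂ * θ (pderiv 2 p) := fun p => by
    have := hD₂ p
    rw [map_one, map_zero, one_mul, zero_mul, zero_add] at this
    exact this
  have hθf : θ f = 0 := Ideal.Quotient.eq_zero_iff_mem.2 (Ideal.subset_span (by simp))
  have hws : Ideal.Quotient.mk J w * θ s = 1 := by
    have : Ideal.Quotient.mk J (w * ι s - 1) = 0 :=
      Ideal.Quotient.eq_zero_iff_mem.2 (Ideal.subset_span (by simp))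
    rwa [map_sub, map_mul, map_one, sub_eq_zero] at this
  have hus : IsUnit (θ s) := IsUnit.of_mul_eq_one _ (by rw [mul_comm]; exact hws)
  have huy : IsUnit (θ (pderiv 2 f)) := by
    rw [hs, map_mul] at hus
    exact isUnit_of_mul_isUnit_left hus
  have hf₁ : θ (pderiv 0 f) + h₁ * θ (pderiv 2 f) = 0 := by rw [← hD₁, hθf, map_zero]
  have hf₂ : θ (pderiv 1 f) + h₂ * θ (pderiv 2 f) = 0 := by rw [← hD₂, hθf, map_zero]
  have hcomm : ∀ i j, pderiv i (pderiv j f) = pderiv j (pderiv i f) := fun i j => pderiv_comm i j f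
  let ev₀ : Poly4 →ₐ[ℝ] ℝ := aeval ![z₀ 0, z₀ 1, z₀ 2, (eval z₀ s)⁻¹]
  have hev₀ : ∀ p, ev₀ (ι p) = eval z₀ p := fun p => by
    have : ev₀.comp ι = aeval z₀ := by
      ext i
      fin_cases i <;> simp only [AlgHom.comp_apply, ι, aeval_X] <;> exact aeval_X _ _
    exact (DFunLike.congr_fun this p).trans (by rw [← coe_aeval_eq_eval]; rfl)
  have hevJ : ∀ z ∈ J, ev₀ z = 0 := by
    intro z hz
    have : J ≤ RingHom.ker ev₀ := by
      rw [Ideal.span_le]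
      rintro z (rfl | rfl)
      · change ev₀ _ = 0
        rw [map_sub, map_mul, hev₀, map_one]
        have : ev₀ w = (eval z₀ s)⁻¹ := aeval_X _ _
        rw [this, inv_mul_cancel₀ (by rw [hs]; exact hg), sub_self]
      · change ev₀ _ = 0
        rw [hev₀, hf]
    exact this hz
  refine ⟨Poly4 ⧸ J, inferInstance, inferInstance, θ, D₁, D₂, Ideal.Quotient.liftₐ J ev₀ hevJ, hθf,
    hs ▸ hus, ?_, fun p => ?_, fun p => ?_⟩
  · have hmul : ∀ a b, D₁ (D₂ a) = D₂ (D₁ a) → D₁ (D₂ b) = D₂ (D₁ b) →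
        D₁ (D₂ (a * b)) = D₂ (D₁ (a * b)) := fun a b ha hb => by
      simp only [Derivation.leibniz, map_add, smul_eq_mul]
      linear_combination a * hb + b * ha
    have h12 : D₁ h₂ = D₂ h₁ := by
      have e₁ := congrArg D₂ hf₁
      have e₂ := congrArg D₁ hf₂
      simp only [map_add, Derivation.leibniz, smul_eq_mul, hD₁, hD₂, map_zero] at e₁ e₂
      rw [hcomm 1 0, hcomm 1 2] at e₁
      rw [hcomm 0 2] at e₂
      refine huy.mul_left_cancel ?_
      linear_combination e₂ - e₁
    have hX : ∀ i, D₁ (D₂ (θ (X i))) = D₂ (D₁ (θ (X i))) := by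
      intro i
      fin_cases i
      · simp [hD₁, hD₂, pderiv_X]
      · simp [hD₁, hD₂, pderiv_X]
      · simp [hD₁, hD₂, pderiv_X, h12]
    have hθ : ∀ p, D₁ (D₂ (θ p)) = D₂ (D₁ (θ p)) := by
      intro p
      induction p using MvPolynomial.induction_on with
      | C c => simp [← MvPolynomial.algebraMap_eq]
      | add p q hp hq => simp only [map_add, hp, hq]
      | mul_X p i hp => rw [map_mul]; exact hmul _ _ hp (hX i)
    have hw : D₁ (D₂ (Ideal.Quotient.mk J w)) = D₂ (D₁ (Ideal.Quotient.mk J w)) := by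
      have e₁ := congrArg (fun z => D₁ (D₂ z)) hws
      have e₂ := congrArg (fun z => D₂ (D₁ z)) hws
      simp only [Derivation.leibniz, smul_eq_mul, map_add, Derivation.map_one_eq_zero,
        map_zero] at e₁ e₂
      refine hus.mul_left_cancel ?_
      linear_combination e₁ - e₂ - Ideal.Quotient.mk J w * hθ s
    intro z
    obtain ⟨z, rfl⟩ := Ideal.Quotient.mk_surjective z
    induction z using MvPolynomial.induction_on with
    | C c =>
      have : Ideal.Quotient.mk J (C c) = algebraMap ℝ _ c := rfl
      rw [this]; simp
    | add p q hp hq => simp only [map_add, hp, hq]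
    | mul_X p i hp =>
      rw [map_mul]
      refine hmul _ _ hp ?_
      fin_cases i
      · simpa [θ, ι] using hX 0
      · simpa [θ, ι] using hX 1
      · simpa [θ, ι] using hX 2
      · exact hw
  · rw [hD₁, map_sub, map_mul, map_mul]
    linear_combination θ (pderiv 2 p) * hf₁
  · rw [hD₂, map_sub, map_mul, map_mul]
    linear_combination θ (pderiv 2 p) * hf₂

/-- `f_y` times the derivative, in the `i`-th direction, along the surface `f = 0`. -/
noncomputable def tang (f : Poly3) (i : Fin 3) (p : Poly3) : Poly3 :=
  pderiv 2 f * pderiv i p - pderiv i f * pderiv 2 p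

/-- Numerators of the second derivatives of the surface `f = 0` as a graph. -/
noncomputable def num₂ (f : Poly3) (i j : Fin 3) : Poly3 :=
  pderiv 2 f * tang f j (-pderiv i f) + pderiv i f * tang f j (pderiv 2 f)

/-- Numerators of the third derivatives of the surface `f = 0` as a graph. -/
noncomputable def num₃ (f : Poly3) (i j k : Fin 3) : Poly3 :=
  pderiv 2 f * tang f k (num₂ f i j) - 3 * num₂ f i j * tang f k (pderiv 2 f)

noncomputable def hess (f : Poly3) : Poly3 := num₂ f 0 0 * num₂ f 1 1 - num₂ f 0 1 * num₂ f 0 1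

/-- The coefficients of the cubic form of third derivatives. -/
noncomputable def cub (f : Poly3) : Fin 4 → Poly3 :=
  ![num₃ f 0 0 0, num₃ f 0 0 1 + 2 * num₃ f 0 1 0, 2 * num₃ f 0 1 1 + num₃ f 1 1 0, num₃ f 1 1 1]

noncomputable def hessD (f : Poly3) : Fin 2 → Poly3 :=
  ![3 * cub f 0 * num₂ f 1 1 + num₂ f 0 0 * cub f 2 - 2 * num₂ f 0 1 * cub f 1,
    cub f 1 * num₂ f 1 1 + 3 * num₂ f 0 0 * cub f 3 - 2 * num₂ f 0 1 * cub f 2]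

/-- The obstructions to being a quadric. -/
noncomputable def obstr (f : Poly3) : Fin 4 → Poly3 :=
  ![4 * hess f * cub f 0 - num₂ f 0 0 * hessD f 0,
    4 * hess f * cub f 1 - (num₂ f 0 0 * hessD f 1 + 2 * num₂ f 0 1 * hessD f 0),
    4 * hess f * cub f 2 - (num₂ f 1 1 * hessD f 0 + 2 * num₂ f 0 1 * hessD f 1),
    4 * hess f * cub f 3 - num₂ f 1 1 * hessD f 1]

lemma exists_pderiv_coeff {r : Poly3} {m : Fin 3 →₀ ℕ} (hm : coeff m r ≠ 0) (i : Fin 3)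
    (hi : m i ≠ 0) : coeff (m - Finsupp.single i 1) (pderiv i r) ≠ 0 := by
  rw [coeff_pderiv]
  have : m - Finsupp.single i 1 + Finsupp.single i 1 = m := by
    apply tsub_add_cancel_of_le
    rw [Finsupp.single_le_iff]
    omega
  rw [this]
  exact mul_ne_zero hm (by positivity)

lemma eq_C_of_pderiv_eq_zero {r : Poly3} (h : ∀ i, pderiv i r = 0) : r = C (coeff 0 r) := by
  ext m
  rw [coeff_C]
  split_ifs with hm
  · rw [← hm]
  · by_contra h0
    obtain ⟨i, hi⟩ := Finsupp.ne_iff.1 (Ne.symm hm)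
    exact exists_pderiv_coeff h0 i hi (by rw [h i, coeff_zero])

lemma totalDegree_pderiv_lt {r : Poly3} {i : Fin 3} (h : pderiv i r ≠ 0) :
    (pderiv i r).totalDegree < r.totalDegree := by
  have h1 : ∀ m ∈ (pderiv i r).support, (m.sum fun _ e => e) + 1 ≤ r.totalDegree := by
    intro m hm
    rw [mem_support_iff, coeff_pderiv] at hm
    have h1 := le_totalDegree (mem_support_iff.2 (left_ne_zero_of_mul hm))
    rwa [Finsupp.sum_add_index' (by simp) (by simp), Finsupp.sum_single_index rfl] at h1
  obtain ⟨m, hm⟩ := support_nonempty.2 h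
  rw [totalDegree, Finset.sup_lt_iff (by have := h1 m hm; simp only [Nat.bot_eq_zero]; omega)]
  exact fun m hm => h1 m hm

lemma pderiv_two_eq_zero {r : Poly3} (h : degreeOf 2 r = 0) : pderiv 2 r = 0 := by
  apply pderiv_eq_zero_of_notMem_vars
  rw [mem_vars_iff_degreeOf_ne_zero]
  exact fun hv => hv h

section

variable {O : Type} [CommRing O] [Algebra ℝ O] {θ : Poly3 →ₐ[ℝ] O} {D₁ D₂ : Derivation ℝ O O}
  {f : Poly3}

lemma eq_zero_of_mem_stable (hu : IsUnit (θ (pderiv 2 f)))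
    (hD₁ : ∀ p, θ (pderiv 2 f) * D₁ (θ p) = θ (tang f 0 p))
    (hD₂ : ∀ p, θ (pderiv 2 f) * D₂ (θ p) = θ (tang f 1 p)) (ev : O →ₐ[ℝ] ℝ) (I : Ideal O)
    (hI : ∀ z ∈ I, ev z = 0) (hI₁ : ∀ z ∈ I, D₁ z ∈ I) (hI₂ : ∀ z ∈ I, D₂ z ∈ I)
    (n : ℕ) (r : Poly3) (hn : r.totalDegree < n) (hr : pderiv 2 r = 0) (hrI : θ r ∈ I) :
    r = 0 := by
  induction n generalizing r with
  | zero => omega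
  | succ n ih =>
    have h0 : ∀ i, θ (pderiv i r) ∈ I → pderiv i r = 0 := fun i hi => by
      by_contra hne
      exact hne (ih _ (by have := totalDegree_pderiv_lt hne; omega)
        (by rw [pderiv_comm, hr, map_zero]) hi)
    have e₁ : D₁ (θ r) = θ (pderiv 0 r) := hu.mul_left_cancel (by
      rw [hD₁, tang, hr, mul_zero, sub_zero, map_mul])
    have e₂ : D₂ (θ r) = θ (pderiv 1 r) := hu.mul_left_cancel (by
      rw [hD₂, tang, hr, mul_zero, sub_zero, map_mul])
    have hC : r = C (coeff 0 r) := eq_C_of_pderiv_eq_zero fun i => by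
      fin_cases i
      · exact h0 0 (e₁ ▸ hI₁ _ hrI)
      · exact h0 1 (e₂ ▸ hI₂ _ hrI)
      · exact hr
    have := hI _ hrI
    rw [hC, ← MvPolynomial.algebraMap_eq, AlgHom.commutes, AlgHom.commutes] at this
    rw [hC, show coeff 0 r = 0 from this, C_0]

/-- The ten monomials of degree at most two. -/
noncomputable def quadMonomial : Fin 10 → Poly3 :=
  ![X 2 ^ 2, X 2, X 2 * X 0, X 2 * X 1, 1, X 0, X 1, X 0 ^ 2, X 0 * X 1, X 1 ^ 2]

lemma quad_ne_zero {c : Fin 10 → ℝ} (hc : c ≠ 0) : ∑ i, c i • quadMonomial i ≠ 0 := by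
  intro h
  have he : ∀ t x y : ℝ, c 0 * y ^ 2 + c 1 * y + c 2 * (y * t) + c 3 * (y * x) + c 4 + c 5 * t +
      c 6 * x + c 7 * t ^ 2 + c 8 * (t * x) + c 9 * x ^ 2 = 0 := fun t x y => by
    have := congrArg (eval ![t, x, y]) h
    simp [Fin.sum_univ_succ, quadMonomial] at this
    linarith
  have e0 := he 0 0 0
  have e1 := he 0 0 1
  have e2 := he 0 0 (-1)
  have e3 := he 1 0 0
  have e4 := he (-1) 0 0
  have e5 := he 0 1 0
  have e6 := he 0 (-1) 0
  have e7 := he 1 1 0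
  have e8 := he 1 0 1
  have e9 := he 0 1 1
  apply hc
  ext i
  fin_cases i
  · change c 0 = 0; linarith
  · change c 1 = 0; linarith
  · change c 2 = 0; linarith
  · change c 3 = 0; linarith
  · change c 4 = 0; linarith
  · change c 5 = 0; linarith
  · change c 6 = 0; linarith
  · change c 7 = 0; linarith
  · change c 8 = 0; linarith
  · change c 9 = 0; linarith

lemma totalDegree_quad_le (c : Fin 10 → ℝ) : (∑ i, c i • quadMonomial i).totalDegree ≤ 2 := by
  refine totalDegree_finsetSum_le fun i _ => (totalDegree_smul_le _ _).trans ?_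
  have hmul : ∀ i j : Fin 3, (X i * X j : Poly3).totalDegree ≤ 2 := fun i j =>
    (totalDegree_mul _ _).trans (by simp)
  have hX : ∀ i : Fin 3, (X i : Poly3).totalDegree ≤ 2 := fun i => by simp
  fin_cases i
  · simp [quadMonomial]
  · exact hX 2
  · exact hmul 2 0
  · exact hmul 2 1
  · simp [quadMonomial]
  · exact hX 0
  · exact hX 1
  · simp [quadMonomial]
  · exact hmul 0 1
  · simp [quadMonomial]

lemma totalDegree_le_two_of_stable (hf : Irreducible f) (hθ : θ f = 0)
    (hu : IsUnit (θ (pderiv 2 f)))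
    (hD₁ : ∀ p, θ (pderiv 2 f) * D₁ (θ p) = θ (tang f 0 p))
    (hD₂ : ∀ p, θ (pderiv 2 f) * D₂ (θ p) = θ (tang f 1 p)) (ev : O →ₐ[ℝ] ℝ) (I : Ideal O)
    (hI : ∀ z ∈ I, ev z = 0) (hI₁ : ∀ z ∈ I, D₁ z ∈ I) (hI₂ : ∀ z ∈ I, D₂ z ∈ I)
    {c : Fin 10 → ℝ} (hc : c ≠ 0) (hcI : θ (∑ i, c i • quadMonomial i) ∈ I) :
    f.totalDegree ≤ 2 := by
  by_cases hdvd : f ∣ ∑ i, c i • quadMonomial i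
  · exact (totalDegree_le_of_dvd_of_isDomain hdvd (quad_ne_zero hc)).trans (totalDegree_quad_le c)
  · obtain ⟨α, β, hne, hdeg⟩ := exists_elimination hf hdvd
    refine absurd (eq_zero_of_mem_stable hu hD₁ hD₂ ev I hI hI₁ hI₂ _ _ (Nat.lt_succ_self _)
      (pderiv_two_eq_zero hdeg) ?_) hne
    rw [map_add, map_mul, map_mul, hθ, mul_zero, zero_add]
    exact I.mul_mem_left _ hcI

lemma mul_derivation_of_mul {D : Derivation ℝ O O} {i : Fin 3}
    (hD : ∀ p, θ (pderiv 2 f) * D (θ p) = θ (tang f i p)) {z : O} {p : Poly3} (a : ℕ)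
    (hz : θ (pderiv 2 f) ^ a * z = θ p) :
    θ (pderiv 2 f) ^ (a + 2) * D z =
      θ (pderiv 2 f * tang f i p - a * p * tang f i (pderiv 2 f)) := by
  have h := congrArg (fun w => θ (pderiv 2 f) ^ 2 * D w) hz
  have hp := hD p
  have hf := hD (pderiv 2 f)
  simp only [Derivation.leibniz, Derivation.leibniz_pow, smul_eq_mul, nsmul_eq_mul] at h
  rw [map_sub, map_mul, map_mul, map_mul, map_natCast]
  rcases a with _ | a
  · simp at h ⊢
    linear_combination h + θ (pderiv 2 f) * hp
  · simp only [Nat.add_sub_cancel] at h ⊢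
    linear_combination h + θ (pderiv 2 f) * hp - (↑(a + 1) : O) * θ p * hf -
      (↑(a + 1) : O) * θ (pderiv 2 f) * D (θ (pderiv 2 f)) * hz

end

lemma num₂_symm (f : Poly3) (i j : Fin 3) : num₂ f i j = num₂ f j i := by
  simp only [num₂, tang, map_neg]
  rw [pderiv_comm j i, pderiv_comm 2 i, pderiv_comm 2 j]
  ring

/-- Hessian and cubic data on the surface, in a model of functions of `(t, x)` on it. -/
lemma model_relations {O : Type} [CommRing O] [Algebra ℝ O] {θ : Poly3 →ₐ[ℝ] O}
    {D : Fin 2 → Derivation ℝ O O} {f : Poly3}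
    (hD : ∀ i p, θ (pderiv 2 f) * D i (θ p) = θ (tang f (Fin.castSucc i) p)) (i j k : Fin 2) :
    θ (pderiv 2 f) ^ 3 * D j (D i (θ (X 2))) = θ (num₂ f i.castSucc j.castSucc) ∧
    θ (pderiv 2 f) ^ 5 * D k (D j (D i (θ (X 2)))) =
      θ (num₃ f i.castSucc j.castSucc k.castSucc) := by
  have h1 : θ (pderiv 2 f) ^ 1 * D i (θ (X 2)) = θ (-pderiv i.castSucc f) := by
    rw [pow_one, hD, tang]
    have : pderiv i.castSucc (X 2 : Poly3) = 0 := pderiv_X_of_ne (by fin_cases i <;> decide)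
    rw [this, pderiv_X_self]
    simp
  have h2 := mul_derivation_of_mul (hD j) 1 h1
  have e2 : pderiv 2 f * tang f j.castSucc (-pderiv i.castSucc f) -
      ((1 : ℕ) : Poly3) * -pderiv i.castSucc f * tang f j.castSucc (pderiv 2 f) =
      num₂ f i.castSucc j.castSucc := by rw [num₂]; push_cast; ring
  rw [e2] at h2
  have h3 := mul_derivation_of_mul (hD k) 3 h2
  refine ⟨h2, h3.trans ?_⟩
  rw [num₃]; push_cast; rfl

lemma map_eq_zero_of_dvd {O : Type} [CommRing O] [Algebra ℝ O] {θ : Poly3 →ₐ[ℝ] O} {f p : Poly3}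
    (h : θ f = 0) (hd : f ∣ p) : θ p = 0 := by
  obtain ⟨q, rfl⟩ := hd
  rw [map_mul, h, zero_mul]

lemma theta_quad {O : Type} [CommRing O] [Algebra ℝ O] (θ : Poly3 →ₐ[ℝ] O) (c : Fin 10 → ℝ) :
    θ (∑ i, c i • quadMonomial i) = ∑ i, c i • (![θ (X 2) ^ 2, θ (X 2), θ (X 2) * θ (X 0),
      θ (X 2) * θ (X 1), 1, θ (X 0), θ (X 1), θ (X 0) ^ 2, θ (X 0) * θ (X 1), θ (X 1) ^ 2] :
        Fin 10 → O) i := by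
  rw [map_sum]
  refine Finset.sum_congr rfl fun i _ => ?_
  rw [map_smul]
  congr 1
  fin_cases i <;> simp [quadMonomial]

lemma coord_derivation {O : Type} [CommRing O] [Algebra ℝ O] {θ : Poly3 →ₐ[ℝ] O}
    {D : Fin 2 → Derivation ℝ O O} {f : Poly3} (hu : IsUnit (θ (pderiv 2 f)))
    (hD : ∀ i p, θ (pderiv 2 f) * D i (θ p) = θ (tang f (Fin.castSucc i) p)) (i j : Fin 2) :
    D i (θ (X j.castSucc)) = if i = j then 1 else 0 := by
  refine hu.mul_left_cancel ?_
  rw [hD, tang]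
  fin_cases i <;> fin_cases j <;> simp [pderiv_X]

lemma exists_model_fin (f g : Poly3) (z₀ : Fin 3 → ℝ) (hf : eval z₀ f = 0)
    (hg : eval z₀ (pderiv 2 f * g) ≠ 0) :
    ∃ (O : Type) (_ : CommRing O) (_ : Algebra ℝ O) (θ : Poly3 →ₐ[ℝ] O)
      (D : Fin 2 → Derivation ℝ O O) (_ : O →ₐ[ℝ] ℝ), θ f = 0 ∧ IsUnit (θ (pderiv 2 f)) ∧
      IsUnit (θ g) ∧ (∀ z, D 0 (D 1 z) = D 1 (D 0 z)) ∧
      (∀ i p, θ (pderiv 2 f) * D i (θ p) = θ (tang f (Fin.castSucc i) p)) := by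
  obtain ⟨O, _, _, θ, D₁, D₂, ev, h1, h2, h3, h4, h5⟩ := exists_model f g z₀ hf hg
  rw [map_mul] at h2
  refine ⟨O, _, _, θ, ![D₁, D₂], ev, h1, isUnit_of_mul_isUnit_left h2,
    isUnit_of_mul_isUnit_right h2, h3, fun i p => ?_⟩
  fin_cases i
  · exact h4 p
  · exact h5 p

/-- A surface with vanishing second fundamental form has degree at most two. -/
theorem totalDegree_le_two_of_flat {f : Poly3} (hf : Irreducible f) {z₀ : Fin 3 → ℝ}
    (hz : eval z₀ f = 0) (hz₂ : eval z₀ (pderiv 2 f) ≠ 0) (h00 : f ∣ num₂ f 0 0)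
    (h01 : f ∣ num₂ f 0 1) (h11 : f ∣ num₂ f 1 1) : f.totalDegree ≤ 2 := by
  obtain ⟨O, _, _, θ, D, ev, hθ, hu, -, hc, hD⟩ := exists_model_fin f 1 z₀ hz (by simpa using hz₂)
  have hrel := fun i j => (model_relations hD i j 0).1
  have hcan : ∀ z, θ (pderiv 2 f) ^ 3 * z = 0 → z = 0 := fun z h =>
    (hu.pow 3).mul_left_cancel (by rw [h, mul_zero])
  have k00 : D 0 (D 0 (θ (X 2))) = 0 := hcan _ ((hrel 0 0).trans (map_eq_zero_of_dvd hθ h00))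
  have k01 : D 1 (D 0 (θ (X 2))) = 0 := hcan _ ((hrel 0 1).trans (map_eq_zero_of_dvd hθ h01))
  have k11 : D 1 (D 1 (θ (X 2))) = 0 := hcan _ ((hrel 1 1).trans (map_eq_zero_of_dvd hθ h11))
  have hX := coord_derivation hu hD
  obtain ⟨c, hc0, I, hI, hI₁, hI₂, hcI⟩ := exists_quadric_ideal (D 0) (D 1) (θ (X 0)) (θ (X 1))
    (θ (X 2)) (hX 0 0) (hX 1 0) (hX 0 1) (hX 1 1) hc rfl rfl k00 k01 k11 0 0 0
    (by simp) (by simp) (by simp) (by simp) (by simp) (by simp) (by simp) (by simp) (by simp)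
    (by simp) ev
  exact totalDegree_le_two_of_stable hf hθ hu (hD 0) (hD 1) ev I hI hI₁ hI₂ hc0
    (by rw [theta_quad]; exact hcI)

/-- A surface annihilated by the obstructions and with nonzero Hessian has degree at most two. -/
theorem totalDegree_le_two_of_obstr {f : Poly3} (hf : Irreducible f) {z₀ : Fin 3 → ℝ}
    (hz : eval z₀ f = 0) (hz₂ : eval z₀ (pderiv 2 f * hess f) ≠ 0) (h : ∀ i, f ∣ obstr f i) :
    f.totalDegree ≤ 2 := by
  obtain ⟨O, _, _, θ, D, ev, hθ, hu, hH, hc, hD⟩ := exists_model_fin f (hess f) z₀ hz hz₂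
  obtain ⟨y, hy⟩ : ∃ y, y = θ (X 2) := ⟨_, rfl⟩
  have hrel := model_relations hD
  have hX := coord_derivation hu hD
  have hR : ∀ i, θ (obstr f i) = 0 := fun i => map_eq_zero_of_dvd hθ (h i)
  rw [← hy] at hrel
  have q00 := (hrel 0 0 0).1
  have q01 := (hrel 0 1 0).1
  have q11 := (hrel 1 1 0).1
  have c000 := (hrel 0 0 0).2
  have c001 := (hrel 0 0 1).2
  have c010 := (hrel 0 1 0).2
  have c011 := (hrel 0 1 1).2
  have c110 := (hrel 1 1 0).2
  have c111 := (hrel 1 1 1).2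
  have R0 := hR 0
  have R1 := hR 1
  have R2 := hR 2
  have R3 := hR 3
  obtain ⟨u, hu'⟩ : ∃ u, u = θ (pderiv 2 f) := ⟨_, rfl⟩
  simp only [obstr, hess, hessD, cub, Matrix.cons_val_zero, Matrix.cons_val_one, Matrix.cons_val,
    map_sub, map_add, map_mul, map_ofNat] at R0 R1 R2 R3 hH
  simp only [Fin.castSucc_zero, Fin.castSucc_one] at q00 q01 q11 c000 c001 c010 c011 c110 c111
  rw [← q00, ← q11, ← q01] at hH
  rw [← q00, ← q11, ← q01, ← c000, ← c001, ← c010, ← c011, ← c110] at R0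
  rw [← q00, ← q11, ← q01, ← c000, ← c001, ← c010, ← c011, ← c110, ← c111] at R1
  rw [← q00, ← q11, ← q01, ← c000, ← c001, ← c010, ← c011, ← c110, ← c111] at R2
  rw [← q00, ← q11, ← q01, ← c001, ← c010, ← c011, ← c110, ← c111] at R3
  have s010 : D 0 (D 1 (D 0 y)) = D 1 (D 0 (D 0 y)) := hc _
  have s011 : D 1 (D 1 (D 0 y)) = D 0 (D 1 (D 1 y)) := by rw [hc, hc]
  have hu₂ : IsUnit u := hu' ▸ hu
  rw [← hu', s010, s011] at R0 R1 R2 R3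
  rw [← hu'] at hH
  clear hrel q00 q01 q11 c000 c001 c010 c011 c110 c111
  obtain ⟨h00, e00⟩ : ∃ h, h = D 0 (D 0 y) := ⟨_, rfl⟩
  obtain ⟨h01, e01⟩ : ∃ h, h = D 1 (D 0 y) := ⟨_, rfl⟩
  obtain ⟨h11, e11⟩ : ∃ h, h = D 1 (D 1 y) := ⟨_, rfl⟩
  rw [← e00, ← e11] at R0 R1 R2 R3
  rw [← e01] at R0 R1 R2 R3
  rw [← e00, ← e01, ← e11] at hH
  rw [← e00] at s010
  rw [← e11] at s011
  have hH₂ : IsUnit (h00 * h11 - h01 * h01) := by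
    have : u ^ 3 * h00 * (u ^ 3 * h11) - u ^ 3 * h01 * (u ^ 3 * h01) =
        u ^ 6 * (h00 * h11 - h01 * h01) := by ring
    rw [this] at hH
    exact isUnit_of_mul_isUnit_right hH
  obtain ⟨v, hv⟩ : ∃ v, 12 * (h00 * h11 - h01 * h01) * v = 1 := by
    obtain ⟨H, hH₃⟩ := hH₂
    refine ⟨algebraMap ℝ O (1 / 12) * (↑H⁻¹ : O), ?_⟩
    have h12 : algebraMap ℝ O (1 / 12) * 12 = 1 := by
      have : (12 : O) = algebraMap ℝ O 12 := (map_ofNat _ 12).symm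
      rw [this, ← map_mul]; norm_num
    have hHi : (H : O) * (↑H⁻¹ : O) = 1 := by simp
    rw [← hH₃]
    linear_combination (H : O) * (↑H⁻¹ : O) * h12 + hHi
  obtain ⟨s₁, hs₁⟩ : ∃ s, s = -(3 * v * (D 0 h00 * h11 + h00 * D 0 h11 - 2 * h01 * D 1 h00)) :=
    ⟨_, rfl⟩
  obtain ⟨s₂, hs₂⟩ : ∃ s, s = -(3 * v * (D 1 h00 * h11 + h00 * D 1 h11 - 2 * h01 * D 0 h11)) :=
    ⟨_, rfl⟩
  have hcan : ∀ z, u ^ 11 * z = 0 → z = 0 := fun z h =>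
    (hu₂.pow 11).mul_left_cancel (by rw [h, mul_zero])
  have T0 : 4 * (h00 * h11 - h01 * h01) * D 0 h00 -
      3 * h00 * (D 0 h00 * h11 + h00 * D 0 h11 - 2 * h01 * D 1 h00) = 0 :=
    hcan _ (by linear_combination R0)
  have T1 : 12 * (h00 * h11 - h01 * h01) * D 1 h00 -
      3 * (h00 * (D 1 h00 * h11 + h00 * D 1 h11 - 2 * h01 * D 0 h11) +
        2 * h01 * (D 0 h00 * h11 + h00 * D 0 h11 - 2 * h01 * D 1 h00)) = 0 :=
    hcan _ (by linear_combination R1)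
  have T2 : 12 * (h00 * h11 - h01 * h01) * D 0 h11 -
      3 * (h11 * (D 0 h00 * h11 + h00 * D 0 h11 - 2 * h01 * D 1 h00) +
        2 * h01 * (D 1 h00 * h11 + h00 * D 1 h11 - 2 * h01 * D 0 h11)) = 0 :=
    hcan _ (by linear_combination R2)
  have T3 : 4 * (h00 * h11 - h01 * h01) * D 1 h11 -
      3 * h11 * (D 1 h00 * h11 + h00 * D 1 h11 - 2 * h01 * D 0 h11) = 0 :=
    hcan _ (by linear_combination R3)
  have r111 : D 0 h00 = -(3 * h00 * s₁) := by
    rw [hs₁]; linear_combination 3 * v * T0 - D 0 h00 * hv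
  have r112 : D 1 h00 = -(h00 * s₂ + 2 * h01 * s₁) := by
    rw [hs₁, hs₂]; linear_combination v * T1 - D 1 h00 * hv
  have r122 : D 0 h11 = -(h11 * s₁ + 2 * h01 * s₂) := by
    rw [hs₁, hs₂]; linear_combination v * T2 - D 0 h11 * hv
  have r222 : D 1 h11 = -(3 * h11 * s₂) := by
    rw [hs₂]; linear_combination 3 * v * T3 - D 1 h11 * hv
  have r121 : D 0 h01 = -(h00 * s₂ + 2 * h01 * s₁) := by rw [← r112, ← s010, ← e01]
  have r221 : D 1 h01 = -(h11 * s₁ + 2 * h01 * s₂) := by rw [← r122, ← s011, ← e01]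
  obtain ⟨ν, i11, i12, i21, i22, n1, n2⟩ :=
    integrability (D 0) (D 1) hc hH₂ r111 r112 r121 r221 r122 r222
  obtain ⟨c, hc0, I, hI, hI₁, hI₂, hcI⟩ := exists_quadric_ideal (D 0) (D 1) (θ (X 0)) (θ (X 1))
    (θ (X 2)) (hX 0 0) (hX 1 0) (hX 0 1) (hX 1 1) hc rfl rfl (by rw [e00, hy]) (by rw [e01, hy])
    (by rw [e11, hy]) s₁ s₂ ν r111 r112 r122 r222 i11 i12 i21 i22 n1 n2 ev
  exact totalDegree_le_two_of_stable hf hθ hu (hD 0) (hD 1) ev I hI hI₁ hI₂ hc0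
    (by rw [theta_quad]; exact hcI)

lemma derivative_res (ℓ : Line) (p : Poly3) :
    Polynomial.derivative (res ℓ p) = res ℓ (pderiv 0 p) -
      Polynomial.C ℓ.1.1 * res ℓ (pderiv 1 p) + Polynomial.C ℓ.2.2 * res ℓ (pderiv 2 p) := by
  induction p using MvPolynomial.induction_on with
  | C c => simp
  | add p q hp hq => simp only [map_add, hp, hq]; ring
  | mul_X p i hp =>
    simp only [map_mul, Polynomial.derivative_mul, hp, Derivation.leibniz, map_add, smul_eq_mul]
    fin_cases i <;> simp [pderiv_X] <;> ring

section

variable {ℓ : Line} {f : Poly3}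

lemma res_tang (h : res ℓ f = 0) (p : Poly3) :
    res ℓ (tang f 0 p) - Polynomial.C ℓ.1.1 * res ℓ (tang f 1 p) =
      res ℓ (pderiv 2 f) * Polynomial.derivative (res ℓ p) := by
  have hd := derivative_res ℓ f
  rw [h, Polynomial.derivative_zero] at hd
  rw [derivative_res, tang, tang]
  simp only [map_sub, map_mul]
  linear_combination res ℓ (pderiv 2 p) * hd

lemma res_num₂_sum (h : res ℓ f = 0) (i : Fin 3) :
    res ℓ (num₂ f i 0) - Polynomial.C ℓ.1.1 * res ℓ (num₂ f i 1) =
      res ℓ (pderiv 2 f) * (res ℓ (pderiv 2 f) * Polynomial.derivative (res ℓ (-pderiv i f)) +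
        res ℓ (pderiv i f) * Polynomial.derivative (res ℓ (pderiv 2 f))) := by
  have h1 := res_tang h (-pderiv i f)
  have h2 := res_tang h (pderiv 2 f)
  rw [num₂, num₂]
  simp only [map_add, map_mul]
  linear_combination res ℓ (pderiv 2 f) * h1 + res ℓ (pderiv i f) * h2

lemma res_num₂ (h : res ℓ f = 0) :
    res ℓ (num₂ f 0 0) - 2 * Polynomial.C ℓ.1.1 * res ℓ (num₂ f 0 1) +
      Polynomial.C ℓ.1.1 ^ 2 * res ℓ (num₂ f 1 1) = 0 := by
  have h0 := res_num₂_sum h 0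
  have h1 := res_num₂_sum h 1
  rw [num₂_symm f 1 0] at h1
  have hd := derivative_res ℓ f
  rw [h, Polynomial.derivative_zero] at hd
  have hdd := congrArg Polynomial.derivative hd
  simp only [Polynomial.derivative_add, Polynomial.derivative_sub, Polynomial.derivative_mul,
    Polynomial.derivative_C, zero_mul, zero_add, Polynomial.derivative_zero] at hdd
  simp only [map_neg] at h0 h1
  linear_combination h0 - Polynomial.C ℓ.1.1 * h1 + res ℓ (pderiv 2 f) ^ 2 * hdd -
    res ℓ (pderiv 2 f) * Polynomial.derivative (res ℓ (pderiv 2 f)) * hd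

lemma res_num₃_sum (h : res ℓ f = 0) (i j : Fin 3) :
    res ℓ (num₃ f i j 0) - Polynomial.C ℓ.1.1 * res ℓ (num₃ f i j 1) =
      res ℓ (pderiv 2 f) * (res ℓ (pderiv 2 f) * Polynomial.derivative (res ℓ (num₂ f i j)) -
        3 * res ℓ (num₂ f i j) * Polynomial.derivative (res ℓ (pderiv 2 f))) := by
  have h1 := res_tang h (num₂ f i j)
  have h2 := res_tang h (pderiv 2 f)
  rw [num₃, num₃]
  simp only [map_sub, map_mul, map_ofNat]
  linear_combination res ℓ (pderiv 2 f) * h1 - 3 * res ℓ (num₂ f i j) * h2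

lemma res_cub (h : res ℓ f = 0) :
    res ℓ (cub f 0) - Polynomial.C ℓ.1.1 * res ℓ (cub f 1) +
      Polynomial.C ℓ.1.1 ^ 2 * res ℓ (cub f 2) - Polynomial.C ℓ.1.1 ^ 3 * res ℓ (cub f 3) = 0 := by
  have h00 := res_num₃_sum h 0 0
  have h01 := res_num₃_sum h 0 1
  have h11 := res_num₃_sum h 1 1
  have hq := res_num₂ h
  have hqd := congrArg Polynomial.derivative hq
  simp only [Polynomial.derivative_add, Polynomial.derivative_sub, Polynomial.derivative_mul,
    Polynomial.derivative_C, zero_mul, zero_add, Polynomial.derivative_zero,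
    Polynomial.derivative_pow, mul_zero, Polynomial.derivative_ofNat] at hqd
  simp only [cub, Matrix.cons_val_zero, Matrix.cons_val_one, Matrix.cons_val, map_add, map_mul,
    map_ofNat]
  linear_combination h00 - 2 * Polynomial.C ℓ.1.1 * h01 + Polynomial.C ℓ.1.1 ^ 2 * h11 +
    res ℓ (pderiv 2 f) ^ 2 * hqd -
    3 * res ℓ (pderiv 2 f) * Polynomial.derivative (res ℓ (pderiv 2 f)) * hq

lemma eval_num₂ (h : res ℓ f = 0) (t : ℝ) :
    eval (pt ℓ t) (num₂ f 0 0) - 2 * ℓ.1.1 * eval (pt ℓ t) (num₂ f 0 1) +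
      ℓ.1.1 ^ 2 * eval (pt ℓ t) (num₂ f 1 1) = 0 := by
  have := congrArg (Polynomial.eval t) (res_num₂ h)
  simpa [eval_res] using this

lemma eval_cub (h : res ℓ f = 0) (t : ℝ) :
    eval (pt ℓ t) (cub f 0) - ℓ.1.1 * eval (pt ℓ t) (cub f 1) +
      ℓ.1.1 ^ 2 * eval (pt ℓ t) (cub f 2) - ℓ.1.1 ^ 3 * eval (pt ℓ t) (cub f 3) = 0 := by
  have := congrArg (Polynomial.eval t) (res_cub h)
  simpa [eval_res] using this

end

lemma obstr_arith {m n q₀ q₁ q₂ c₀ c₁ c₂ c₃ : ℝ} (hmn : m ≠ n)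
    (hm : q₀ - 2 * m * q₁ + m ^ 2 * q₂ = 0) (hn : q₀ - 2 * n * q₁ + n ^ 2 * q₂ = 0)
    (cm : c₀ - m * c₁ + m ^ 2 * c₂ - m ^ 3 * c₃ = 0)
    (cn : c₀ - n * c₁ + n ^ 2 * c₂ - n ^ 3 * c₃ = 0) :
    q₀ = m * n * q₂ ∧ q₁ = (m + n) / 2 * q₂ ∧ c₁ = (m + n) * c₂ - (m ^ 2 + m * n + n ^ 2) * c₃ ∧
      c₀ = m * n * c₂ - m * n * (m + n) * c₃ := by
  have h := sub_ne_zero.2 hmn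
  have e1 : q₁ = (m + n) / 2 * q₂ := mul_left_cancel₀ h (by linear_combination (hn - hm) / 2)
  have e2 : c₁ = (m + n) * c₂ - (m ^ 2 + m * n + n ^ 2) * c₃ :=
    mul_left_cancel₀ h (by linear_combination cn - cm)
  refine ⟨?_, e1, e2, ?_⟩
  · rw [e1] at hm; linear_combination hm
  · rw [e2] at cm; linear_combination cm

/-- At the meeting point of two lines of the surface with different directions the obstructions
vanish, and the second fundamental form vanishes together with the Hessian. -/
lemma eval_obstr_of_meet {ℓ ℓ' : Line} {f : Poly3} (h : res ℓ f = 0) (h' : res ℓ' f = 0)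
    {t t' : ℝ} (ht : pt ℓ t = pt ℓ' t') (hu : ℓ.1.1 ≠ ℓ'.1.1) :
    (∀ i, eval (pt ℓ t) (obstr f i) = 0) ∧ (eval (pt ℓ t) (hess f) = 0 →
      eval (pt ℓ t) (num₂ f 0 0) = 0 ∧ eval (pt ℓ t) (num₂ f 0 1) = 0 ∧
        eval (pt ℓ t) (num₂ f 1 1) = 0) := by
  have a1 := eval_num₂ h t
  have a2 := eval_cub h t
  have b1 := eval_num₂ h' t'
  have b2 := eval_cub h' t'
  rw [← ht] at b1 b2
  obtain ⟨e1, e2, e3, e4⟩ := obstr_arith hu a1 b1 a2 b2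
  constructor
  · intro i
    fin_cases i <;>
    · simp only [obstr, hess, hessD, Fin.zero_eta, Fin.mk_one, Fin.reduceFinMk,
        Matrix.cons_val_zero, Matrix.cons_val_one, Matrix.cons_val, map_sub, map_add, map_mul,
        map_ofNat]
      simp only [e1, e2, e3, e4]
      ring
  · intro hh
    simp only [hess, map_sub, map_mul] at hh
    rw [e1, e2] at hh ⊢
    have h2 : ((ℓ.1.1 - ℓ'.1.1) * eval (pt ℓ t) (num₂ f 1 1)) ^ 2 = 0 := by
      linear_combination (-4) * hh
    have h3 : eval (pt ℓ t) (num₂ f 1 1) = 0 :=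
      (mul_eq_zero.1 (pow_eq_zero_iff two_ne_zero |>.1 h2)).resolve_left (sub_ne_zero.2 hu)
    simp [h3]

section

variable (f : Poly3)

lemma totalDegree_mul_le_of {p q : Poly3} {a b : ℕ} (hp : p.totalDegree ≤ a)
    (hq : q.totalDegree ≤ b) : (p * q).totalDegree ≤ a + b :=
  (totalDegree_mul _ _).trans (add_le_add hp hq)

lemma totalDegree_add_le_of {p q : Poly3} {a : ℕ} (hp : p.totalDegree ≤ a)
    (hq : q.totalDegree ≤ a) : (p + q).totalDegree ≤ a :=
  (totalDegree_add _ _).trans (max_le hp hq)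

lemma totalDegree_sub_le_of {p q : Poly3} {a : ℕ} (hp : p.totalDegree ≤ a)
    (hq : q.totalDegree ≤ a) : (p - q).totalDegree ≤ a :=
  (totalDegree_sub _ _).trans (max_le hp hq)

lemma totalDegree_ofNat_le (n a : ℕ) [n.AtLeastTwo] :
    (OfNat.ofNat n : Poly3).totalDegree ≤ a := by
  rw [← map_ofNat (C (σ := Fin 3) (R := ℝ)) n, totalDegree_C]
  exact Nat.zero_le _

lemma totalDegree_pderiv_le (i : Fin 3) (p : Poly3) :
    (pderiv i p).totalDegree ≤ p.totalDegree := by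
  by_cases h : pderiv i p = 0
  · simp [h]
  · exact (totalDegree_pderiv_lt h).le

lemma totalDegree_tang_le (i : Fin 3) (p : Poly3) :
    (tang f i p).totalDegree ≤ f.totalDegree + p.totalDegree :=
  totalDegree_sub_le_of
    (totalDegree_mul_le_of (totalDegree_pderiv_le _ _) (totalDegree_pderiv_le _ _))
    (totalDegree_mul_le_of (totalDegree_pderiv_le _ _) (totalDegree_pderiv_le _ _))

lemma totalDegree_num₂_le (i j : Fin 3) : (num₂ f i j).totalDegree ≤ 3 * f.totalDegree := by
  have h := totalDegree_pderiv_le i f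
  have h2 := totalDegree_pderiv_le 2 f
  have h3 := totalDegree_tang_le f j (-pderiv i f)
  have h4 := totalDegree_tang_le f j (pderiv 2 f)
  rw [totalDegree_neg] at h3
  refine totalDegree_add_le_of ((totalDegree_mul _ _).trans ?_) ((totalDegree_mul _ _).trans ?_) <;>
    omega

lemma totalDegree_num₃_le (i j k : Fin 3) : (num₃ f i j k).totalDegree ≤ 5 * f.totalDegree := by
  have h2 := totalDegree_pderiv_le 2 f
  have h0 := totalDegree_num₂_le f i j
  have h3 := totalDegree_tang_le f k (num₂ f i j)
  have h4 := totalDegree_tang_le f k (pderiv 2 f)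
  have h5 : (3 * num₂ f i j).totalDegree ≤ 0 + 3 * f.totalDegree :=
    totalDegree_mul_le_of (totalDegree_ofNat_le 3 0) h0
  refine totalDegree_sub_le_of ((totalDegree_mul _ _).trans ?_) ((totalDegree_mul _ _).trans ?_) <;>
    omega

lemma totalDegree_hess_le : (hess f).totalDegree ≤ 6 * f.totalDegree := by
  have h := totalDegree_num₂_le f
  have h1 := h 0 0
  have h2 := h 0 1
  have h3 := h 1 1
  refine totalDegree_sub_le_of ((totalDegree_mul _ _).trans ?_) ((totalDegree_mul _ _).trans ?_) <;>
    omega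

lemma totalDegree_cub_le (i : Fin 4) : (cub f i).totalDegree ≤ 5 * f.totalDegree := by
  have h := totalDegree_num₃_le f
  have h2 : ∀ i j k, (2 * num₃ f i j k).totalDegree ≤ 5 * f.totalDegree := fun i j k =>
    (totalDegree_mul_le_of (totalDegree_ofNat_le 2 0) (h i j k)).trans (by omega)
  fin_cases i
  · exact h 0 0 0
  · exact totalDegree_add_le_of (h 0 0 1) (h2 0 1 0)
  · exact totalDegree_add_le_of (h2 0 1 1) (h 1 1 0)
  · exact h 1 1 1

lemma totalDegree_hessD_le (i : Fin 2) : (hessD f i).totalDegree ≤ 8 * f.totalDegree := by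
  have h := totalDegree_num₂_le f
  have hc := totalDegree_cub_le f
  have h3 : ∀ i j k, (3 * cub f k * num₂ f i j).totalDegree ≤ 8 * f.totalDegree := fun i j k =>
    (totalDegree_mul_le_of (totalDegree_mul_le_of (totalDegree_ofNat_le 3 0) (hc k))
      (h i j)).trans (by omega)
  have h3' : ∀ i j k, (3 * num₂ f i j * cub f k).totalDegree ≤ 8 * f.totalDegree := fun i j k =>
    (totalDegree_mul_le_of (totalDegree_mul_le_of (totalDegree_ofNat_le 3 0) (h i j))
      (hc k)).trans (by omega)
  have h2 : ∀ i j k, (2 * num₂ f i j * cub f k).totalDegree ≤ 8 * f.totalDegree := fun i j k =>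
    (totalDegree_mul_le_of (totalDegree_mul_le_of (totalDegree_ofNat_le 2 0) (h i j))
      (hc k)).trans (by omega)
  have h1 : ∀ i j k, (num₂ f i j * cub f k).totalDegree ≤ 8 * f.totalDegree := fun i j k =>
    (totalDegree_mul_le_of (h i j) (hc k)).trans (by omega)
  fin_cases i
  · exact totalDegree_sub_le_of (totalDegree_add_le_of (h3 _ _ _) (h1 _ _ _)) (h2 _ _ _)
  · refine totalDegree_sub_le_of (totalDegree_add_le_of ?_ (h3' _ _ _)) (h2 _ _ _)
    rw [mul_comm]; exact h1 _ _ _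

lemma totalDegree_obstr_le (i : Fin 4) : (obstr f i).totalDegree ≤ 11 * f.totalDegree := by
  have h := totalDegree_num₂_le f
  have hD := totalDegree_hessD_le f
  have h4 : ∀ k, (4 * hess f * cub f k).totalDegree ≤ 11 * f.totalDegree := fun k =>
    (totalDegree_mul_le_of (totalDegree_mul_le_of (totalDegree_ofNat_le 4 0)
      (totalDegree_hess_le f)) (totalDegree_cub_le f k)).trans (by omega)
  have h1 : ∀ i j k, (num₂ f i j * hessD f k).totalDegree ≤ 11 * f.totalDegree := fun i j k =>
    (totalDegree_mul_le_of (h i j) (hD k)).trans (by omega)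
  have h2 : ∀ i j k, (2 * num₂ f i j * hessD f k).totalDegree ≤ 11 * f.totalDegree := fun i j k =>
    (totalDegree_mul_le_of (totalDegree_mul_le_of (totalDegree_ofNat_le 2 0) (h i j))
      (hD k)).trans (by omega)
  fin_cases i
  · exact totalDegree_sub_le_of (h4 _) (h1 _ _ _)
  · exact totalDegree_sub_le_of (h4 _) (totalDegree_add_le_of (h1 _ _ _) (h2 _ _ _))
  · exact totalDegree_sub_le_of (h4 _) (totalDegree_add_le_of (h1 _ _ _) (h2 _ _ _))
  · exact totalDegree_sub_le_of (h4 _) (h1 _ _ _)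

end

/-- Two lines meet at a parameter `t ≠ 0` and do not agree in a coordinate. -/
def Cross (ℓ ℓ' : Line) : Prop :=
  (ℓ.1.1 - ℓ'.1.1) * (ℓ.1.2 - ℓ'.1.2) = (ℓ.2.1 - ℓ'.2.1) * (ℓ.2.2 - ℓ'.2.2) ∧
    (ℓ.1.1 - ℓ'.1.1) * (ℓ.1.2 - ℓ'.1.2) ≠ 0

noncomputable def meetT (ℓ ℓ' : Line) : ℝ := (ℓ.2.1 - ℓ'.2.1) / (ℓ.1.1 - ℓ'.1.1)

lemma Cross.symm {ℓ ℓ' : Line} (h : Cross ℓ ℓ') : Cross ℓ' ℓ := by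
  obtain ⟨h1, h2⟩ := h
  refine ⟨by linear_combination h1, fun h => h2 (by linear_combination h)⟩

lemma meetT_comm (ℓ ℓ' : Line) : meetT ℓ ℓ' = meetT ℓ' ℓ := by
  rw [meetT, meetT, ← neg_sub, ← neg_sub ℓ'.1.1, neg_div_neg_eq]

lemma Cross.ne {ℓ ℓ' : Line} (h : Cross ℓ ℓ') :
    ℓ.1.1 - ℓ'.1.1 ≠ 0 ∧ ℓ.1.2 - ℓ'.1.2 ≠ 0 ∧ ℓ.2.1 - ℓ'.2.1 ≠ 0 ∧ ℓ.2.2 - ℓ'.2.2 ≠ 0 := by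
  obtain ⟨h1, h2⟩ := h
  have h3 := h1 ▸ h2
  exact ⟨left_ne_zero_of_mul h2, right_ne_zero_of_mul h2, left_ne_zero_of_mul h3,
    right_ne_zero_of_mul h3⟩

lemma not_cross_self (ℓ : Line) : ¬ Cross ℓ ℓ := fun h => h.2 (by simp)

lemma Cross.meetT_ne_zero {ℓ ℓ' : Line} (h : Cross ℓ ℓ') : meetT ℓ ℓ' ≠ 0 :=
  div_ne_zero h.ne.2.2.1 h.ne.1

lemma Cross.pt_eq {ℓ ℓ' : Line} (h : Cross ℓ ℓ') : pt ℓ (meetT ℓ ℓ') = pt ℓ' (meetT ℓ ℓ') := by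
  obtain ⟨hu, hv, ha, hb⟩ := h.ne
  have h1 : meetT ℓ ℓ' * (ℓ.1.1 - ℓ'.1.1) = ℓ.2.1 - ℓ'.2.1 := div_mul_cancel₀ _ hu
  have h2 : meetT ℓ ℓ' * (ℓ.2.2 - ℓ'.2.2) = ℓ.1.2 - ℓ'.1.2 := by
    rw [meetT, div_mul_eq_mul_div, div_eq_iff hu, ← h.1, mul_comm]
  ext i
  fin_cases i
  · simp [pt]
  · simp only [pt]; simp; linear_combination -h1
  · simp only [pt]; simp; linear_combination h2

lemma pt_eq_iff {ℓ ℓ' : Line} {t t' : ℝ} : pt ℓ t = pt ℓ' t' ↔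
    t = t' ∧ ℓ.2.1 - ℓ'.2.1 = t * (ℓ.1.1 - ℓ'.1.1) ∧ ℓ.1.2 - ℓ'.1.2 = t * (ℓ.2.2 - ℓ'.2.2) := by
  constructor
  · intro h
    have h0 := congrFun h 0
    have h1 := congrFun h 1
    have h2 := congrFun h 2
    simp [pt] at h0 h1 h2
    subst h0
    exact ⟨rfl, by linear_combination h1, by linear_combination -h2⟩
  · rintro ⟨rfl, h1, h2⟩
    ext i
    fin_cases i
    · simp [pt]
    · simp only [pt]; simp; linear_combination h1
    · simp only [pt]; simp; linear_combination -h2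

/-- Two lines through a common point cross unless they agree in a coordinate. -/
lemma cross_of_pt_eq {ℓ ℓ' : Line} {t t' : ℝ} (h : pt ℓ t = pt ℓ' t')
    (hu : ℓ.1.1 ≠ ℓ'.1.1) (hv : ℓ.1.2 ≠ ℓ'.1.2) : Cross ℓ ℓ' ∧ meetT ℓ ℓ' = t := by
  obtain ⟨-, h1, h2⟩ := pt_eq_iff.1 h
  refine ⟨⟨by rw [h1, h2]; ring, mul_ne_zero (sub_ne_zero.2 hu) (sub_ne_zero.2 hv)⟩, ?_⟩
  rw [meetT, h1, mul_div_cancel_right₀ _ (sub_ne_zero.2 hu)]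

lemma Cross.eq_meetT {ℓ ℓ' : Line} (h : Cross ℓ ℓ') {t t' : ℝ} (he : pt ℓ t = pt ℓ' t') :
    t = meetT ℓ ℓ' := by
  obtain ⟨-, h1, h2⟩ := pt_eq_iff.1 he
  rw [meetT, h1, mul_div_cancel_right₀ _ h.ne.1]

lemma notMem_vars_of_pderiv_eq_zero {f : Poly3} {i : Fin 3} (h : pderiv i f = 0) :
    i ∉ f.vars := by
  intro hi
  rw [mem_vars_iff_mem_support] at hi
  obtain ⟨m, hm, hmi⟩ := hi
  exact exists_pderiv_coeff (mem_support_iff.1 hm) i (by simpa using hmi) (by rw [h]; simp)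

lemma res_congr {f : Poly3} {ℓ ℓ' : Line}
    (h : ∀ i ∈ f.vars, res ℓ (X i) = res ℓ' (X i)) : res ℓ f = res ℓ' f := by
  have := hom_congr_vars (f₁ := (res ℓ : Poly3 →+* Polynomial ℝ))
    (f₂ := (res ℓ' : Poly3 →+* Polynomial ℝ)) (p₁ := f) (p₂ := f) (by ext; simp)
    (fun i hi _ => h i hi) rfl
  exact this

lemma not_cross_of_pderiv_two {f : Poly3} (hf : Irreducible f) (h2 : pderiv 2 f = 0)
    {ℓ ℓ' : Line} (h : res ℓ f = 0) (h' : res ℓ' f = 0) : ¬ Cross ℓ ℓ' := by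
  intro hc
  have hv := notMem_vars_of_pderiv_eq_zero h2
  obtain ⟨⟨u, v⟩, ⟨a, b⟩⟩ := ℓ
  have key : ∀ v₁, res ((u, v₁), (a, b)) f = 0 := by
    intro v₁
    rw [← h]
    refine res_congr fun i hi => ?_
    fin_cases i
    · simp
    · simp
    · exact absurd hi hv
  set w : Poly3 := X 1 + C u * X 0 - C a with hw
  by_cases hd : f ∣ w
  · obtain ⟨c, hc'⟩ := hd
    have h1 : res ℓ' w = 0 := by rw [hc', map_mul, h', zero_mul]
    have h2 := congrArg (Polynomial.eval 0) h1
    have h3 := congrArg (Polynomial.eval 1) h1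
    simp [hw] at h2 h3
    have := hc.ne.2.2.1
    simp at this
    apply this; linear_combination -h2
  · have := card_lines_le hf hd ((Finset.range (6 * f.totalDegree * w.totalDegree + 1)).image
      (fun n : ℕ => (((u, (n : ℝ)), (a, b)) : Line))) (by
        intro ℓ hℓ
        obtain ⟨n, -, rfl⟩ := Finset.mem_image.1 hℓ
        exact key n) (by
        intro ℓ hℓ
        obtain ⟨n, -, rfl⟩ := Finset.mem_image.1 hℓ
        simp [hw])
    rw [Finset.card_image_of_injective _ (by intro m n; simp), Finset.card_range] at this
    omega

lemma not_cross_of_pderiv_one {f : Poly3} (hf : Irreducible f) (h2 : pderiv 1 f = 0)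
    {ℓ ℓ' : Line} (h : res ℓ f = 0) (h' : res ℓ' f = 0) : ¬ Cross ℓ ℓ' := by
  intro hc
  have hv := notMem_vars_of_pderiv_eq_zero h2
  obtain ⟨⟨u, v⟩, ⟨a, b⟩⟩ := ℓ
  have key : ∀ u₁, res ((u₁, v), (a, b)) f = 0 := by
    intro v₁
    rw [← h]
    refine res_congr fun i hi => ?_
    fin_cases i
    · simp
    · exact absurd hi hv
    · simp
  set w : Poly3 := X 2 - C b * X 0 + C v with hw
  by_cases hd : f ∣ w
  · obtain ⟨c, hc'⟩ := hd
    have h1 : res ℓ' w = 0 := by rw [hc', map_mul, h', zero_mul]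
    have h2 := congrArg (Polynomial.eval 0) h1
    simp [hw] at h2
    have := hc.ne.2.1
    simp at this
    apply this; linear_combination h2
  · have := card_lines_le hf hd ((Finset.range (6 * f.totalDegree * w.totalDegree + 1)).image
      (fun n : ℕ => ((((n : ℝ), v), (a, b)) : Line))) (by
        intro ℓ hℓ
        obtain ⟨n, -, rfl⟩ := Finset.mem_image.1 hℓ
        exact key n) (by
        intro ℓ hℓ
        obtain ⟨n, -, rfl⟩ := Finset.mem_image.1 hℓ
        simp [hw])
    rw [Finset.card_image_of_injective _ (by intro m n; simp), Finset.card_range] at this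
    omega

lemma dvd_derivation_comp {f : Poly3} (D₁ D₂ : Derivation ℝ Poly3 Poly3) (h₁ : f ∣ D₁ f)
    (h₂ : f ∣ D₂ f) : f ∣ D₁ (D₂ f) := by
  obtain ⟨c, hc⟩ := h₂
  rw [hc, Derivation.leibniz]
  exact dvd_add (by simp) (by simpa using h₁.mul_left c)

/-- The field of directions of the lines attached to `p`. -/
noncomputable def field (p : ℝ × ℝ) : Derivation ℝ Poly3 Poly3 :=
  (X 0 : Poly3) • pderiv 0 - (C p.1 * X 0 : Poly3) • pderiv 1 + (X 2 + C p.2 : Poly3) • pderiv 2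

lemma res_field {f : Poly3} {ℓ : Line} (h : res ℓ f = 0) : res ℓ (field ℓ.1 f) = 0 := by
  have h1 := derivative_res ℓ f
  rw [h, Polynomial.derivative_zero] at h1
  simp [field]
  linear_combination (-Polynomial.X) * h1

lemma totalDegree_field_le (f : Poly3) (h : f.totalDegree ≤ 2) (p : ℝ × ℝ) :
    (field p f).totalDegree ≤ 2 := by
  have h1 : ∀ i, (pderiv i f).totalDegree ≤ 1 := by
    intro i
    by_cases h0 : pderiv i f = 0
    · simp [h0]
    · have := totalDegree_pderiv_lt h0; omega
  have hX : ∀ i, (X i : Poly3).totalDegree ≤ 1 := fun i => by simp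
  simp only [field, Derivation.add_apply, Derivation.sub_apply, Derivation.smul_apply, smul_eq_mul]
  refine totalDegree_add_le_of (totalDegree_sub_le_of (totalDegree_mul_le_of (hX 0) (h1 0))
    (totalDegree_mul_le_of ?_ (h1 1))) (totalDegree_mul_le_of (totalDegree_add_le_of (hX 2) ?_)
    (h1 2))
  · exact totalDegree_mul_le_of (a := 0) (by simp) (hX 0)
  · simp

lemma eq_of_dvd_field {f : Poly3} (hf : Irreducible f) {p p' : ℝ × ℝ} (h : f ∣ field p f)
    (h' : f ∣ field p' f) {ℓ ℓ' : Line} (hℓ : res ℓ f = 0) (hℓ' : res ℓ' f = 0)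
    (hc : Cross ℓ ℓ') : p = p' := by
  set W : Derivation ℝ Poly3 Poly3 := field p - field p' with hW
  have hWd : f ∣ W f := by rw [hW, Derivation.sub_apply]; exact dvd_sub h h'
  have h3 := dvd_sub (dvd_derivation_comp _ W h hWd) (dvd_derivation_comp W _ hWd h)
  have e1 : W f = C (-(p.1 - p'.1)) * X 0 * pderiv 1 f + C (p.2 - p'.2) * pderiv 2 f := by
    simp [hW, field]; ring
  have e2 : field p (W f) - W (field p f) =
      C (-(p.1 - p'.1)) * X 0 * pderiv 1 f - C (p.2 - p'.2) * pderiv 2 f := by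
    simp [hW, field, pderiv_X, pderiv_comm 1 0 f, pderiv_comm 2 0 f,
      pderiv_comm 2 1 f]
    ring
  rw [e2] at h3
  rw [e1] at hWd
  have hlt : ∀ i, pderiv i f ≠ 0 → ¬ f ∣ pderiv i f := fun i hi hd => by
    have := totalDegree_le_of_dvd_of_isDomain hd hi
    have := totalDegree_pderiv_lt hi
    omega
  have n1 : pderiv 1 f ≠ 0 := fun h0 => not_cross_of_pderiv_one hf h0 hℓ hℓ' hc
  have n2 : pderiv 2 f ≠ 0 := fun h0 => not_cross_of_pderiv_two hf h0 hℓ hℓ' hc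
  have hprime := hf.prime
  have hC : ∀ r : ℝ, f ∣ C r → r = 0 := by
    rintro r ⟨c, hc⟩
    by_contra hr
    have := congrArg (res ℓ) hc
    rw [map_mul, hℓ, zero_mul] at this
    simp at this
    exact hr this
  have hX : ¬ f ∣ X 0 := by
    rintro ⟨c, hc⟩
    have := congrArg (res ℓ) hc
    rw [map_mul, hℓ, zero_mul] at this
    simp at this
  have h4 : f ∣ C (2 * (p.2 - p'.2)) * pderiv 2 f := by
    have := dvd_sub hWd h3
    convert this using 1
    simp [show (C 2 : Poly3) = 2 from map_ofNat C 2]; ring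
  have h5 : f ∣ C (2 * (-(p.1 - p'.1))) * (X 0 * pderiv 1 f) := by
    have := dvd_add hWd h3
    convert this using 1
    simp [show (C 2 : Poly3) = 2 from map_ofNat C 2]; ring
  have h6 : 2 * (p.2 - p'.2) = 0 := hC _ ((hprime.dvd_or_dvd h4).resolve_right (hlt 2 n2))
  have h7 : 2 * (-(p.1 - p'.1)) = 0 := hC _ ((hprime.dvd_or_dvd h5).resolve_right fun h =>
    (hprime.dvd_or_dvd h).elim hX (hlt 1 n1))
  exact Prod.ext (by linarith) (by linarith)

/-- A quadric contains few of the lines attached to pairs of points of `P`. -/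
lemma card_le_of_totalDegree_le_two {f : Poly3} (hf : Irreducible f) (hd : f.totalDegree ≤ 2)
    (P : Finset (ℝ × ℝ)) (F : Finset Line) (hFP : F ⊆ P ×ˢ P) (hF : ∀ ℓ ∈ F, res ℓ f = 0)
    {ℓ₀ ℓ₁ : Line} (h0 : ℓ₀ ∈ F) (h1 : ℓ₁ ∈ F) (hc : Cross ℓ₀ ℓ₁) : F.card ≤ 25 * P.card := by
  classical
  have hmaps : ∀ ℓ ∈ F, ℓ.1 ∈ P := fun ℓ hℓ => (Finset.mem_product.1 (hFP hℓ)).1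
  have hfib : ∀ p ∈ P, ¬ f ∣ field p f → (F.filter (fun ℓ => ℓ.1 = p)).card ≤ 24 := by
    intro p hp hnd
    have := card_lines_le hf hnd (F.filter (fun ℓ => ℓ.1 = p))
      (fun ℓ hℓ => hF ℓ (Finset.mem_filter.1 hℓ).1) (fun ℓ hℓ => by
        rw [← (Finset.mem_filter.1 hℓ).2]
        exact res_field (hF ℓ (Finset.mem_filter.1 hℓ).1))
    have h2 := totalDegree_field_le f hd p
    calc _ ≤ _ := this
      _ ≤ 6 * 2 * 2 := by gcongr
  have hfibN : ∀ p ∈ P, (F.filter (fun ℓ => ℓ.1 = p)).card ≤ P.card := by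
    intro p hp
    refine Finset.card_le_card_of_injOn (fun ℓ => ℓ.2)
      (fun ℓ hℓ => (Finset.mem_product.1 (hFP (Finset.mem_filter.1 hℓ).1)).2) ?_
    intro ℓ hℓ ℓ' hℓ' h
    exact Prod.ext ((Finset.mem_filter.1 hℓ).2.trans (Finset.mem_filter.1 hℓ').2.symm) h
  rw [Finset.card_eq_sum_card_fiberwise hmaps]
  have hsplit : ∀ p ∈ P, (F.filter (fun ℓ => ℓ.1 = p)).card ≤
      24 + if f ∣ field p f then P.card else 0 := by
    intro p hp
    split_ifs with h
    · exact (hfibN p hp).trans (by omega)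
    · exact hfib p hp h
  refine (Finset.sum_le_sum hsplit).trans ?_
  rw [Finset.sum_add_distrib, ← Finset.sum_filter, Finset.sum_const, Finset.sum_const]
  have : (P.filter (fun p => f ∣ field p f)).card ≤ 1 := by
    rw [Finset.card_le_one]
    intro p hp p' hp'
    exact eq_of_dvd_field hf (Finset.mem_filter.1 hp).2 (Finset.mem_filter.1 hp').2 (hF _ h0)
      (hF _ h1) hc
  simp only [smul_eq_mul]
  nlinarith

lemma structure_of_vanishing {f g : Poly3} (hf : Irreducible f) (hfg : ¬ f ∣ g)
    (hg : g.totalDegree ≤ 11 * f.totalDegree) (F : Finset Line) (hF : ∀ ℓ ∈ F, res ℓ f = 0)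
    (hvan : ∀ ℓ ∈ F, ∀ ℓ' ∈ F, Cross ℓ ℓ' → eval (pt ℓ (meetT ℓ ℓ')) g = 0) :
    ∃ E ⊆ F, E.card ≤ 66 * f.totalDegree ^ 2 ∧ ∀ ℓ ∈ F, ℓ ∉ E → ∃ T : Finset ℝ,
      T.card ≤ 11 * f.totalDegree ∧ ∀ ℓ' ∈ F, Cross ℓ ℓ' → meetT ℓ ℓ' ∈ T := by
  classical
  refine ⟨F.filter (fun ℓ => res ℓ g = 0), Finset.filter_subset _ _, ?_, ?_⟩
  · refine (card_lines_le hf hfg _ (fun ℓ hℓ => hF ℓ (Finset.mem_filter.1 hℓ).1)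
      (fun ℓ hℓ => (Finset.mem_filter.1 hℓ).2)).trans ?_
    calc 6 * f.totalDegree * g.totalDegree ≤ 6 * f.totalDegree * (11 * f.totalDegree) := by gcongr
      _ = _ := by ring
  · intro ℓ hℓ hE
    have h0 : res ℓ g ≠ 0 := fun h => hE (Finset.mem_filter.2 ⟨hℓ, h⟩)
    refine ⟨(res ℓ g).roots.toFinset, ?_, ?_⟩
    · exact (Multiset.toFinset_card_le _).trans ((Polynomial.card_roots' _).trans
        ((natDegree_res_le ℓ g).trans hg))
    · intro ℓ' hℓ' hc
      rw [Multiset.mem_toFinset, Polynomial.mem_roots h0, Polynomial.IsRoot, eval_res]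
      exact hvan ℓ hℓ ℓ' hℓ' hc

lemma card_le_or_exists_eval_ne {f g : Poly3} (hf : Irreducible f) (hfg : ¬ f ∣ g)
    (F : Finset Line) (hF : ∀ ℓ ∈ F, res ℓ f = 0) :
    F.card ≤ 6 * f.totalDegree * g.totalDegree ∨ ∃ z, eval z f = 0 ∧ eval z g ≠ 0 := by
  by_cases h : ∀ ℓ ∈ F, res ℓ g = 0
  · exact Or.inl (card_lines_le hf hfg F hF h)
  · push Not at h
    obtain ⟨ℓ, hℓ, hne⟩ := h
    right
    by_contra! hcon
    refine hne (Polynomial.funext fun t => ?_)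
    rw [eval_res, Polynomial.eval_zero]
    refine hcon _ ?_
    rw [← eval_res, hF ℓ hℓ, Polynomial.eval_zero]

/-- Lines on an irreducible surface: either no two of them cross, or there are few of them, or
outside a small exceptional set every line carries few crossing points. -/
theorem surface_structure {f : Poly3} (hf : Irreducible f) (P : Finset (ℝ × ℝ)) (F : Finset Line)
    (hFP : F ⊆ P ×ˢ P) (hF : ∀ ℓ ∈ F, res ℓ f = 0) :
    (∀ ℓ ∈ F, ∀ ℓ' ∈ F, ¬ Cross ℓ ℓ') ∨ F.card ≤ 25 * P.card ∨
    ∃ E ⊆ F, E.card ≤ 66 * f.totalDegree ^ 2 ∧ ∀ ℓ ∈ F, ℓ ∉ E → ∃ T : Finset ℝ,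
      T.card ≤ 11 * f.totalDegree ∧ ∀ ℓ' ∈ F, Cross ℓ ℓ' → meetT ℓ ℓ' ∈ T := by
  by_cases hno : ∀ ℓ ∈ F, ∀ ℓ' ∈ F, ¬ Cross ℓ ℓ'
  · exact Or.inl hno
  right
  push Not at hno
  obtain ⟨ℓ₀, h0, ℓ₁, h1, hc⟩ := hno
  by_cases hd : f.totalDegree ≤ 2
  · exact Or.inl (card_le_of_totalDegree_le_two hf hd P F hFP hF h0 h1 hc)
  right
  have hsmall : F.card ≤ 66 * f.totalDegree ^ 2 → ∃ E ⊆ F, E.card ≤ 66 * f.totalDegree ^ 2 ∧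
      ∀ ℓ ∈ F, ℓ ∉ E → ∃ T : Finset ℝ,
      T.card ≤ 11 * f.totalDegree ∧ ∀ ℓ' ∈ F, Cross ℓ ℓ' → meetT ℓ ℓ' ∈ T :=
    fun h => ⟨F, subset_rfl, h, fun ℓ h h' => absurd h h'⟩
  have hevals := fun {ℓ ℓ' : Line} (hℓ : ℓ ∈ F) (hℓ' : ℓ' ∈ F) (hc : Cross ℓ ℓ') =>
    eval_obstr_of_meet (hF ℓ hℓ) (hF ℓ' hℓ') hc.pt_eq (sub_ne_zero.1 hc.ne.1)
  by_cases hob : ∀ i, f ∣ obstr f i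
  swap
  · push Not at hob
    obtain ⟨i, hi⟩ := hob
    exact structure_of_vanishing hf hi (totalDegree_obstr_le f i) F hF
      (fun ℓ hℓ ℓ' hℓ' hc => (hevals hℓ hℓ' hc).1 i)
  have n2 : pderiv 2 f ≠ 0 := fun h =>
    not_cross_of_pderiv_two hf h (hF _ h0) (hF _ h1) hc
  have nd2 : ¬ f ∣ pderiv 2 f := fun h => by
    have := totalDegree_le_of_dvd_of_isDomain h n2
    have := totalDegree_pderiv_lt n2
    omega
  have hdeg2 := totalDegree_pderiv_le 2 f
  by_cases hh : f ∣ hess f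
  · have hh0 : ∀ ℓ ∈ F, ∀ t, eval (pt ℓ t) (hess f) = 0 := by
      intro ℓ hℓ t
      obtain ⟨c, hc⟩ := hh
      rw [hc, map_mul, ← eval_res, hF ℓ hℓ, Polynomial.eval_zero, zero_mul]
    have hnum : ∀ i j, ¬ f ∣ num₂ f i j → (num₂ f i j).totalDegree ≤ 11 * f.totalDegree :=
      fun i j _ => (totalDegree_num₂_le f i j).trans (by omega)
    by_cases h00 : f ∣ num₂ f 0 0
    swap
    · exact structure_of_vanishing hf h00 (hnum _ _ h00) F hF
        (fun ℓ hℓ ℓ' hℓ' hc => ((hevals hℓ hℓ' hc).2 (hh0 ℓ hℓ _)).1)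
    by_cases h01 : f ∣ num₂ f 0 1
    swap
    · exact structure_of_vanishing hf h01 (hnum _ _ h01) F hF
        (fun ℓ hℓ ℓ' hℓ' hc => ((hevals hℓ hℓ' hc).2 (hh0 ℓ hℓ _)).2.1)
    by_cases h11 : f ∣ num₂ f 1 1
    swap
    · exact structure_of_vanishing hf h11 (hnum _ _ h11) F hF
        (fun ℓ hℓ ℓ' hℓ' hc => ((hevals hℓ hℓ' hc).2 (hh0 ℓ hℓ _)).2.2)
    rcases card_le_or_exists_eval_ne hf nd2 F hF with h | ⟨z, hz, hz2⟩
    · refine hsmall (h.trans ?_)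
      nlinarith
    · exact absurd (totalDegree_le_two_of_flat hf hz hz2 h00 h01 h11) hd
  · have hnd : ¬ f ∣ pderiv 2 f * hess f := fun h => (hf.prime.dvd_or_dvd h).elim nd2 hh
    have hdeg := totalDegree_mul_le_of hdeg2 (totalDegree_hess_le f)
    rcases card_le_or_exists_eval_ne hf hnd F hF with h | ⟨z, hz, hz2⟩
    · refine hsmall (h.trans ?_)
      nlinarith
    · exact absurd (totalDegree_le_two_of_obstr hf hz hz2 hob) hd

lemma exists_irreducible_list {f : Poly3} (hf : f ≠ 0) : ∃ l : List Poly3,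
    (∀ g ∈ l, Irreducible g) ∧ listDeg l = f.totalDegree ∧
    (∀ z, eval z f = 0 → ∃ g ∈ l, eval z g = 0) ∧
    (∀ ℓ, res ℓ f = 0 → ∃ g ∈ l, res ℓ g = 0) := by
  induction f using WfDvdMonoid.induction_on_irreducible with
  | zero => exact absurd rfl hf
  | unit u hu =>
    obtain ⟨r, hr, rfl⟩ := MvPolynomial.isUnit_iff_eq_C_of_isReduced.1 hu
    refine ⟨[], by simp, by simp [listDeg], ?_, ?_⟩
    · intro z hz; simp [hr.ne_zero] at hz
    · intro ℓ hz; simp [hr.ne_zero] at hz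
  | mul a i ha hi ih =>
    obtain ⟨l, h1, h2, h3, h4⟩ := ih ha
    refine ⟨i :: l, ?_, ?_, ?_, ?_⟩
    · simpa [hi] using h1
    · rw [totalDegree_mul_of_isDomain hi.ne_zero ha, ← h2]; simp [listDeg]
    · intro z hz
      rw [map_mul, mul_eq_zero] at hz
      rcases hz with hz | hz
      · exact ⟨i, by simp, hz⟩
      · obtain ⟨g, hg, hg'⟩ := h3 z hz
        exact ⟨g, by simp [hg], hg'⟩
    · intro z hz
      rw [map_mul, mul_eq_zero] at hz
      rcases hz with hz | hz
      · exact ⟨i, by simp, hz⟩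
      · obtain ⟨g, hg, hg'⟩ := h4 z hz
        exact ⟨g, by simp [hg], hg'⟩

section

variable {n : ℕ} (g : Fin n → Poly3)

open scoped Classical in
/-- Parameters at which `ℓ` properly meets one of the surfaces `g j = 0`. -/
noncomputable def inc (ℓ : Line) : Finset ℝ :=
  Finset.univ.biUnion fun j => (res ℓ (g j)).roots.toFinset

lemma card_inc_le (ℓ : Line) : (inc g ℓ).card ≤ ∑ j, (g j).totalDegree := by
  classical
  refine Finset.card_biUnion_le.trans (Finset.sum_le_sum fun j _ => ?_)
  exact (Multiset.toFinset_card_le _).trans ((Polynomial.card_roots' _).trans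
        (natDegree_res_le ℓ (g j)))

lemma mem_inc {ℓ : Line} {t : ℝ} (j : Fin n) (h : res ℓ (g j) ≠ 0) (h0 : eval (pt ℓ t) (g j) = 0) :
    t ∈ inc g ℓ := by
  classical
  rw [inc, Finset.mem_biUnion]
  refine ⟨j, Finset.mem_univ _, ?_⟩
  rw [Multiset.mem_toFinset, Polynomial.mem_roots h, Polynomial.IsRoot, eval_res]
  exact h0

open scoped Classical in
/-- The lines of `𝓛` for which `g i = 0` is the first of the given surfaces containing them. -/
noncomputable def grp (𝓛 : Finset Line) (i : Fin n) : Finset Line :=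
  𝓛.filter fun ℓ => res ℓ (g i) = 0 ∧ ∀ j < i, res ℓ (g j) ≠ 0

variable {g} {𝓛 : Finset Line}

lemma mem_grp {i : Fin n} {ℓ : Line} :
    ℓ ∈ grp g 𝓛 i ↔ ℓ ∈ 𝓛 ∧ res ℓ (g i) = 0 ∧ ∀ j < i, res ℓ (g j) ≠ 0 := by
  classical
  simp [grp]

lemma grp_subset (i : Fin n) : grp g 𝓛 i ⊆ 𝓛 := fun _ h => (mem_grp.1 h).1

lemma exists_mem_grp {ℓ : Line} (hℓ : ℓ ∈ 𝓛) (h : ∃ j, res ℓ (g j) = 0) :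
    ∃ i, ℓ ∈ grp g 𝓛 i := by
  classical
  obtain ⟨i, hi, hmin⟩ := WellFounded.has_min (wellFounded_lt (α := Fin n)) {j | res ℓ (g j) = 0} h
  exact ⟨i, mem_grp.2 ⟨hℓ, hi, fun j hj hj' => hmin j hj' hj⟩⟩

lemma sum_card_grp_le : ∑ i, (grp g 𝓛 i).card ≤ 𝓛.card := by
  classical
  rw [← Finset.card_biUnion]
  · exact Finset.card_le_card (Finset.biUnion_subset.2 fun i _ => grp_subset i)
  · intro i _ j _ hij
    rw [Function.onFun, Finset.disjoint_left]
    intro ℓ hi hj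
    rcases lt_or_gt_of_ne hij with h | h
    · exact (mem_grp.1 hj).2.2 i h (mem_grp.1 hi).2.1
    · exact (mem_grp.1 hi).2.2 j h (mem_grp.1 hj).2.1

lemma mem_inc_of_grp {i j : Fin n} {ℓ : Line} {t : ℝ} (hℓ : ℓ ∈ grp g 𝓛 i) (hj : j < i)
    (h : eval (pt ℓ t) (g j) = 0) : t ∈ inc g ℓ :=
  mem_inc g j ((mem_grp.1 hℓ).2.2 j hj) h

end

open scoped Classical in
/-- The points at which two lines of `𝓛` cross. -/
noncomputable def crossPts (𝓛 : Finset Line) : Finset (Fin 3 → ℝ) :=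
  ((𝓛 ×ˢ 𝓛).filter fun p => Cross p.1 p.2).image fun p => pt p.1 (meetT p.1 p.2)

lemma mem_crossPts {𝓛 : Finset Line} {z : Fin 3 → ℝ} :
    z ∈ crossPts 𝓛 ↔ ∃ ℓ ∈ 𝓛, ∃ ℓ' ∈ 𝓛, Cross ℓ ℓ' ∧ pt ℓ (meetT ℓ ℓ') = z := by
  classical
  simp only [crossPts, Finset.mem_image, Finset.mem_filter, Finset.mem_product]
  constructor
  · rintro ⟨p, ⟨⟨ha, hb⟩, hc⟩, h⟩
    exact ⟨p.1, ha, p.2, hb, hc, h⟩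
  · rintro ⟨a, ha, b, hb, hc, h⟩
    exact ⟨(a, b), ⟨⟨ha, hb⟩, hc⟩, h⟩

lemma card_crossPts_le_sq (𝓛 : Finset Line) : (crossPts 𝓛).card ≤ 𝓛.card * 𝓛.card := by
  classical
  rw [← Finset.card_product]
  exact Finset.card_image_le.trans (Finset.card_le_card (Finset.filter_subset _ _))

lemma card_biUnion_pt_le {𝓛 : Finset Line} (T : Line → Finset ℝ) (d : ℕ)
    (hT : ∀ ℓ ∈ 𝓛, (T ℓ).card ≤ d) : ∀ [DecidableEq (Fin 3 → ℝ)],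
    (𝓛.biUnion fun ℓ => (T ℓ).image (pt ℓ)).card ≤ 𝓛.card * d := by
  intro _
  refine Finset.card_biUnion_le_card_mul _ _ _ fun ℓ hℓ => ?_
  exact Finset.card_image_le.trans (hT ℓ hℓ)

lemma card_crossPts_le_of_structure {𝓛 E : Finset Line} {d : ℕ}
    (h : ∀ ℓ ∈ 𝓛, ℓ ∉ E → ∃ T : Finset ℝ,
      T.card ≤ d ∧ ∀ ℓ' ∈ 𝓛, Cross ℓ ℓ' → meetT ℓ ℓ' ∈ T) :
    (crossPts 𝓛).card ≤ 𝓛.card * d + (crossPts E).card := by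
  classical
  choose! T hT hmem using h
  have hsub : crossPts 𝓛 ⊆ ((𝓛 \ E).biUnion fun ℓ => (T ℓ).image (pt ℓ)) ∪ crossPts E := by
    intro z hz
    obtain ⟨ℓ, hℓ, ℓ', hℓ', hc, rfl⟩ := mem_crossPts.1 hz
    rw [Finset.mem_union]
    by_cases h1 : ℓ ∈ E
    · by_cases h2 : ℓ' ∈ E
      · exact Or.inr (mem_crossPts.2 ⟨ℓ, h1, ℓ', h2, hc, rfl⟩)
      · left
        rw [hc.pt_eq, meetT_comm]
        exact Finset.mem_biUnion.2 ⟨ℓ', Finset.mem_sdiff.2 ⟨hℓ', h2⟩,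
          Finset.mem_image_of_mem _ (hmem _ hℓ' h2 _ hℓ hc.symm)⟩
    · left
      exact Finset.mem_biUnion.2 ⟨ℓ, Finset.mem_sdiff.2 ⟨hℓ, h1⟩,
          Finset.mem_image_of_mem _ (hmem _ hℓ h1 _ hℓ' hc)⟩
  refine (Finset.card_le_card hsub).trans ((Finset.card_union_le _ _).trans ?_)
  refine add_le_add_left ?_ _
  refine (card_biUnion_pt_le T d fun ℓ hℓ => ?_).trans
    (Nat.mul_le_mul_right _ (Finset.card_le_card Finset.sdiff_subset))
  exact hT ℓ (Finset.mem_sdiff.1 hℓ).1 (Finset.mem_sdiff.1 hℓ).2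

lemma crossPts_subset_of_grp {n : ℕ} {g : Fin n → Poly3} {𝓛 : Finset Line}
    (h : ∀ ℓ ∈ 𝓛, ∃ j, res ℓ (g j) = 0) [DecidableEq (Fin 3 → ℝ)] :
    crossPts 𝓛 ⊆ (𝓛.biUnion fun ℓ => (inc g ℓ).image (pt ℓ)) ∪
      Finset.univ.biUnion fun i => crossPts (grp g 𝓛 i) := by
  intro z hz
  obtain ⟨ℓ, hℓ, ℓ', hℓ', hc, rfl⟩ := mem_crossPts.1 hz
  obtain ⟨i, hi⟩ := exists_mem_grp hℓ (h ℓ hℓ)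
  obtain ⟨j, hj⟩ := exists_mem_grp hℓ' (h ℓ' hℓ')
  have e1 : ∀ t, eval (pt ℓ t) (g i) = 0 := fun t => by
    rw [← eval_res, (mem_grp.1 hi).2.1, Polynomial.eval_zero]
  have e2 : ∀ t, eval (pt ℓ' t) (g j) = 0 := fun t => by
    rw [← eval_res, (mem_grp.1 hj).2.1, Polynomial.eval_zero]
  rw [Finset.mem_union]
  rcases lt_trichotomy i j with hij | rfl | hij
  · left
    refine Finset.mem_biUnion.2 ⟨ℓ', hℓ', Finset.mem_image.2 ⟨meetT ℓ ℓ', ?_, hc.pt_eq.symm⟩⟩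
    exact mem_inc_of_grp hj hij (by rw [← hc.pt_eq]; exact e1 _)
  · right
    exact Finset.mem_biUnion.2 ⟨i, Finset.mem_univ _, mem_crossPts.2 ⟨ℓ, hi, ℓ', hj, hc, rfl⟩⟩
  · left
    refine Finset.mem_biUnion.2 ⟨ℓ, hℓ, Finset.mem_image.2 ⟨meetT ℓ ℓ', ?_, rfl⟩⟩
    exact mem_inc_of_grp hi hij (by rw [hc.pt_eq]; exact e2 _)

lemma card_crossPts_le_erase {𝓛 : Finset Line} {ℓ : Line} [DecidableEq Line]
    [DecidablePred (Cross ℓ)] :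
    (crossPts 𝓛).card ≤ (crossPts (𝓛.erase ℓ)).card +
      ((𝓛.filter (Cross ℓ)).image (meetT ℓ)).card := by
  classical
  have hsub : crossPts 𝓛 ⊆ crossPts (𝓛.erase ℓ) ∪
      ((𝓛.filter (Cross ℓ)).image (meetT ℓ)).image (pt ℓ) := by
    intro z hz
    obtain ⟨k, hk, k', hk', hc, rfl⟩ := mem_crossPts.1 hz
    rw [Finset.mem_union]
    by_cases h1 : k = ℓ
    · subst h1
      right
      exact Finset.mem_image_of_mem _ (Finset.mem_image_of_mem _ (Finset.mem_filter.2 ⟨hk', hc⟩))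
    by_cases h2 : k' = ℓ
    · subst h2
      right
      rw [hc.pt_eq, meetT_comm]
      exact Finset.mem_image_of_mem _ (Finset.mem_image_of_mem _
        (Finset.mem_filter.2 ⟨hk, hc.symm⟩))
    · left
      exact mem_crossPts.2 ⟨k, Finset.mem_erase.2 ⟨h1, hk⟩, k', Finset.mem_erase.2 ⟨h2, hk'⟩, hc, rfl⟩
  exact (Finset.card_le_card hsub).trans ((Finset.card_union_le _ _).trans
    (add_le_add_right Finset.card_image_le _))

/-- The number of crossing points determined by lines attached to pairs of points of `P`. -/
theorem card_crossPts_le (P : Finset (ℝ × ℝ)) (𝓛 : Finset Line) (h𝓛 : 𝓛 ⊆ P ×ˢ P) :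
    (crossPts 𝓛).card ≤ 200 * P.card * 𝓛.card := by
  classical
  induction hL : 𝓛.card using Nat.strong_induction_on generalizing 𝓛 with
  | _ L ih =>
  subst hL
  set N := P.card with hN
  by_cases hex : ∃ ℓ ∈ 𝓛, ((𝓛.filter (Cross ℓ)).image (meetT ℓ)).card ≤ 200 * N
  · obtain ⟨ℓ, hℓ, hcard⟩ := hex
    have h1 := Finset.card_erase_add_one hℓ
    have h2 := ih _ (by omega) (𝓛.erase ℓ) ((Finset.erase_subset _ _).trans h𝓛) rfl
    have h3 := card_crossPts_le_erase (𝓛 := 𝓛) (ℓ := ℓ)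
    calc _ ≤ _ := h3
      _ ≤ 200 * N * (𝓛.erase ℓ).card + 200 * N := add_le_add h2 hcard
      _ = 200 * N * ((𝓛.erase ℓ).card + 1) := by ring
      _ = _ := by rw [h1]
  push Not at hex
  rcases 𝓛.eq_empty_or_nonempty with rfl | hne
  · simp [crossPts]
  have hsec : ∀ ℓ, ∃ Γ ⊆ 𝓛.filter (Cross ℓ), Set.InjOn (meetT ℓ) Γ ∧
      Γ.image (meetT ℓ) = (𝓛.filter (Cross ℓ)).image (meetT ℓ) := by
    intro ℓ
    obtain ⟨u, hu, hinj, himg⟩ := Finset.exists_subset_injOn_image_eq_of_surjOn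
      (f := meetT ℓ) (s := 𝓛.filter (Cross ℓ)) (t := (𝓛.filter (Cross ℓ)).image (meetT ℓ))
      (by rw [Finset.coe_image]; exact Set.surjOn_image _ _)
    exact ⟨u, hu, hinj, himg⟩
  choose Γ hΓ hinj himg using hsec
  have hmem : ∀ ℓ, ∀ ℓ' ∈ Γ ℓ, ℓ' ∈ 𝓛 ∧ Cross ℓ ℓ' := fun ℓ ℓ' h => Finset.mem_filter.1 (hΓ ℓ h)
  set m := 200 * N with hm
  set e := 9 * 𝓛.card / (2 * (m + 1)) with he
  obtain ⟨f, hf0, hfd, hfl⟩ := degree_reduction 𝓛 m e Γ meetT (fun ℓ _ ℓ' h => (hmem ℓ ℓ' h).1)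
    (fun ℓ _ h => not_cross_self ℓ (hmem ℓ ℓ h).2)
    (fun ℓ hℓ => by
      rw [← Finset.card_image_of_injOn (hinj ℓ), himg]; exact (hex ℓ hℓ).le)
    (fun ℓ _ => hinj ℓ) (fun ℓ _ ℓ' h => (hmem ℓ ℓ' h).2.pt_eq)
    (Nat.lt_mul_div_succ _ (by omega))
  obtain ⟨l, hirr, hdeg, -, hres⟩ := exists_irreducible_list hf0
  set g : Fin l.length → Poly3 := fun i => l[i] with hg
  have hsumd : ∑ i, (g i).totalDegree ≤ 3 * e := by
    refine le_trans (le_of_eq ?_) hfd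
    rw [← hdeg, listDeg, ← Fin.sum_univ_fun_getElem]
    rfl
  set D := 3 * e with hD
  have hcov : ∀ ℓ ∈ 𝓛, ∃ j, res ℓ (g j) = 0 := by
    intro ℓ hℓ
    obtain ⟨p, hp, hp0⟩ := hres ℓ (hfl ℓ hℓ)
    obtain ⟨i, hi, rfl⟩ := List.getElem_of_mem hp
    exact ⟨⟨i, hi⟩, hp0⟩
  have hL : 𝓛.card ≤ N * N := (Finset.card_le_card h𝓛).trans (by rw [Finset.card_product])
  have hLpos : 0 < 𝓛.card := hne.card_pos
  have hNpos : 0 < N := by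
    rcases Nat.eq_zero_or_pos N with h | h
    · rw [h] at hL; omega
    · exact h
  have hND : 400 * N * D ≤ 27 * 𝓛.card := by
    have : 2 * (m + 1) * e ≤ 9 * 𝓛.card := Nat.mul_div_le _ _
    rw [hD]
    nlinarith
  have hDN : 400 * D ≤ 27 * N := by
    have : N * (400 * D) ≤ N * (27 * N) := by nlinarith
    exact Nat.le_of_mul_le_mul_left this hNpos
  have hDL : 66 * D ^ 2 < 𝓛.card := by
    have h1 : (400 * N * D) * (400 * D) ≤ (27 * 𝓛.card) * (27 * N) := Nat.mul_le_mul hND hDN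
    have h2 : N * (66 * D ^ 2) < N * 𝓛.card := by
      have : 0 < N * 𝓛.card := Nat.mul_pos hNpos hLpos
      nlinarith
    exact Nat.lt_of_mul_lt_mul_left h2
  have hdi : ∀ i, (g i).totalDegree ≤ D := fun i =>
    (Finset.single_le_sum (fun j _ => Nat.zero_le ((g j).totalDegree)) (Finset.mem_univ i)).trans
      hsumd
  have hgrp : ∀ i, (crossPts (grp g 𝓛 i)).card ≤ 25 * N * (grp g 𝓛 i).card +
      (11 * D * (grp g 𝓛 i).card + m * (66 * D) * (g i).totalDegree) := by
    intro i
    have hirr_i : Irreducible (g i) := hirr _ (List.getElem_mem _)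
    rcases surface_structure hirr_i P (grp g 𝓛 i) ((grp_subset i).trans h𝓛)
      (fun ℓ hℓ => (mem_grp.1 hℓ).2.1) with h | h | ⟨E, hE, hEc, hT⟩
    · have : crossPts (grp g 𝓛 i) = ∅ := by
        refine Finset.eq_empty_of_forall_notMem fun z hz => ?_
        obtain ⟨ℓ, hℓ, ℓ', hℓ', hc, -⟩ := mem_crossPts.1 hz
        exact h ℓ hℓ ℓ' hℓ' hc
      simp [this]
    · refine (card_crossPts_le_sq _).trans (le_add_right ?_)
      exact Nat.mul_le_mul_right _ h
    · have h1 := card_crossPts_le_of_structure hT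
      have hEd : E.card ≤ 66 * D * (g i).totalDegree := hEc.trans (by
        have := hdi i
        rw [pow_two, mul_assoc]
        gcongr)
      have hEL : E.card < 𝓛.card := lt_of_le_of_lt (hEc.trans (by
        have := hdi i
        gcongr)) hDL
      have h2 := ih _ hEL E (hE.trans ((grp_subset i).trans h𝓛)) rfl
      refine le_add_left (h1.trans ?_)
      have h3 := hdi i
      refine add_le_add ?_ (h2.trans ?_)
      · rw [mul_comm]; gcongr
      · rw [mul_assoc m]; gcongr
  have htot := Finset.card_le_card (crossPts_subset_of_grp hcov)
  have hb1 := card_biUnion_pt_le (𝓛 := 𝓛) (inc g) D (fun ℓ _ => (card_inc_le g ℓ).trans hsumd)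
  have hb2 : (Finset.univ.biUnion fun i => crossPts (grp g 𝓛 i)).card ≤
      25 * N * 𝓛.card + (11 * D * 𝓛.card + m * (66 * D) * D) := by
    refine Finset.card_biUnion_le.trans ((Finset.sum_le_sum fun i _ => hgrp i).trans ?_)
    rw [Finset.sum_add_distrib, Finset.sum_add_distrib, ← Finset.mul_sum, ← Finset.mul_sum,
      ← Finset.mul_sum]
    have := sum_card_grp_le (g := g) (𝓛 := 𝓛)
    gcongr
  have hfin := htot.trans ((Finset.card_union_le _ _).trans (add_le_add hb1 hb2))
  refine hfin.trans ?_
  have k1 : (400 * N * D) * D ≤ 27 * 𝓛.card * D := Nat.mul_le_mul_right _ hND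
  have k2 : 𝓛.card * (400 * D) ≤ 𝓛.card * (27 * N) := Nat.mul_le_mul_left _ hDN
  rw [hm]
  nlinarith

lemma pt_zero (ℓ : Line) (t : ℝ) : pt ℓ t 0 = t := by simp [pt]

lemma eq_of_pt_eq {ℓ ℓ' : Line} {t t' : ℝ} (hne : t ≠ t') (h : pt ℓ t = pt ℓ' t)
    (h' : pt ℓ t' = pt ℓ' t') : ℓ = ℓ' := by
  obtain ⟨-, h1, h2⟩ := pt_eq_iff.1 h
  obtain ⟨-, h3, h4⟩ := pt_eq_iff.1 h'
  have hs := sub_ne_zero.2 hne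
  have e1 : ℓ.1.1 - ℓ'.1.1 = 0 := by
    have : (t - t') * (ℓ.1.1 - ℓ'.1.1) = 0 := by linear_combination h3 - h1
    exact (mul_eq_zero.1 this).resolve_left hs
  have e2 : ℓ.2.2 - ℓ'.2.2 = 0 := by
    have : (t - t') * (ℓ.2.2 - ℓ'.2.2) = 0 := by linear_combination h4 - h2
    exact (mul_eq_zero.1 this).resolve_left hs
  rw [e1, mul_zero] at h1
  rw [e2, mul_zero] at h2
  exact Prod.ext (Prod.ext (sub_eq_zero.1 e1) (sub_eq_zero.1 h2))
    (Prod.ext (sub_eq_zero.1 h1) (sub_eq_zero.1 e2))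

open scoped Classical in
/-- The lines of `𝓛` through the point `z`. -/
noncomputable def thr (𝓛 : Finset Line) (z : Fin 3 → ℝ) : Finset Line :=
  𝓛.filter fun ℓ => pt ℓ (z 0) = z

lemma mem_thr {𝓛 : Finset Line} {z : Fin 3 → ℝ} {ℓ : Line} :
    ℓ ∈ thr 𝓛 z ↔ ℓ ∈ 𝓛 ∧ pt ℓ (z 0) = z := by
  classical
  simp [thr]

open scoped Classical in
/-- No plane of the two distinguished families contains a large share of the lines through `z`. -/
def Nondom (𝓛 : Finset Line) (z : Fin 3 → ℝ) : Prop :=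
  ∀ ℓ ∈ thr 𝓛 z, 8 * ((thr 𝓛 z).filter fun ℓ' => ℓ.1.1 = ℓ'.1.1).card < (thr 𝓛 z).card ∧
    8 * ((thr 𝓛 z).filter fun ℓ' => ℓ.1.2 = ℓ'.1.2).card < (thr 𝓛 z).card

lemma off_surface {𝓛 : Finset Line} {S S' : Finset (Fin 3 → ℝ)} (hS : S' ⊆ S) {l : List Poly3}
    (hl : ∀ z ∈ S', ∀ f ∈ l, eval z f ≠ 0) {k : ℕ} (hk : ∀ z ∈ S', k ≤ (thr 𝓛 z).card) :
    S'.card * k ≤ 𝓛.card * (listDeg l + 1) + (cellPairs S l).card := by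
  classical
  let Sl : Line → Finset (Fin 3 → ℝ) := fun ℓ => S'.filter fun z => pt ℓ (z 0) = z
  let T : Line → Finset ℝ := fun ℓ => (Sl ℓ).image fun z => z 0
  have hT : ∀ ℓ, ∀ t ∈ T ℓ, pt ℓ t ∈ S' := by
    intro ℓ t ht
    obtain ⟨z, hz, rfl⟩ := Finset.mem_image.1 ht
    obtain ⟨hz, hz'⟩ := Finset.mem_filter.1 hz
    rwa [hz']
  have hTc : ∀ ℓ, (T ℓ).card = (Sl ℓ).card := by
    intro ℓ
    refine Finset.card_image_of_injOn ?_
    intro z hz z' hz' h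
    have h1 := (Finset.mem_filter.1 hz).2
    have h2 := (Finset.mem_filter.1 hz').2
    rw [← h1, ← h2]
    exact congrArg _ h
  let Q : Line → Finset (ℝ × ℝ) := fun ℓ => (T ℓ ×ˢ T ℓ).filter fun p => p.1 ≠ p.2 ∧
    SameCell l (pt ℓ p.1) (pt ℓ p.2)
  have h1 : ∀ ℓ ∈ 𝓛, (Sl ℓ).card ≤ listDeg l + 1 + (Q ℓ).card := by
    intro ℓ _
    rw [← hTc]
    exact line_cells ℓ l (T ℓ) fun t ht f hf => hl _ (hT ℓ t ht) f hf
  have h2 : ∑ ℓ ∈ 𝓛, (Q ℓ).card ≤ (cellPairs S l).card := by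
    rw [← Finset.card_sigma]
    refine Finset.card_le_card_of_injOn (fun q => (pt q.1 q.2.1, pt q.1 q.2.2)) ?_ ?_
    · rintro ⟨ℓ, p⟩ hq
      obtain ⟨-, hq⟩ := Finset.mem_sigma.1 hq
      obtain ⟨hq, -, hc⟩ := Finset.mem_filter.1 hq
      obtain ⟨hp1, hp2⟩ := Finset.mem_product.1 hq
      exact mem_cellPairs.2 ⟨⟨hS (hT _ _ hp1), hS (hT _ _ hp2)⟩, hc⟩
    · rintro ⟨ℓ, p⟩ hq ⟨ℓ', p'⟩ _ heq
      obtain ⟨-, hq⟩ := Finset.mem_sigma.1 hq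
      obtain ⟨-, hne, -⟩ := Finset.mem_filter.1 hq
      obtain ⟨e1, e2⟩ := Prod.ext_iff.1 heq
      simp only at e1 e2
      have t1 : p.1 = p'.1 := by rw [← pt_zero ℓ p.1, e1, pt_zero]
      have t2 : p.2 = p'.2 := by rw [← pt_zero ℓ p.2, e2, pt_zero]
      rw [← t1] at e1
      rw [← t2] at e2
      obtain rfl := eq_of_pt_eq hne e1 e2
      obtain rfl : p = p' := Prod.ext t1 t2
      rfl
  calc S'.card * k ≤ ∑ z ∈ S', (thr 𝓛 z).card := by
        rw [← smul_eq_mul]; exact Finset.card_nsmul_le_sum _ _ _ hk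
    _ = ∑ ℓ ∈ 𝓛, (Sl ℓ).card :=
        Finset.sum_card_bipartiteAbove_eq_sum_card_bipartiteBelow
          (fun (z : Fin 3 → ℝ) (ℓ : Line) => pt ℓ (z 0) = z)
    _ ≤ ∑ ℓ ∈ 𝓛, (listDeg l + 1 + (Q ℓ).card) := Finset.sum_le_sum h1
    _ = 𝓛.card * (listDeg l + 1) + ∑ ℓ ∈ 𝓛, (Q ℓ).card := by
        rw [Finset.sum_add_distrib, Finset.sum_const, smul_eq_mul]
    _ ≤ _ := Nat.add_le_add_left h2 _

open scoped Classical in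
lemma card_mul_le_of_mem_inc {𝓛 : Finset Line} {S : Finset (Fin 3 → ℝ)} (B : Line → Finset ℝ)
    {k b : ℕ} (hS : ∀ z ∈ S, k ≤ ((thr 𝓛 z).filter fun ℓ => z 0 ∈ B ℓ).card)
    (hB : ∀ ℓ ∈ 𝓛, (B ℓ).card ≤ b) : S.card * k ≤ 𝓛.card * b := by
  refine Finset.card_mul_le_card_mul (fun z ℓ => pt ℓ (z 0) = z ∧ z 0 ∈ B ℓ) ?_ ?_
  · intro z hz
    refine (hS z hz).trans (Finset.card_le_card ?_)
    intro ℓ hℓ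
    obtain ⟨h1, h2⟩ := Finset.mem_filter.1 hℓ
    obtain ⟨h1, h3⟩ := mem_thr.1 h1
    exact (Finset.mem_bipartiteAbove _).2 ⟨h1, h3, h2⟩
  · intro ℓ hℓ
    refine le_trans ?_ (hB ℓ hℓ)
    refine Finset.card_le_card_of_injOn (fun z => z 0) ?_ ?_
    · intro z hz
      exact ((Finset.mem_bipartiteBelow _).1 hz).2.2
    · intro z hz z' hz' h
      rw [← ((Finset.mem_bipartiteBelow _).1 hz).2.1, ← ((Finset.mem_bipartiteBelow _).1 hz').2.1]
      exact congrArg _ h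

open scoped Classical in
lemma card_mul_le_of_crossing {F : Finset Line} {S : Finset (Fin 3 → ℝ)} {c : ℕ}
    (hS : ∀ z ∈ S, c ≤ 8 * ((F ×ˢ F).filter fun p => Cross p.1 p.2 ∧
      pt p.1 (meetT p.1 p.2) = z).card) : S.card * c ≤ 8 * (F.card * F.card) := by
  rw [← Finset.card_product]
  calc S.card * c ≤ ∑ z ∈ S, 8 * ((F ×ˢ F).filter fun p => Cross p.1 p.2 ∧
      pt p.1 (meetT p.1 p.2) = z).card := by
        rw [← smul_eq_mul]; exact Finset.card_nsmul_le_sum _ _ _ hS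
    _ = 8 * (S.biUnion fun z => (F ×ˢ F).filter fun p => Cross p.1 p.2 ∧
      pt p.1 (meetT p.1 p.2) = z).card := by
        rw [← Finset.mul_sum, Finset.card_biUnion]
        intro z _ z' _ hne
        rw [Function.onFun, Finset.disjoint_left]
        intro p hp hp'
        exact hne ((Finset.mem_filter.1 hp).2.2.symm.trans (Finset.mem_filter.1 hp').2.2)
    _ ≤ _ := Nat.mul_le_mul_left _ (Finset.card_le_card
        (Finset.biUnion_subset.2 fun z _ => Finset.filter_subset _ _))

open scoped Classical in
lemma Nondom.cross_count {𝓛 : Finset Line} {z : Fin 3 → ℝ} (hnd : Nondom 𝓛 z) {G : Finset Line}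
    (hG : G ⊆ thr 𝓛 z) (hG2 : (thr 𝓛 z).card < 2 * G.card) {ℓ : Line} (hℓ : ℓ ∈ G) :
    (thr 𝓛 z).card < 4 * (G.filter fun ℓ' => Cross ℓ ℓ').card := by
  obtain ⟨h1, h2⟩ := hnd ℓ (hG hℓ)
  have hsub : G.filter (fun ℓ' => ¬ Cross ℓ ℓ') ⊆
      ((thr 𝓛 z).filter fun ℓ' => ℓ.1.1 = ℓ'.1.1) ∪ (thr 𝓛 z).filter fun ℓ' => ℓ.1.2 = ℓ'.1.2 := by
    intro ℓ' hℓ'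
    obtain ⟨hm, hc⟩ := Finset.mem_filter.1 hℓ'
    rw [Finset.mem_union, Finset.mem_filter, Finset.mem_filter]
    by_contra! hcon
    refine hc (cross_of_pt_eq (t := z 0) (t' := z 0) ?_ (hcon.1 (hG hm)) (hcon.2 (hG hm))).1
    rw [(mem_thr.1 (hG hm)).2, (mem_thr.1 (hG hℓ)).2]
  have h3 := (Finset.card_le_card hsub).trans (Finset.card_union_le _ _)
  have h4 := Finset.card_filter_add_card_filter_not (s := G) (fun ℓ' => Cross ℓ ℓ')
  omega

lemma on_surface (P : Finset (ℝ × ℝ)) {n : ℕ} (g : Fin n → Poly3) (hirr : ∀ i, Irreducible (g i))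
    {D : ℕ} (hD : ∑ i, (g i).totalDegree ≤ D) (S : Finset (Fin 3 → ℝ))
    (hS : ∀ z ∈ S, ∃ j, eval z (g j) = 0) {k : ℕ} (hk : ∀ z ∈ S, k ≤ (thr (P ×ˢ P) z).card)
    (hnd : ∀ z ∈ S, Nondom (P ×ˢ P) z) :
    ∃ a b c : ℕ, S.card ≤ a + b + c ∧ a * k ≤ 24 * D * P.card ^ 2 ∧
      b ≤ 13200 * P.card * D ^ 2 ∧ c * k ^ 2 ≤ 200 * P.card ^ 3 := by
  classical
  set N := P.card with hN
  set 𝓛 := P ×ˢ P with h𝓛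
  have hL : 𝓛.card = N ^ 2 := by rw [h𝓛, Finset.card_product, sq]
  have hE : ∀ i, ∃ E ⊆ grp g 𝓛 i, E.card ≤ 66 * (g i).totalDegree ^ 2 ∧
      ((grp g 𝓛 i).card ≤ 25 * N ∨ ∀ ℓ ∈ grp g 𝓛 i, ℓ ∉ E → ∃ T : Finset ℝ,
        T.card ≤ 11 * (g i).totalDegree ∧ ∀ ℓ' ∈ grp g 𝓛 i, Cross ℓ ℓ' → meetT ℓ ℓ' ∈ T) := by
    intro i
    rcases surface_structure (hirr i) P (grp g 𝓛 i) (grp_subset i)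
      (fun ℓ hℓ => (mem_grp.1 hℓ).2.1) with h | h | ⟨E, hE, hEc, hT⟩
    · exact ⟨∅, Finset.empty_subset _, by simp, Or.inr fun ℓ hℓ _ =>
        ⟨∅, by simp, fun ℓ' hℓ' hc => absurd hc (h ℓ hℓ ℓ' hℓ')⟩⟩
    · exact ⟨∅, Finset.empty_subset _, by simp, Or.inl h⟩
    · exact ⟨E, hE, hEc, Or.inr hT⟩
  choose E hEsub hEc hE using hE
  have hT : ∀ i ℓ, ∃ T : Finset ℝ, T.card ≤ 11 * (g i).totalDegree ∧
      (25 * N < (grp g 𝓛 i).card → ℓ ∈ grp g 𝓛 i → ℓ ∉ E i →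
        ∀ ℓ' ∈ grp g 𝓛 i, Cross ℓ ℓ' → meetT ℓ ℓ' ∈ T) := by
    intro i ℓ
    by_cases hc : 25 * N < (grp g 𝓛 i).card ∧ ℓ ∈ grp g 𝓛 i ∧ ℓ ∉ E i
    · obtain ⟨T, hT, hT'⟩ := (hE i).resolve_left (by omega) ℓ hc.2.1 hc.2.2
      exact ⟨T, hT, fun _ _ _ => hT'⟩
    · exact ⟨∅, by simp, fun h1 h2 h3 => absurd ⟨h1, h2, h3⟩ hc⟩
  choose T hTc hT using hT
  set B : Line → Finset ℝ := fun ℓ => inc g ℓ ∪ Finset.univ.biUnion fun i => T i ℓ with hB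
  have hBc : ∀ ℓ ∈ 𝓛, (B ℓ).card ≤ 12 * D := by
    intro ℓ _
    have h1 := (card_inc_le g ℓ).trans hD
    have h2 : (Finset.univ.biUnion fun i => T i ℓ).card ≤ 11 * D := by
      refine Finset.card_biUnion_le.trans ((Finset.sum_le_sum fun i _ => hTc i ℓ).trans ?_)
      rw [← Finset.mul_sum]
      exact Nat.mul_le_mul_left _ hD
    exact (Finset.card_union_le _ _).trans (by omega)
  set A := S.filter fun z => k ≤ 2 * ((thr 𝓛 z).filter fun ℓ => z 0 ∈ B ℓ).card with hA
  set X : Finset (Fin 3 → ℝ) := Finset.univ.biUnion fun i => crossPts (E i) with hX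
  set Y : Fin n → Finset (Fin 3 → ℝ) := fun i => S.filter fun z => (grp g 𝓛 i).card ≤ 25 * N ∧
    k ^ 2 ≤ 8 * ((grp g 𝓛 i ×ˢ grp g 𝓛 i).filter fun p => Cross p.1 p.2 ∧
      pt p.1 (meetT p.1 p.2) = z).card with hY
  have hcover : S ⊆ A ∪ X ∪ Finset.univ.biUnion Y := by
    intro z hz
    by_cases hzA : z ∈ A
    · exact Finset.mem_union_left _ (Finset.mem_union_left _ hzA)
    have hzk : 2 * ((thr 𝓛 z).filter fun ℓ => z 0 ∈ B ℓ).card < k := by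
      by_contra hcon
      exact hzA (Finset.mem_filter.2 ⟨hz, not_lt.1 hcon⟩)
    set G := (thr 𝓛 z).filter fun ℓ => z 0 ∉ B ℓ with hG
    have hGsub : G ⊆ thr 𝓛 z := Finset.filter_subset _ _
    have hsplit := Finset.card_filter_add_card_filter_not (s := thr 𝓛 z) (fun ℓ => z 0 ∈ B ℓ)
    have hkz := hk z hz
    have hG2 : (thr 𝓛 z).card < 2 * G.card := by rw [hG]; omega
    have hthr : ∀ ℓ ∈ G, ℓ ∈ 𝓛 ∧ pt ℓ (z 0) = z := fun ℓ hℓ => mem_thr.1 (hGsub hℓ)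
    have hnB : ∀ ℓ ∈ G, z 0 ∉ B ℓ := fun ℓ hℓ => (Finset.mem_filter.1 hℓ).2
    have hninc : ∀ ℓ ∈ G, z 0 ∉ inc g ℓ := fun ℓ hℓ h => hnB ℓ hℓ (Finset.mem_union_left _ h)
    obtain ⟨i, hi, hmin⟩ := WellFounded.has_min (wellFounded_lt (α := Fin n))
      {j | eval z (g j) = 0} (hS z hz)
    have hGF : ∀ ℓ ∈ G, ℓ ∈ grp g 𝓛 i := by
      intro ℓ hℓ
      obtain ⟨hℓ𝓛, hℓz⟩ := hthr ℓ hℓ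
      refine mem_grp.2 ⟨hℓ𝓛, ?_, ?_⟩
      · by_contra h
        exact hninc ℓ hℓ (mem_inc g i h (by rw [hℓz]; exact hi))
      · intro j hj h
        refine hmin j ?_ hj
        have := eval_res ℓ (g j) (z 0)
        rw [h, Polynomial.eval_zero, hℓz] at this
        exact this.symm
    have hcr : ∀ ℓ ∈ G, _ := fun ℓ hℓ => (hnd z hz).cross_count hGsub hG2 hℓ
    have hmeet : ∀ ℓ ∈ G, ∀ ℓ' ∈ G, Cross ℓ ℓ' → meetT ℓ ℓ' = z 0 := fun ℓ hℓ ℓ' hℓ' hc =>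
      (hc.eq_meetT ((hthr ℓ hℓ).2.trans (hthr ℓ' hℓ').2.symm)).symm
    by_cases hcase : (grp g 𝓛 i).card ≤ 25 * N
    · refine Finset.mem_union_right _ (Finset.mem_biUnion.2 ⟨i, Finset.mem_univ _,
        Finset.mem_filter.2 ⟨hz, hcase, ?_⟩⟩)
      have hle : ∑ ℓ ∈ G, (G.filter fun ℓ' => Cross ℓ ℓ').card ≤
          ((grp g 𝓛 i ×ˢ grp g 𝓛 i).filter fun p => Cross p.1 p.2 ∧
            pt p.1 (meetT p.1 p.2) = z).card := by
        rw [← Finset.card_sigma]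
        refine Finset.card_le_card_of_injOn (fun q => (q.1, q.2)) ?_ ?_
        · rintro ⟨ℓ, ℓ'⟩ hq
          obtain ⟨hℓ, hq⟩ := Finset.mem_sigma.1 hq
          obtain ⟨hℓ', hc⟩ := Finset.mem_filter.1 hq
          refine Finset.mem_filter.2 ⟨Finset.mem_product.2 ⟨hGF _ hℓ, hGF _ hℓ'⟩, hc, ?_⟩
          simp only at hc hℓ hℓ' ⊢
          rw [hmeet ℓ hℓ ℓ' hℓ' hc]
          exact (hthr ℓ hℓ).2
        · rintro ⟨ℓ, ℓ'⟩ _ ⟨m, m'⟩ _ h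
          obtain ⟨h1, h2⟩ := Prod.ext_iff.1 h
          simp only at h1 h2
          rw [h1, h2]
      have h3 : G.card * k ≤ ∑ ℓ ∈ G, 4 * (G.filter fun ℓ' => Cross ℓ ℓ').card := by
        rw [← smul_eq_mul]
        refine Finset.card_nsmul_le_sum _ _ _ fun ℓ hℓ => ?_
        exact hkz.trans (hcr ℓ hℓ).le
      rw [← Finset.mul_sum] at h3
      nlinarith
    · refine Finset.mem_union_left _ (Finset.mem_union_right _ (Finset.mem_biUnion.2
        ⟨i, Finset.mem_univ _, ?_⟩))
      have hex : ∀ ℓ ∈ G, ∃ ℓ' ∈ G, Cross ℓ ℓ' := by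
        intro ℓ hℓ
        have := hcr ℓ hℓ
        have hpos : 0 < (G.filter fun ℓ' => Cross ℓ ℓ').card := by omega
        obtain ⟨ℓ', h⟩ := Finset.card_pos.1 hpos
        exact ⟨ℓ', (Finset.mem_filter.1 h).1, (Finset.mem_filter.1 h).2⟩
      have hGE : ∀ ℓ ∈ G, ℓ ∈ E i := by
        intro ℓ hℓ
        by_contra hcon
        obtain ⟨ℓ', hℓ', hc⟩ := hex ℓ hℓ
        have := hT i ℓ (not_le.1 hcase) (hGF ℓ hℓ) hcon ℓ' (hGF ℓ' hℓ') hc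
        rw [hmeet ℓ hℓ ℓ' hℓ' hc] at this
        exact hnB ℓ hℓ (Finset.mem_union_right _ (Finset.mem_biUnion.2 ⟨i, Finset.mem_univ _, this⟩))
      obtain ⟨ℓ, hℓ⟩ : G.Nonempty := Finset.card_pos.1 (by omega)
      obtain ⟨ℓ', hℓ', hc⟩ := hex ℓ hℓ
      refine mem_crossPts.2 ⟨ℓ, hGE ℓ hℓ, ℓ', hGE ℓ' hℓ', hc, ?_⟩
      rw [hmeet ℓ hℓ ℓ' hℓ' hc]
      exact (hthr ℓ hℓ).2
  refine ⟨A.card, X.card, (Finset.univ.biUnion Y).card, ?_, ?_, ?_, ?_⟩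
  · exact (Finset.card_le_card hcover).trans ((Finset.card_union_le _ _).trans
      (Nat.add_le_add_right (Finset.card_union_le _ _) _))
  · have h1 : A.card * ((k + 1) / 2) ≤ 𝓛.card * (12 * D) := by
      refine card_mul_le_of_mem_inc B (fun z hz => ?_) hBc
      have := (Finset.mem_filter.1 hz).2
      omega
    have h2 : k ≤ 2 * ((k + 1) / 2) := by omega
    rw [hL] at h1
    calc A.card * k ≤ A.card * (2 * ((k + 1) / 2)) := Nat.mul_le_mul_left _ h2
      _ = 2 * (A.card * ((k + 1) / 2)) := by ring
      _ ≤ 2 * (N ^ 2 * (12 * D)) := Nat.mul_le_mul_left _ h1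
      _ = _ := by ring
  · refine Finset.card_biUnion_le.trans ?_
    have h1 : ∀ i, (crossPts (E i)).card ≤ 13200 * N * D * (g i).totalDegree := by
      intro i
      have hdi : (g i).totalDegree ≤ D :=
        (Finset.single_le_sum (fun j _ => Nat.zero_le ((g j).totalDegree))
          (Finset.mem_univ i)).trans hD
      calc _ ≤ 200 * N * (E i).card := card_crossPts_le P (E i) ((hEsub i).trans (grp_subset i))
        _ ≤ 200 * N * (66 * (g i).totalDegree ^ 2) := Nat.mul_le_mul_left _ (hEc i)
        _ = 13200 * N * (g i).totalDegree * (g i).totalDegree := by ring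
        _ ≤ _ := by gcongr
    refine (Finset.sum_le_sum fun i _ => h1 i).trans ?_
    rw [← Finset.mul_sum]
    calc _ ≤ 13200 * N * D * D := Nat.mul_le_mul_left _ hD
      _ = _ := by ring
  · have h1 : ∀ i, (Y i).card * k ^ 2 ≤ 200 * N * (grp g 𝓛 i).card := by
      intro i
      by_cases hc : (grp g 𝓛 i).card ≤ 25 * N
      · refine (card_mul_le_of_crossing (F := grp g 𝓛 i) (fun z hz =>
          (Finset.mem_filter.1 hz).2.2)).trans ?_
        nlinarith [Nat.mul_le_mul_right (grp g 𝓛 i).card hc]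
      · have : Y i = ∅ := Finset.eq_empty_of_forall_notMem fun z hz =>
          hc (Finset.mem_filter.1 hz).2.1
        simp [this]
    calc _ ≤ (∑ i, (Y i).card) * k ^ 2 := Nat.mul_le_mul_right _ Finset.card_biUnion_le
      _ = ∑ i, (Y i).card * k ^ 2 := Finset.sum_mul _ _ _
      _ ≤ ∑ i, 200 * N * (grp g 𝓛 i).card := Finset.sum_le_sum fun i _ => h1 i
      _ = 200 * N * ∑ i, (grp g 𝓛 i).card := by rw [Finset.mul_sum]
      _ ≤ 200 * N * N ^ 2 := by rw [← hL]; exact Nat.mul_le_mul_left _ sum_card_grp_le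
      _ = _ := by ring

lemma card_thr_le (P : Finset (ℝ × ℝ)) {z : Fin 3 → ℝ} (hz : z 0 ≠ 0) :
    (thr (P ×ˢ P) z).card ≤ P.card := by
  refine Finset.card_le_card_of_injOn (fun ℓ => ℓ.1)
    (fun ℓ hℓ => (Finset.mem_product.1 (mem_thr.1 hℓ).1).1) ?_
  intro ℓ hℓ ℓ' hℓ' h
  simp only at h
  obtain ⟨-, h1, h2⟩ := pt_eq_iff.1 ((mem_thr.1 hℓ).2.trans (mem_thr.1 hℓ').2.symm)
  rw [h, sub_self, mul_zero] at h1
  rw [h, sub_self, eq_comm, mul_eq_zero] at h2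
  exact Prod.ext h (Prod.ext (sub_eq_zero.1 h1) (sub_eq_zero.1 (h2.resolve_left hz)))

lemma exists_irreducible_family (l : List Poly3) (hl : ∀ f ∈ l, f ≠ 0) :
    ∃ (n : ℕ) (g : Fin n → Poly3), (∀ i, Irreducible (g i)) ∧
      ∑ i, (g i).totalDegree ≤ listDeg l ∧
      ∀ z, (∃ f ∈ l, eval z f = 0) → ∃ j, eval z (g j) = 0 := by
  have h0 : l.prod ≠ 0 := by
    rw [Ne, List.prod_eq_zero_iff]
    exact fun h => hl 0 h rfl
  have hdeg : l.prod.totalDegree ≤ listDeg l := totalDegree_list_prod l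
  obtain ⟨l', h1, h2, h3, -⟩ := exists_irreducible_list h0
  refine ⟨l'.length, fun i => l'[i], fun i => h1 _ (List.getElem_mem _), ?_, ?_⟩
  · refine le_trans (le_of_eq ?_) hdeg
    rw [← h2, listDeg, ← Fin.sum_univ_fun_getElem]
    rfl
  · rintro z ⟨f, hf, hz⟩
    obtain ⟨p, hp, hp0⟩ := h3 z (by
      rw [map_list_prod, List.prod_eq_zero_iff]
      exact List.mem_map.2 ⟨f, hf, hz⟩)
    obtain ⟨i, hi, rfl⟩ := List.getElem_of_mem hp
    exact ⟨⟨i, hi⟩, hp0⟩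

lemma rich_arith_linear {s k N x c C : ℝ} (hs : 0 < s) (hk : 0 < k) (hN : 0 ≤ N)
    (hC : 0 ≤ C) (hcC : 4 * c ^ 3 ≤ C ^ 2) (hx3 : x ^ 3 * k = 4 * s)
    (h : s * k ≤ c * N ^ 2 * x) : s * k ^ 2 ≤ C * N ^ 3 := by
  have h1 : (s * k) ^ 3 ≤ (c * N ^ 2 * x) ^ 3 := pow_le_pow_left₀ (by positivity) h 3
  have h2 : s * (s * k ^ 2) ^ 2 ≤ s * (C * N ^ 3) ^ 2 := by
    calc s * (s * k ^ 2) ^ 2 = (s * k) ^ 3 * k := by ring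
      _ ≤ (c * N ^ 2 * x) ^ 3 * k := by gcongr
      _ = c ^ 3 * N ^ 6 * (x ^ 3 * k) := by ring
      _ = s * N ^ 6 * (4 * c ^ 3) := by rw [hx3]; ring
      _ ≤ s * N ^ 6 * C ^ 2 := by gcongr
      _ = _ := by ring
  exact (abs_le_of_sq_le_sq' (le_of_mul_le_mul_left h2 hs) (by positivity)).2

lemma rich_arith_quadratic {s k N x c C : ℝ} (hs : 0 < s) (hk : 0 < k) (hN : 0 ≤ N)
    (hcC : 16 * c ^ 3 ≤ C) (hx3 : x ^ 3 * k = 4 * s)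
    (h : s ≤ c * N * x ^ 2) : s * k ^ 2 ≤ C * N ^ 3 := by
  have h1 : s ^ 3 ≤ (c * N * x ^ 2) ^ 3 := pow_le_pow_left₀ hs.le h 3
  have h2 : s ^ 2 * (s * k ^ 2) ≤ s ^ 2 * (C * N ^ 3) := by
    calc s ^ 2 * (s * k ^ 2) = s ^ 3 * k ^ 2 := by ring
      _ ≤ (c * N * x ^ 2) ^ 3 * k ^ 2 := by gcongr
      _ = c ^ 3 * N ^ 3 * (x ^ 3 * k) ^ 2 := by ring
      _ = s ^ 2 * N ^ 3 * (16 * c ^ 3) := by rw [hx3]; ring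
      _ ≤ s ^ 2 * N ^ 3 * C := by gcongr
      _ = _ := by ring
  exact le_of_mul_le_mul_left h2 (by positivity)

/-- There are few points, not dominated by a plane, through which many lines pass. -/
theorem card_rich_le (P : Finset (ℝ × ℝ)) (S : Finset (Fin 3 → ℝ)) (hS0 : ∀ z ∈ S, z 0 ≠ 0)
    {k : ℕ} (hkpos : 0 < k) (hk : ∀ z ∈ S, k ≤ (thr (P ×ˢ P) z).card)
    (hnd : ∀ z ∈ S, Nondom (P ×ˢ P) z) :
    (S.card : ℝ) * k ^ 2 ≤ 10 ^ 28 * (P.card : ℝ) ^ 3 := by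
  classical
  set N := P.card with hN
  rcases S.eq_empty_or_nonempty with rfl | hne
  · simp
  have hs : (0 : ℝ) < S.card := by exact_mod_cast hne.card_pos
  have hk0 : (0 : ℝ) < k := by exact_mod_cast hkpos
  have hN0 : (0 : ℝ) ≤ N := Nat.cast_nonneg _
  have hkN : (k : ℝ) ≤ N := by
    obtain ⟨z, hz⟩ := hne
    exact_mod_cast (hk z hz).trans (card_thr_le P (hS0 z hz))
  by_cases hsmall : 4 * (S.card : ℝ) < k
  · have hsk : (S.card : ℝ) ≤ k := by linarith
    calc (S.card : ℝ) * k ^ 2 ≤ k * k ^ 2 := mul_le_mul_of_nonneg_right hsk (by positivity)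
      _ = (k : ℝ) ^ 3 := by ring
      _ ≤ (N : ℝ) ^ 3 := by gcongr
      _ ≤ _ := by
        have : (0 : ℝ) ≤ (N : ℝ) ^ 3 := by positivity
        linarith
  set x : ℝ := (4 * S.card / k) ^ ((3 : ℝ)⁻¹) with hx
  have hbase : (1 : ℝ) ≤ 4 * S.card / k := by rw [le_div_iff₀ hk0]; linarith
  have hx1 : 1 ≤ x := Real.one_le_rpow hbase (by norm_num)
  have hx3' : x ^ 3 = 4 * S.card / k := by
    rw [hx, ← Real.rpow_natCast, ← Real.rpow_mul (by linarith)]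
    norm_num
  have hx3 : x ^ 3 * k = 4 * S.card := by rw [hx3', div_mul_cancel₀ _ hk0.ne']
  obtain ⟨l, hl0, hΨ, hdeg⟩ := exists_partition S hx1
  have hΨ' : ((cellPairs S l).card : ℝ) * 4 ≤ S.card * k := by
    have h1 : (cellPairs S l).card * x ^ 3 * k ≤ (S.card : ℝ) ^ 2 * k := by gcongr
    rw [mul_assoc, hx3] at h1
    have h2 : (S.card : ℝ) * ((cellPairs S l).card * 4) ≤ S.card * (S.card * k) := by
      nlinarith
    exact le_of_mul_le_mul_left h2 hs
  obtain ⟨n, g, hirr, hgdeg, hg⟩ := exists_irreducible_family l hl0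
  set S₁ := S.filter fun z => ∀ f ∈ l, eval z f ≠ 0 with hS₁
  set S₂ := S.filter fun z => ¬ ∀ f ∈ l, eval z f ≠ 0 with hS₂
  have hsplit : (S₁.card : ℝ) + S₂.card = S.card := by
    exact_mod_cast Finset.card_filter_add_card_filter_not (s := S) _
  have hoff := off_surface (𝓛 := P ×ˢ P) (Finset.filter_subset _ _ : S₁ ⊆ S)
    (fun z hz => (Finset.mem_filter.1 hz).2) (fun z hz => hk z (Finset.mem_filter.1 hz).1)
  obtain ⟨a, b, c, habc, ha, hb, hc⟩ := on_surface P g hirr hgdeg S₂ (fun z hz => by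
      have := (Finset.mem_filter.1 hz).2
      push Not at this
      exact hg z this) (fun z hz => hk z (Finset.mem_filter.1 hz).1)
      (fun z hz => hnd z (Finset.mem_filter.1 hz).1)
  rw [Finset.card_product, ← hN] at hoff
  rw [← hN] at ha hb hc
  have hoffR : (S₁.card : ℝ) * k ≤ N * N * (listDeg l + 1) + (cellPairs S l).card := by
    exact_mod_cast hoff
  have habcR : (S₂.card : ℝ) ≤ a + b + c := by exact_mod_cast habc
  have haR : (a : ℝ) * k ≤ 24 * listDeg l * N ^ 2 := by exact_mod_cast ha
  have hbR : (b : ℝ) ≤ 13200 * N * listDeg l ^ 2 := by exact_mod_cast hb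
  have hcR : (c : ℝ) * k ^ 2 ≤ 200 * N ^ 3 := by exact_mod_cast hc
  have hN3 : (0 : ℝ) ≤ (N : ℝ) ^ 3 := by positivity
  by_cases h1 : (S.card : ℝ) ≤ 2 * S₁.card
  · refine rich_arith_linear (c := 296) hs hk0 hN0 (by norm_num) (by norm_num) hx3 ?_
    have e1 : (N : ℝ) * N * (listDeg l + 1) ≤ N * N * (74 * x) := by
      gcongr; linarith
    have e2 : (S.card : ℝ) * k ≤ 2 * S₁.card * k := by gcongr
    nlinarith
  by_cases h2 : (S.card : ℝ) ≤ 6 * a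
  · refine rich_arith_linear (c := 10512) hs hk0 hN0 (by norm_num) (by norm_num) hx3 ?_
    have e2 : (S.card : ℝ) * k ≤ 6 * a * k := by gcongr
    have e1 : 24 * (listDeg l : ℝ) * N ^ 2 ≤ 24 * (73 * x) * N ^ 2 := by gcongr
    linarith
  by_cases h3 : (S.card : ℝ) ≤ 6 * b
  · refine rich_arith_quadratic (c := 422056800) hs hk0 hN0 (by norm_num) hx3 ?_
    have e1 : 13200 * N * (listDeg l : ℝ) ^ 2 ≤ 13200 * N * (73 * x) ^ 2 := by gcongr
    linarith
  · have h4 : (S.card : ℝ) ≤ 6 * c := by linarith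
    have e2 : (S.card : ℝ) * k ^ 2 ≤ 6 * c * k ^ 2 := by gcongr
    linarith

/-- The total squared multiplicity of the points not dominated by a plane. -/
theorem sum_sq_rich_le (P : Finset (ℝ × ℝ)) (S : Finset (Fin 3 → ℝ)) (hS0 : ∀ z ∈ S, z 0 ≠ 0)
    (hnd : ∀ z ∈ S, Nondom (P ×ˢ P) z) :
    ∑ z ∈ S, ((thr (P ×ˢ P) z).card : ℝ) ^ 2 ≤
      2 * 10 ^ 28 * (P.card : ℝ) ^ 3 * (1 + Real.log P.card) := by
  classical
  set N := P.card with hN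
  set r : (Fin 3 → ℝ) → ℕ := fun z => (thr (P ×ˢ P) z).card with hr
  have hsq : ∀ m : ℕ, ((m : ℝ)) ^ 2 ≤ ∑ k ∈ Finset.range m, 2 * ((k : ℝ) + 1) := by
    intro m
    induction m with
    | zero => simp
    | succ m ih =>
      rw [Finset.sum_range_succ]
      push_cast
      nlinarith
  have h1 : ∀ z ∈ S, ((r z : ℝ)) ^ 2 ≤
      ∑ k ∈ Finset.range N, if k + 1 ≤ r z then 2 * ((k : ℝ) + 1) else 0 := by
    intro z hz
    refine (hsq (r z)).trans (le_of_eq ?_)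
    rw [← Finset.sum_filter]
    refine Finset.sum_congr ?_ fun _ _ => rfl
    have := card_thr_le P (hS0 z hz)
    ext k
    simp only [Finset.mem_range, Finset.mem_filter]
    have : r z ≤ N := this
    omega
  refine (Finset.sum_le_sum h1).trans ?_
  rw [Finset.sum_comm]
  have h2 : ∀ k ∈ Finset.range N, (∑ z ∈ S, if k + 1 ≤ r z then 2 * ((k : ℝ) + 1) else 0) ≤
      2 * 10 ^ 28 * (N : ℝ) ^ 3 * ((k : ℝ) + 1)⁻¹ := by
    intro k _
    rw [← Finset.sum_filter, Finset.sum_const, nsmul_eq_mul]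
    have h := card_rich_le P (S.filter fun z => k + 1 ≤ r z)
      (fun z hz => hS0 z (Finset.mem_filter.1 hz).1) (Nat.succ_pos k)
      (fun z hz => (Finset.mem_filter.1 hz).2) (fun z hz => hnd z (Finset.mem_filter.1 hz).1)
    push_cast at h
    rw [← div_eq_mul_inv, le_div_iff₀ (by positivity)]
    linarith
  refine (Finset.sum_le_sum h2).trans ?_
  rw [← Finset.mul_sum]
  have h3 : ∑ k ∈ Finset.range N, ((k : ℝ) + 1)⁻¹ ≤ 1 + Real.log N := by
    have := harmonic_le_one_add_log N
    rw [harmonic] at this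
    push_cast at this
    exact this
  gcongr

lemma exists_blocks (A : Finset ℝ) {ρ : ℕ} (hρ : 0 < ρ) (hρA : ρ ≤ A.card) :
    ∃ κ : ℝ → ℕ, Monotone κ ∧ (∀ v ∈ A, κ v < ρ) ∧
      ∀ i, ρ * (A.filter fun v => κ v = i).card ≤ 2 * A.card := by
  set rk : ℝ → ℕ := fun v => (A.filter fun w => w < v).card with hrk
  have hA : 0 < A.card := by omega
  have hmono : Monotone rk := fun v w h => Finset.card_le_card fun y hy => by
    obtain ⟨h1, h2⟩ := Finset.mem_filter.1 hy
    exact Finset.mem_filter.2 ⟨h1, h2.trans_le h⟩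
  have hstrict : ∀ v ∈ A, ∀ w, v < w → rk v < rk w := fun v hv w h => by
    refine Finset.card_lt_card ⟨fun y hy => ?_, fun hsub => ?_⟩
    · obtain ⟨h1, h2⟩ := Finset.mem_filter.1 hy
      exact Finset.mem_filter.2 ⟨h1, h2.trans h⟩
    · exact lt_irrefl v (Finset.mem_filter.1 (hsub (Finset.mem_filter.2 ⟨hv, h⟩))).2
  have hlt : ∀ v ∈ A, rk v < A.card := fun v hv => by
    refine Finset.card_lt_card ⟨Finset.filter_subset _ _, fun hsub => ?_⟩
    exact lt_irrefl v (Finset.mem_filter.1 (hsub hv)).2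
  refine ⟨fun v => rk v * ρ / A.card, ?_, ?_, ?_⟩
  · intro v w h
    exact Nat.div_le_div_right (Nat.mul_le_mul_right _ (hmono h))
  · intro v hv
    rw [Nat.div_lt_iff_lt_mul hA, mul_comm]
    exact Nat.mul_lt_mul_of_pos_left (hlt v hv) hρ
  · intro i
    set F := A.filter fun v => rk v * ρ / A.card = i with hF
    rcases F.eq_empty_or_nonempty with h | hne
    · simp [h]
    have hinj : Set.InjOn rk F := by
      intro v hv w hw h
      have hv' := (Finset.mem_filter.1 hv).1
      have hw' := (Finset.mem_filter.1 hw).1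
      rcases lt_trichotomy v w with h' | h' | h'
      · exact absurd h (hstrict v hv' w h').ne
      · exact h'
      · exact absurd h (hstrict w hw' v h').ne'
    obtain ⟨v, hv, hmin⟩ := F.exists_min_image rk hne
    obtain ⟨w, hw, hmax⟩ := F.exists_max_image rk hne
    have hcard : F.card ≤ rk w + 1 - rk v := by
      rw [← Nat.card_Icc]
      exact Finset.card_le_card_of_injOn rk
        (fun y hy => Finset.mem_coe.2 (Finset.mem_Icc.2 ⟨hmin y hy, hmax y hy⟩)) hinj
    have h1 : i * A.card ≤ rk v * ρ := by
      rw [← (Finset.mem_filter.1 hv).2]; exact Nat.div_mul_le_self _ _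
    have h2 : rk w * ρ < (i + 1) * A.card := by
      rw [← (Finset.mem_filter.1 hw).2, mul_comm _ A.card]
      exact Nat.lt_mul_div_succ _ hA
    have h3 : rk v ≤ rk w := hmin w hw
    have h4 : F.card + rk v ≤ rk w + 1 := by omega
    have h5 := Nat.mul_le_mul_right ρ h4
    nlinarith

/-- A family of monotone or antitone sets in a grid, any two of which share at most one point. -/
theorem sum_sq_card_chains_le {ι : Type*} (Z : Finset ι) (A B : Finset ℝ) (M : ι → Finset (ℝ × ℝ))
    (hM : ∀ z ∈ Z, M z ⊆ A ×ˢ B) (τ : ι → ℝ) (hτ : ∀ z ∈ Z, τ z ≠ 0)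
    (hchain : ∀ z ∈ Z, ∀ p ∈ M z, ∀ q ∈ M z, p.1 - q.1 = τ z * (p.2 - q.2))
    (hone : ∀ z ∈ Z, ∀ z' ∈ Z, ∀ p ∈ M z, ∀ q ∈ M z, p ∈ M z' → q ∈ M z' → p ≠ q → z = z')
    {ρ : ℕ} (hρ : 0 < ρ) (hρA : ρ ≤ A.card) (hρB : ρ ≤ B.card) (hbig : ∀ z ∈ Z, 4 * ρ ≤ (M z).card) :
    ρ * ∑ z ∈ Z, (M z).card ^ 2 ≤ 16 * (A.card * B.card) ^ 2 := by
  classical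
  obtain ⟨κ, hκm, hκA, hκc⟩ := exists_blocks A hρ hρA
  obtain ⟨μ, hμm, hμB, hμc⟩ := exists_blocks B hρ hρB
  set bx : ℝ × ℝ → ℕ × ℕ := fun p => (κ p.1, μ p.2) with hbx
  set Q := ((A ×ˢ B) ×ˢ (A ×ˢ B)).filter fun p => bx p.1 = bx p.2 with hQ
  have hQc : ρ ^ 2 * Q.card ≤ 4 * (A.card * B.card) ^ 2 := by
    have h1 : Q.card = ∑ p ∈ A ×ˢ B, ((A ×ˢ B).filter fun q => bx p = bx q).card := by
      rw [hQ, Finset.card_filter, Finset.sum_product]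
      refine Finset.sum_congr rfl fun p _ => ?_
      rw [Finset.card_filter]
    have h2 : ∀ p ∈ A ×ˢ B, ρ ^ 2 * ((A ×ˢ B).filter fun q => bx p = bx q).card ≤
        4 * (A.card * B.card) := by
      intro p _
      have h3 : ((A ×ˢ B).filter fun q => bx p = bx q) =
          (A.filter fun v => κ v = κ p.1) ×ˢ (B.filter fun v => μ v = μ p.2) := by
        rw [← Finset.filter_product]
        refine Finset.filter_congr fun q _ => ?_
        simp only [hbx, Prod.mk.injEq]
        constructor
        · rintro ⟨h1, h2⟩; exact ⟨h1.symm, h2.symm⟩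
        · rintro ⟨h1, h2⟩; exact ⟨h1.symm, h2.symm⟩
      rw [h3, Finset.card_product]
      have := Nat.mul_le_mul (hκc (κ p.1)) (hμc (μ p.2))
      nlinarith
    rw [h1, Finset.mul_sum]
    refine (Finset.sum_le_sum h2).trans (le_of_eq ?_)
    rw [Finset.sum_const, Finset.card_product, smul_eq_mul]
    ring
  set R : ι → Finset ((ℝ × ℝ) × (ℝ × ℝ)) := fun z =>
    (M z ×ˢ M z).filter fun p => p.1 ≠ p.2 ∧ bx p.1 = bx p.2 with hR
  have hRQ : ∑ z ∈ Z, (R z).card ≤ Q.card := by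
    rw [← Finset.card_biUnion]
    · refine Finset.card_le_card (Finset.biUnion_subset.2 fun z hz p hp => ?_)
      obtain ⟨h1, -, h2⟩ := Finset.mem_filter.1 hp
      obtain ⟨h3, h4⟩ := Finset.mem_product.1 h1
      exact Finset.mem_filter.2 ⟨Finset.mem_product.2 ⟨hM z hz h3, hM z hz h4⟩, h2⟩
    · intro z hz z' hz' hne
      rw [Function.onFun, Finset.disjoint_left]
      intro p hp hp'
      obtain ⟨h1, h2, -⟩ := Finset.mem_filter.1 hp
      obtain ⟨h3, h4⟩ := Finset.mem_product.1 h1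
      obtain ⟨h1', -, -⟩ := Finset.mem_filter.1 hp'
      obtain ⟨h3', h4'⟩ := Finset.mem_product.1 h1'
      exact hne (hone z hz z' hz' _ h3 _ h4 h3' h4' h2)
  have hboxes : ∀ z ∈ Z, ((M z).image bx).card ≤ 2 * ρ := by
    intro z hz
    have hlt : ∀ p ∈ M z, κ p.1 < ρ ∧ μ p.2 < ρ := fun p hp =>
      ⟨hκA _ (Finset.mem_product.1 (hM z hz hp)).1, hμB _ (Finset.mem_product.1 (hM z hz hp)).2⟩
    rcases lt_or_gt_of_ne (hτ z hz) with hneg | hpos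
    · have := Finset.card_le_card_of_injOn (s := (M z).image bx) (t := Finset.range (2 * ρ))
        (fun b => b.1 + (ρ - b.2)) ?_ ?_
      · rwa [Finset.card_range] at this
      · intro b hb
        obtain ⟨p, hp, rfl⟩ := Finset.mem_image.1 hb
        have := hlt p hp
        simp only [hbx, Finset.coe_range, Set.mem_Iio]
        omega
      · intro b hb b' hb' h
        obtain ⟨p, hp, rfl⟩ := Finset.mem_image.1 hb
        obtain ⟨q, hq, rfl⟩ := Finset.mem_image.1 hb'
        have h1 := hlt p hp
        have h2 := hlt q hq
        have h3 := hchain z hz p hp q hq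
        simp only [hbx] at h ⊢
        rcases le_total p.2 q.2 with hle | hle
        · have h4 := hμm hle
          have h5 : κ q.1 ≤ κ p.1 := hκm (by nlinarith)
          rw [Prod.mk.injEq]; omega
        · have h4 := hμm hle
          have h5 : κ p.1 ≤ κ q.1 := hκm (by nlinarith)
          rw [Prod.mk.injEq]; omega
    · have := Finset.card_le_card_of_injOn (s := (M z).image bx) (t := Finset.range (2 * ρ))
        (fun b => b.1 + b.2) ?_ ?_
      · rwa [Finset.card_range] at this
      · intro b hb
        obtain ⟨p, hp, rfl⟩ := Finset.mem_image.1 hb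
        have := hlt p hp
        simp only [hbx, Finset.coe_range, Set.mem_Iio]
        omega
      · intro b hb b' hb' h
        obtain ⟨p, hp, rfl⟩ := Finset.mem_image.1 hb
        obtain ⟨q, hq, rfl⟩ := Finset.mem_image.1 hb'
        have h3 := hchain z hz p hp q hq
        simp only [hbx] at h ⊢
        rcases le_total p.2 q.2 with hle | hle
        · have h4 := hμm hle
          have h5 : κ p.1 ≤ κ q.1 := hκm (by nlinarith)
          rw [Prod.mk.injEq]; omega
        · have h4 := hμm hle
          have h5 : κ q.1 ≤ κ p.1 := hκm (by nlinarith)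
          rw [Prod.mk.injEq]; omega
  have hz : ∀ z ∈ Z, (M z).card ^ 2 ≤ 4 * ρ * (R z).card := by
    intro z hz
    have h1 : (M z).card ^ 2 ≤ 2 * ρ * ∑ b ∈ (M z).image bx, ((M z).filter fun p => bx p = b).card ^ 2 := by
      rw [Finset.card_eq_sum_card_image bx (M z)]
      refine sq_sum_le_card_mul_sum_sq.trans (Nat.mul_le_mul_right _ (hboxes z hz))
    have h2 : ∑ b ∈ (M z).image bx, ((M z).filter fun p => bx p = b).card ^ 2 =
        ((M z ×ˢ M z).filter fun p => bx p.1 = bx p.2).card := by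
      rw [Finset.card_eq_sum_card_fiberwise (f := fun p : (ℝ × ℝ) × (ℝ × ℝ) => bx p.1)
        (t := (M z).image bx)]
      · refine Finset.sum_congr rfl fun b _ => ?_
        rw [sq, ← Finset.card_product]
        congr 1
        ext p
        simp only [Finset.mem_product, Finset.mem_filter]
        constructor
        · rintro ⟨⟨h1, h2⟩, h3, h4⟩
          exact ⟨⟨⟨h1, h3⟩, h2.trans h4.symm⟩, h2⟩
        · rintro ⟨⟨⟨h1, h3⟩, h2⟩, h4⟩
          exact ⟨⟨h1, h4⟩, h3, h2.symm.trans h4⟩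
      · intro p hp
        exact Finset.mem_coe.2 (Finset.mem_image_of_mem _
          (Finset.mem_product.1 (Finset.mem_filter.1 hp).1).1)
    have h3 : ((M z ×ˢ M z).filter fun p => bx p.1 = bx p.2).card ≤ (R z).card + (M z).card := by
      have : ((M z ×ˢ M z).filter fun p => bx p.1 = bx p.2) ⊆ R z ∪ (M z).image fun p => (p, p) := by
        intro p hp
        obtain ⟨h1, h2⟩ := Finset.mem_filter.1 hp
        rw [Finset.mem_union]
        by_cases h : p.1 = p.2
        · right
          exact Finset.mem_image.2 ⟨p.1, (Finset.mem_product.1 h1).1, Prod.ext rfl h⟩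
        · left
          exact Finset.mem_filter.2 ⟨h1, h, h2⟩
      exact (Finset.card_le_card this).trans ((Finset.card_union_le _ _).trans
        (Nat.add_le_add_left Finset.card_image_le _))
    rw [h2] at h1
    have h4 := hbig z hz
    have h5 := h1.trans (Nat.mul_le_mul_left _ h3)
    have h6 := Nat.mul_le_mul_right (M z).card h4
    nlinarith
  calc ρ * ∑ z ∈ Z, (M z).card ^ 2 ≤ ρ * ∑ z ∈ Z, 4 * ρ * (R z).card :=
        Nat.mul_le_mul_left _ (Finset.sum_le_sum hz)
    _ = 4 * ρ ^ 2 * ∑ z ∈ Z, (R z).card := by rw [← Finset.mul_sum]; ring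
    _ ≤ 4 * ρ ^ 2 * Q.card := Nat.mul_le_mul_left _ hRQ
    _ = 4 * (ρ ^ 2 * Q.card) := by ring
    _ ≤ 4 * (4 * (A.card * B.card) ^ 2) := Nat.mul_le_mul_left _ hQc
    _ = _ := by ring

open scoped Classical in
/-- The crossing ordered pairs of lines of `𝓛` through `z`. -/
noncomputable def crossPairs (𝓛 : Finset Line) (z : Fin 3 → ℝ) : Finset (Line × Line) :=
  (thr 𝓛 z ×ˢ thr 𝓛 z).filter fun e => Cross e.1 e.2

lemma card_crossPairs_le (𝓛 : Finset Line) (z : Fin 3 → ℝ) :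
    (crossPairs 𝓛 z).card ≤ (thr 𝓛 z).card ^ 2 := by
  classical
  refine (Finset.card_filter_le _ _).trans ?_
  rw [Finset.card_product, sq]

lemma card_crossPairs_le_of_subset {𝓛 M : Finset Line} {z : Fin 3 → ℝ} [DecidableEq Line]
    (hM : ∀ ℓ ∈ M, ∀ ℓ' ∈ M, ¬ Cross ℓ ℓ') :
    (crossPairs 𝓛 z).card ≤ 2 * ((thr 𝓛 z \ M).card * (thr 𝓛 z).card) := by
  classical
  have hsub : crossPairs 𝓛 z ⊆
      (thr 𝓛 z \ M) ×ˢ thr 𝓛 z ∪ thr 𝓛 z ×ˢ (thr 𝓛 z \ M) := by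
    intro e he
    obtain ⟨h1, h2⟩ := Finset.mem_filter.1 he
    obtain ⟨h3, h4⟩ := Finset.mem_product.1 h1
    by_cases h5 : e.1 ∈ M
    · by_cases h6 : e.2 ∈ M
      · exact absurd h2 (hM _ h5 _ h6)
      · exact Finset.mem_union_right _ (Finset.mem_product.2 ⟨h3, Finset.mem_sdiff.2 ⟨h4, h6⟩⟩)
    · exact Finset.mem_union_left _ (Finset.mem_product.2 ⟨Finset.mem_sdiff.2 ⟨h3, h5⟩, h4⟩)
  refine (Finset.card_le_card hsub).trans ((Finset.card_union_le _ _).trans ?_)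
  rw [Finset.card_product, Finset.card_product, mul_comm (thr 𝓛 z).card, two_mul]

/-- A choice of coordinates on the plane in which the two ruled families of distinguished planes
play the same role. -/
structure Ruling (x y : ℝ × ℝ → ℝ) (τ : ℝ → ℝ) : Prop where
  inj : Function.Injective τ
  ne_zero : ∀ t, t ≠ 0 → τ t ≠ 0
  ext : ∀ p q, x p = x q → y p = y q → p = q
  rel : ∀ (ℓ ℓ' : Line) (t : ℝ), t ≠ 0 → pt ℓ t = pt ℓ' t →
    x ℓ.2 - x ℓ'.2 = τ t * (x ℓ.1 - x ℓ'.1) ∧ y ℓ.1 - y ℓ'.1 = τ t * (y ℓ.2 - y ℓ'.2)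
  cross : ∀ ℓ ℓ', Cross ℓ ℓ' → x ℓ.1 ≠ x ℓ'.1

lemma ruling_fst : Ruling Prod.fst Prod.snd id where
  inj := Function.injective_id
  ne_zero _ h := h
  ext _ _ h h' := Prod.ext h h'
  rel _ _ _ _ h := (pt_eq_iff.1 h).2
  cross _ _ h := sub_ne_zero.1 h.ne.1

lemma ruling_snd : Ruling Prod.snd Prod.fst (fun t => t⁻¹) where
  inj := inv_injective
  ne_zero _ h := inv_ne_zero h
  ext _ _ h h' := Prod.ext h' h
  rel ℓ ℓ' t ht h := by
    obtain ⟨-, h1, h2⟩ := pt_eq_iff.1 h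
    rw [h1, h2]
    constructor <;> field_simp
  cross _ _ h := sub_ne_zero.1 h.ne.2.1

section

variable {x y : ℝ × ℝ → ℝ} {τ : ℝ → ℝ}

open scoped Classical in
/-- The lines of `P ×ˢ P` through `z` in the plane of a ruling with parameters `u`, `a`. -/
noncomputable def planeThr (P : Finset (ℝ × ℝ)) (x : ℝ × ℝ → ℝ) (u a : ℝ) (z : Fin 3 → ℝ) :
    Finset Line :=
  (thr (P ×ˢ P) z).filter fun ℓ => x ℓ.1 = u ∧ x ℓ.2 = a

lemma mem_planeThr {P : Finset (ℝ × ℝ)} {u a : ℝ} {z : Fin 3 → ℝ} {ℓ : Line} :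
    ℓ ∈ planeThr P x u a z ↔ ℓ ∈ thr (P ×ˢ P) z ∧ x ℓ.1 = u ∧ x ℓ.2 = a := by
  classical
  simp [planeThr]

lemma Ruling.sum_off_plane_le (hR : Ruling x y τ) (P : Finset (ℝ × ℝ)) (u a : ℝ)
    (Z : Finset (Fin 3 → ℝ)) [DecidableEq Line] (hZ0 : ∀ z ∈ Z, z 0 ≠ 0)
    (hne : ∀ z ∈ Z, (planeThr P x u a z).Nonempty) :
    ∑ z ∈ Z, (thr (P ×ˢ P) z \ planeThr P x u a z).card ≤ P.card ^ 2 := by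
  classical
  have key : ∀ z ∈ Z, ∀ ℓ ∈ thr (P ×ˢ P) z \ planeThr P x u a z,
      x ℓ.1 - u ≠ 0 ∧ x ℓ.2 - a = τ (z 0) * (x ℓ.1 - u) := by
    intro z hz ℓ hℓ
    obtain ⟨h1, h2⟩ := Finset.mem_sdiff.1 hℓ
    obtain ⟨ℓ₀, h0⟩ := hne z hz
    obtain ⟨h3, h4, h5⟩ := mem_planeThr.1 h0
    have h6 := (hR.rel ℓ ℓ₀ (z 0) (hZ0 z hz)
      ((mem_thr.1 h1).2.trans (mem_thr.1 h3).2.symm)).1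
    rw [h4, h5] at h6
    refine ⟨fun h7 => h2 (mem_planeThr.2 ⟨h1, sub_eq_zero.1 h7, ?_⟩), h6⟩
    rw [h7, mul_zero] at h6
    exact sub_eq_zero.1 h6
  rw [← Finset.card_biUnion]
  · rw [sq, ← Finset.card_product]
    refine Finset.card_le_card fun ℓ hℓ => ?_
    obtain ⟨z, -, h⟩ := Finset.mem_biUnion.1 hℓ
    exact (mem_thr.1 (Finset.mem_sdiff.1 h).1).1
  · intro z hz z' hz' hzz
    refine Finset.disjoint_left.2 fun ℓ h h' => hzz ?_
    obtain ⟨h1, h2⟩ := key z hz ℓ h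
    obtain ⟨-, h3⟩ := key z' hz' ℓ h'
    have h4 : z 0 = z' 0 := hR.inj (mul_right_cancel₀ h1 (h2.symm.trans h3))
    have h5 := (mem_thr.1 (Finset.mem_sdiff.1 h).1).2
    have h6 := (mem_thr.1 (Finset.mem_sdiff.1 h').1).2
    rw [← h5, ← h6, h4]

open scoped Classical in
/-- The points of `P` on the line `x = c`. -/
noncomputable def col (P : Finset (ℝ × ℝ)) (x : ℝ × ℝ → ℝ) (c : ℝ) : Finset (ℝ × ℝ) :=
  P.filter fun p => x p = c

lemma Ruling.sum_sq_plane_le (hR : Ruling x y τ) (P : Finset (ℝ × ℝ)) (u a : ℝ)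
    (Z : Finset (Fin 3 → ℝ)) (hZ0 : ∀ z ∈ Z, z 0 ≠ 0) {ρ : ℕ} (hρ : 0 < ρ)
    (hρu : ρ ≤ (col P x u).card) (hρa : ρ ≤ (col P x a).card)
    (hbig : ∀ z ∈ Z, 4 * ρ ≤ (planeThr P x u a z).card) :
    ρ * ∑ z ∈ Z, (planeThr P x u a z).card ^ 2 ≤
      16 * ((col P x u).card * (col P x a).card) ^ 2 := by
  classical
  have hcol : ∀ c, ((col P x c).image y).card = (col P x c).card := fun c =>
    Finset.card_image_of_injOn fun p hp q hq h => hR.ext p q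
      ((Finset.mem_filter.1 hp).2.trans (Finset.mem_filter.1 hq).2.symm) h
  let ψ : Line → ℝ × ℝ := fun ℓ => (y ℓ.1, y ℓ.2)
  have hψ : ∀ z z' ℓ ℓ', ℓ ∈ planeThr P x u a z → ℓ' ∈ planeThr P x u a z' → ψ ℓ = ψ ℓ' →
      ℓ = ℓ' := by
    intro z z' ℓ ℓ' h h' he
    obtain ⟨-, h1, h2⟩ := mem_planeThr.1 h
    obtain ⟨-, h3, h4⟩ := mem_planeThr.1 h'
    exact Prod.ext (hR.ext _ _ (h1.trans h3.symm) (congrArg Prod.fst he))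
      (hR.ext _ _ (h2.trans h4.symm) (congrArg Prod.snd he))
  have hcard : ∀ z, ((planeThr P x u a z).image ψ).card = (planeThr P x u a z).card := fun z =>
    Finset.card_image_of_injOn fun ℓ h ℓ' h' he => hψ z z ℓ ℓ' h h' he
  have main := sum_sq_card_chains_le Z ((col P x u).image y) ((col P x a).image y)
    (fun z => (planeThr P x u a z).image ψ) ?_ (fun z => τ (z 0)) ?_ ?_ ?_ hρ
    (by rwa [hcol]) (by rwa [hcol]) (by simpa only [hcard] using hbig)
  · simpa only [hcard, hcol] using main
  · intro z _ p hp
    obtain ⟨ℓ, hℓ, rfl⟩ := Finset.mem_image.1 hp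
    obtain ⟨h1, h2, h3⟩ := mem_planeThr.1 hℓ
    obtain ⟨h4, h5⟩ := Finset.mem_product.1 (mem_thr.1 h1).1
    exact Finset.mem_product.2
      ⟨Finset.mem_image_of_mem _ (Finset.mem_filter.2 ⟨h4, h2⟩),
        Finset.mem_image_of_mem _ (Finset.mem_filter.2 ⟨h5, h3⟩)⟩
  · exact fun z hz => hR.ne_zero _ (hZ0 z hz)
  · intro z hz p hp q hq
    obtain ⟨ℓ, hℓ, rfl⟩ := Finset.mem_image.1 hp
    obtain ⟨ℓ', hℓ', rfl⟩ := Finset.mem_image.1 hq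
    exact (hR.rel ℓ ℓ' (z 0) (hZ0 z hz)
      ((mem_thr.1 (mem_planeThr.1 hℓ).1).2.trans (mem_thr.1 (mem_planeThr.1 hℓ').1).2.symm)).2
  · intro z hz z' hz' p hp q hq hp' hq' hpq
    obtain ⟨ℓ, hℓ, rfl⟩ := Finset.mem_image.1 hp
    obtain ⟨ℓ', hℓ', rfl⟩ := Finset.mem_image.1 hq
    obtain ⟨k, hk, hke⟩ := Finset.mem_image.1 hp'
    obtain ⟨k', hk', hke'⟩ := Finset.mem_image.1 hq'
    obtain rfl := hψ _ _ _ _ hk hℓ hke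
    obtain rfl := hψ _ _ _ _ hk' hℓ' hke'
    have e1 := (mem_thr.1 (mem_planeThr.1 hℓ).1).2
    have e2 := (mem_thr.1 (mem_planeThr.1 hℓ').1).2
    have e3 := (mem_thr.1 (mem_planeThr.1 hk).1).2
    have e4 := (mem_thr.1 (mem_planeThr.1 hk').1).2
    by_cases h : z 0 = z' 0
    · rw [← e1, h, e3]
    · exact absurd (congrArg ψ (eq_of_pt_eq h (e1.trans e2.symm) (e3.trans e4.symm))) hpq

lemma Ruling.sum_crossPairs_plane_le (hR : Ruling x y τ) (P : Finset (ℝ × ℝ)) (u a : ℝ)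
    (Z : Finset (Fin 3 → ℝ)) (hZ0 : ∀ z ∈ Z, z 0 ≠ 0)
    (hr : ∀ z ∈ Z, 64 < (thr (P ×ˢ P) z).card)
    (hm : ∀ z ∈ Z, (thr (P ×ˢ P) z).card ≤ 8 * (planeThr P x u a z).card) :
    ∑ z ∈ Z, (crossPairs (P ×ˢ P) z).card ≤
      8208 * ((col P x u).card * (col P x a).card) * P.card := by
  classical
  rcases Z.eq_empty_or_nonempty with rfl | ⟨z₀, hz₀⟩
  · simp
  have hne : ∀ z ∈ Z, (planeThr P x u a z).Nonempty := fun z hz => by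
    rw [← Finset.card_pos]
    have := hr z hz
    have := hm z hz
    omega
  obtain ⟨ℓ₀, hℓ₀⟩ := hne z₀ hz₀
  obtain ⟨h1, h2, h3⟩ := mem_planeThr.1 hℓ₀
  obtain ⟨h4, h5⟩ := Finset.mem_product.1 (mem_thr.1 h1).1
  have hα : 0 < (col P x u).card := Finset.card_pos.2 ⟨_, Finset.mem_filter.2 ⟨h4, h2⟩⟩
  have hβ : 0 < (col P x a).card := Finset.card_pos.2 ⟨_, Finset.mem_filter.2 ⟨h5, h3⟩⟩
  have hN : 0 < P.card := Finset.card_pos.2 ⟨_, h4⟩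
  have hαN : (col P x u).card ≤ P.card := Finset.card_filter_le _ _
  have hβN : (col P x a).card ≤ P.card := Finset.card_filter_le _ _
  set N := P.card with hNdef
  set α := (col P x u).card with hαdef
  set β := (col P x a).card with hβdef
  rw [← Finset.sum_filter_add_sum_filter_not Z fun z => α * β < (planeThr P x u a z).card * N]
  have hbig : ∑ z ∈ Z.filter (fun z => α * β < (planeThr P x u a z).card * N),
      (crossPairs (P ×ˢ P) z).card ≤ 8192 * (α * β) * N := by
    set ρ := max 1 (α * β / (4 * N)) with hρ
    have hk : α * β / (4 * N) * (4 * N) ≤ α * β := Nat.div_mul_le_self _ _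
    have hk' : α * β < (α * β / (4 * N) + 1) * (4 * N) := by
      have := Nat.lt_div_mul_add (a := α * β) (b := 4 * N) (by omega)
      rwa [add_mul, one_mul]
    have hρ1 : 1 ≤ ρ := le_max_left _ _
    have hρ2 : α * β / (4 * N) ≤ ρ := le_max_right _ _
    have main := hR.sum_sq_plane_le P u a
      (Z.filter fun z => α * β < (planeThr P x u a z).card * N)
      (fun z hz => hZ0 z (Finset.mem_filter.1 hz).1) (ρ := ρ) hρ1 ?_ ?_ ?_
    · have hL : α * β ≤ 8 * N * ρ := by nlinarith
      have h6 : ∑ z ∈ Z.filter (fun z => α * β < (planeThr P x u a z).card * N),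
          (planeThr P x u a z).card ^ 2 ≤ 128 * (α * β) * N := by
        refine Nat.le_of_mul_le_mul_left (main.trans ?_) hρ1
        calc 16 * (α * β) ^ 2 = 16 * (α * β) * (α * β) := by ring
          _ ≤ 16 * (α * β) * (8 * N * ρ) := Nat.mul_le_mul_left _ hL
          _ = ρ * (128 * (α * β) * N) := by ring
      calc _ ≤ ∑ z ∈ Z.filter (fun z => α * β < (planeThr P x u a z).card * N),
            64 * (planeThr P x u a z).card ^ 2 := by
            refine Finset.sum_le_sum fun z hz => (card_crossPairs_le _ _).trans ?_
            calc _ ≤ (8 * (planeThr P x u a z).card) ^ 2 :=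
                  Nat.pow_le_pow_left (hm z (Finset.mem_filter.1 hz).1) 2
              _ = _ := by ring
        _ ≤ _ := by rw [← Finset.mul_sum]; linarith
    · refine max_le hα ?_
      refine Nat.div_le_of_le_mul ?_
      nlinarith
    · refine max_le hβ ?_
      refine Nat.div_le_of_le_mul ?_
      nlinarith
    · intro z hz
      obtain ⟨hz, hzb⟩ := Finset.mem_filter.1 hz
      have e1 := hr z hz
      have e2 := hm z hz
      rw [hρ]
      rcases max_choice 1 (α * β / (4 * N)) with h | h
      · rw [h]; omega
      · rw [h]
        refine Nat.le_of_mul_le_mul_right (?_ : _ * N ≤ _) hN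
        calc 4 * (α * β / (4 * N)) * N = α * β / (4 * N) * (4 * N) := by ring
          _ ≤ _ := hk.trans hzb.le
  have hsmall : ∑ z ∈ Z.filter (fun z => ¬ α * β < (planeThr P x u a z).card * N),
      (crossPairs (P ×ˢ P) z).card ≤ 16 * (α * β) * N := by
    refine Nat.le_of_mul_le_mul_right (?_ : _ * N ≤ _) hN
    calc _ = ∑ z ∈ Z.filter (fun z => ¬ α * β < (planeThr P x u a z).card * N),
          (crossPairs (P ×ˢ P) z).card * N := Finset.sum_mul _ _ _
      _ ≤ ∑ z ∈ Z.filter (fun z => ¬ α * β < (planeThr P x u a z).card * N),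
          16 * (α * β) * (thr (P ×ˢ P) z \ planeThr P x u a z).card := by
          refine Finset.sum_le_sum fun z hz => ?_
          obtain ⟨hz, hzb⟩ := Finset.mem_filter.1 hz
          have e1 := card_crossPairs_le_of_subset (𝓛 := P ×ˢ P) (z := z)
            (M := planeThr P x u a z) fun ℓ h ℓ' h' hc => hR.cross _ _ hc
              ((mem_planeThr.1 h).2.1.trans (mem_planeThr.1 h').2.1.symm)
          have e2 := hm z hz
          have e3 := not_lt.1 hzb
          calc _ ≤ 2 * ((thr (P ×ˢ P) z \ planeThr P x u a z).card *
                (8 * (planeThr P x u a z).card)) * N := by gcongr; exact e1.trans (by gcongr)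
            _ = 16 * ((planeThr P x u a z).card * N) *
                (thr (P ×ˢ P) z \ planeThr P x u a z).card := by ring
            _ ≤ _ := by gcongr
      _ = 16 * (α * β) * ∑ z ∈ Z.filter (fun z => ¬ α * β < (planeThr P x u a z).card * N),
          (thr (P ×ˢ P) z \ planeThr P x u a z).card := (Finset.mul_sum _ _ _).symm
      _ ≤ 16 * (α * β) * N ^ 2 := Nat.mul_le_mul_left _
          (hR.sum_off_plane_le P u a _ (fun z hz => hZ0 z (Finset.mem_filter.1 hz).1)
            fun z hz => hne z (Finset.mem_filter.1 hz).1)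
      _ = _ := by ring
  linarith

/-- Crossings at points where one plane of the ruling holds a large share of the lines. -/
theorem Ruling.sum_crossPairs_le (hR : Ruling x y τ) (P : Finset (ℝ × ℝ))
    (Z : Finset (Fin 3 → ℝ)) (hZ0 : ∀ z ∈ Z, z 0 ≠ 0)
    (hr : ∀ z ∈ Z, 64 < (thr (P ×ˢ P) z).card) [DecidableEq ℝ]
    (hm : ∀ z ∈ Z, ∃ ℓ ∈ thr (P ×ˢ P) z, (thr (P ×ˢ P) z).card ≤
      8 * ((thr (P ×ˢ P) z).filter fun ℓ' => x ℓ.1 = x ℓ'.1).card) :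
    ∑ z ∈ Z, (crossPairs (P ×ˢ P) z).card ≤ 8208 * P.card ^ 3 := by
  classical
  choose! lam hlam hcard using hm
  have hmaps : ∀ z ∈ Z, (x (lam z).1, x (lam z).2) ∈ P.image x ×ˢ P.image x := by
    intro z hz
    obtain ⟨h1, h2⟩ := Finset.mem_product.1 (mem_thr.1 (hlam z hz)).1
    exact Finset.mem_product.2 ⟨Finset.mem_image_of_mem _ h1, Finset.mem_image_of_mem _ h2⟩
  rw [← Finset.sum_fiberwise_of_maps_to hmaps]
  have hα : ∑ c ∈ P.image x, (col P x c).card = P.card := by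
    simp only [col]
    convert (Finset.card_eq_sum_card_fiberwise
      fun p (hp : p ∈ P) => Finset.mem_image_of_mem x hp).symm
  calc _ ≤ ∑ π ∈ P.image x ×ˢ P.image x,
        8208 * ((col P x π.1).card * (col P x π.2).card) * P.card := by
        refine Finset.sum_le_sum fun π _ => ?_
        refine hR.sum_crossPairs_plane_le P π.1 π.2 _
          (fun z hz => hZ0 z (Finset.mem_filter.1 hz).1)
          (fun z hz => hr z (Finset.mem_filter.1 hz).1) fun z hz => ?_
        obtain ⟨hzZ, rfl⟩ := Finset.mem_filter.1 hz
        refine (hcard z hzZ).trans (Nat.mul_le_mul_left _ (Finset.card_le_card fun ℓ hℓ => ?_))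
        obtain ⟨h1, h2⟩ := Finset.mem_filter.1 hℓ
        have h3 := (hR.rel ℓ (lam z) (z 0) (hZ0 z hzZ)
          ((mem_thr.1 h1).2.trans (mem_thr.1 (hlam z hzZ)).2.symm)).1
        rw [← h2, sub_self, mul_zero] at h3
        exact mem_planeThr.2 ⟨h1, h2.symm, sub_eq_zero.1 h3⟩
    _ = 8208 * (∑ c ∈ P.image x, (col P x c).card) ^ 2 * P.card := by
        rw [sq, Finset.sum_mul_sum, ← Finset.sum_product', Finset.mul_sum, Finset.sum_mul]
    _ = _ := by rw [hα]; ring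

end

lemma sum_crossPairs_of_not_nondom_le (P : Finset (ℝ × ℝ)) (Z : Finset (Fin 3 → ℝ))
    (hZ0 : ∀ z ∈ Z, z 0 ≠ 0) (hr : ∀ z ∈ Z, 64 < (thr (P ×ˢ P) z).card)
    (hnd : ∀ z ∈ Z, ¬ Nondom (P ×ˢ P) z) :
    ∑ z ∈ Z, (crossPairs (P ×ˢ P) z).card ≤ 16416 * P.card ^ 3 := by
  classical
  let Dom : (Fin 3 → ℝ) → Prop := fun z => ∃ ℓ ∈ thr (P ×ˢ P) z, (thr (P ×ˢ P) z).card ≤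
    8 * ((thr (P ×ˢ P) z).filter fun ℓ' => ℓ.1.1 = ℓ'.1.1).card
  rw [← Finset.sum_filter_add_sum_filter_not Z Dom]
  have h1 := ruling_fst.sum_crossPairs_le P (Z.filter Dom)
    (fun z hz => hZ0 z (Finset.mem_filter.1 hz).1) (fun z hz => hr z (Finset.mem_filter.1 hz).1)
    (fun z hz => by convert (Finset.mem_filter.1 hz).2)
  have h2 := ruling_snd.sum_crossPairs_le P (Z.filter fun z => ¬ Dom z)
    (fun z hz => hZ0 z (Finset.mem_filter.1 hz).1) (fun z hz => hr z (Finset.mem_filter.1 hz).1)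
    (fun z hz => by
      obtain ⟨hz, hd⟩ := Finset.mem_filter.1 hz
      have h3 := hnd z hz
      unfold Nondom at h3
      push Not at h3
      obtain ⟨ℓ, hℓ, h4⟩ := h3
      refine ⟨ℓ, hℓ, ?_⟩
      convert h4 ?_
      by_contra h5
      exact hd ⟨ℓ, hℓ, by convert not_lt.1 h5⟩)
  linarith

open scoped Classical in
/-- The number of ordered pairs of crossing lines of `P ×ˢ P`. -/
theorem card_cross_le (P : Finset (ℝ × ℝ)) :
    ((((P ×ˢ P) ×ˢ (P ×ˢ P)).filter fun e : Line × Line => Cross e.1 e.2).card : ℝ) ≤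
      3 * 10 ^ 28 * (P.card : ℝ) ^ 3 * (1 + Real.log P.card) := by
  set 𝓛 : Finset Line := P ×ˢ P with h𝓛
  rcases P.eq_empty_or_nonempty with rfl | hP
  · simp [h𝓛]
  have hN : (1 : ℝ) ≤ P.card := by exact_mod_cast hP.card_pos
  have hlog : 0 ≤ Real.log P.card := Real.log_nonneg hN
  let f : Line × Line → (Fin 3 → ℝ) := fun e => pt e.1 (meetT e.1 e.2)
  have hmaps : ∀ e ∈ (𝓛 ×ˢ 𝓛).filter fun e => Cross e.1 e.2, f e ∈ crossPts 𝓛 := by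
    intro e he
    obtain ⟨h1, h2⟩ := Finset.mem_filter.1 he
    obtain ⟨h3, h4⟩ := Finset.mem_product.1 h1
    exact mem_crossPts.2 ⟨_, h3, _, h4, h2, rfl⟩
  have hsum : ((𝓛 ×ˢ 𝓛).filter fun e => Cross e.1 e.2).card ≤
      ∑ z ∈ crossPts 𝓛, (crossPairs 𝓛 z).card := by
    rw [Finset.card_eq_sum_card_fiberwise hmaps]
    refine Finset.sum_le_sum fun z _ => Finset.card_le_card fun e he => ?_
    obtain ⟨h0, rfl⟩ := Finset.mem_filter.1 he
    obtain ⟨h1, h2⟩ := Finset.mem_filter.1 h0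
    obtain ⟨h3, h4⟩ := Finset.mem_product.1 h1
    refine Finset.mem_filter.2 ⟨Finset.mem_product.2 ⟨mem_thr.2 ⟨h3, ?_⟩, mem_thr.2 ⟨h4, ?_⟩⟩, h2⟩
    · simp only [f, pt_zero]
    · simp only [f, pt_zero]
      exact h2.pt_eq.symm
  have h0 : ∀ z ∈ crossPts 𝓛, z 0 ≠ 0 := by
    intro z hz
    obtain ⟨ℓ, -, ℓ', -, hc, rfl⟩ := mem_crossPts.1 hz
    rw [pt_zero]
    exact hc.meetT_ne_zero
  rw [← Finset.sum_filter_add_sum_filter_not _ fun z => 64 < (thr 𝓛 z).card,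
    ← Finset.sum_filter_add_sum_filter_not ((crossPts 𝓛).filter _) fun z => Nondom 𝓛 z] at hsum
  have hpoor : ∑ z ∈ (crossPts 𝓛).filter (fun z => ¬ 64 < (thr 𝓛 z).card),
      (crossPairs 𝓛 z).card ≤ 819200 * P.card ^ 3 := by
    calc _ ≤ ∑ z ∈ (crossPts 𝓛).filter (fun z => ¬ 64 < (thr 𝓛 z).card), 64 ^ 2 :=
          Finset.sum_le_sum fun z hz => (card_crossPairs_le _ _).trans
            (Nat.pow_le_pow_left (not_lt.1 (Finset.mem_filter.1 hz).2) 2)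
      _ ≤ (crossPts 𝓛).card * 4096 := by
          rw [Finset.sum_const, smul_eq_mul]
          exact Nat.mul_le_mul (Finset.card_filter_le _ _) le_rfl
      _ ≤ 200 * P.card * (P.card * P.card) * 4096 := by
          rw [← Finset.card_product]
          exact Nat.mul_le_mul_right _ (card_crossPts_le P 𝓛 subset_rfl)
      _ = _ := by ring
  have hdom := sum_crossPairs_of_not_nondom_le P
    (((crossPts 𝓛).filter fun z => 64 < (thr 𝓛 z).card).filter fun z => ¬ Nondom 𝓛 z)
    (fun z hz => h0 z (Finset.mem_filter.1 (Finset.mem_filter.1 hz).1).1)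
    (fun z hz => (Finset.mem_filter.1 (Finset.mem_filter.1 hz).1).2)
    (fun z hz => (Finset.mem_filter.1 hz).2)
  have hnd : ((∑ z ∈ ((crossPts 𝓛).filter fun z => 64 < (thr 𝓛 z).card).filter
      (fun z => Nondom 𝓛 z), (crossPairs 𝓛 z).card : ℕ) : ℝ) ≤
      2 * 10 ^ 28 * (P.card : ℝ) ^ 3 * (1 + Real.log P.card) := by
    refine le_trans ?_ (sum_sq_rich_le P
      (((crossPts 𝓛).filter fun z => 64 < (thr 𝓛 z).card).filter fun z => Nondom 𝓛 z)
      (fun z hz => h0 z (Finset.mem_filter.1 (Finset.mem_filter.1 hz).1).1)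
      (fun z hz => (Finset.mem_filter.1 hz).2))
    rw [Nat.cast_sum]
    exact Finset.sum_le_sum fun z _ => by exact_mod_cast card_crossPairs_le 𝓛 z
  have e1 : ((∑ z ∈ (crossPts 𝓛).filter (fun z => ¬ 64 < (thr 𝓛 z).card),
      (crossPairs 𝓛 z).card : ℕ) : ℝ) ≤ 819200 * (P.card : ℝ) ^ 3 := by exact_mod_cast hpoor
  have e2 : ((∑ z ∈ ((crossPts 𝓛).filter fun z => 64 < (thr 𝓛 z).card).filter
      (fun z => ¬ Nondom 𝓛 z), (crossPairs 𝓛 z).card : ℕ) : ℝ) ≤ 16416 * (P.card : ℝ) ^ 3 := by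
    exact_mod_cast hdom
  have e3 : ((((𝓛 ×ˢ 𝓛).filter fun e => Cross e.1 e.2).card : ℕ) : ℝ) ≤ _ := Nat.cast_le.2 hsum
  rw [Nat.cast_add, Nat.cast_add] at e3
  have e4 : 0 ≤ (P.card : ℝ) ^ 3 := by positivity
  have e5 : 0 ≤ (P.card : ℝ) ^ 3 * Real.log P.card := mul_nonneg e4 hlog
  nlinarith

/-- The squared Minkowski distance in light-cone coordinates. -/
def nullDist (e : (ℝ × ℝ) × (ℝ × ℝ)) : ℝ := (e.1.1 - e.2.1) * (e.1.2 - e.2.2)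

lemma card_filter_fst_le {Q : Finset (ℝ × ℝ)} {Δ : Finset ℝ} (c : ℝ)
    (hΔ : ∀ p ∈ Q, ∀ q ∈ Q, nullDist (p, q) ∈ Δ) {p : ℝ × ℝ} (hp : p ∈ Q) (hpc : p.1 ≠ c) :
    (Q.filter fun q => q.1 = c).card ≤ Δ.card := by
  refine Finset.card_le_card_of_injOn (fun q => nullDist (p, q))
    (fun q hq => hΔ p hp q (Finset.mem_filter.1 hq).1) fun q hq q' hq' h => ?_
  have h1 := (Finset.mem_filter.1 hq).2
  have h2 := (Finset.mem_filter.1 hq').2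
  simp only [nullDist, h1, h2] at h
  have h3 := mul_left_cancel₀ (sub_ne_zero.2 hpc) h
  exact Prod.ext (h1.trans h2.symm) (by linarith)

lemma card_filter_snd_le {Q : Finset (ℝ × ℝ)} {Δ : Finset ℝ} (c : ℝ)
    (hΔ : ∀ p ∈ Q, ∀ q ∈ Q, nullDist (p, q) ∈ Δ) {p : ℝ × ℝ} (hp : p ∈ Q) (hpc : p.2 ≠ c) :
    (Q.filter fun q => q.2 = c).card ≤ Δ.card := by
  refine Finset.card_le_card_of_injOn (fun q => nullDist (p, q))
    (fun q hq => hΔ p hp q (Finset.mem_filter.1 hq).1) fun q hq q' hq' h => ?_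
  have h1 := (Finset.mem_filter.1 hq).2
  have h2 := (Finset.mem_filter.1 hq').2
  simp only [nullDist, h1, h2] at h
  have h3 := mul_right_cancel₀ (sub_ne_zero.2 hpc) h
  exact Prod.ext (by linarith) (h1.trans h2.symm)

lemma card_nullDist_eq_zero_le {Q : Finset (ℝ × ℝ)} {Δ : Finset ℝ}
    (hΔ : ∀ p ∈ Q, ∀ q ∈ Q, nullDist (p, q) ∈ Δ)
    (hne : ∃ p ∈ Q, ∃ q ∈ Q, nullDist (p, q) ≠ 0) :
    ((Q ×ˢ Q).filter fun e => nullDist e = 0).card ≤ 2 * (Q.card * Δ.card) := by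
  classical
  obtain ⟨p, hp, q, hq, hpq⟩ := hne
  have h1 : p.1 ≠ q.1 := sub_ne_zero.1 (left_ne_zero_of_mul hpq)
  have h2 : p.2 ≠ q.2 := sub_ne_zero.1 (right_ne_zero_of_mul hpq)
  have hu : ∀ c, (Q.filter fun q => q.1 = c).card ≤ Δ.card := fun c => by
    by_cases h : p.1 = c
    · exact card_filter_fst_le c hΔ hq fun h' => h1 (h.trans h'.symm)
    · exact card_filter_fst_le c hΔ hp h
  have hv : ∀ c, (Q.filter fun q => q.2 = c).card ≤ Δ.card := fun c => by
    by_cases h : p.2 = c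
    · exact card_filter_snd_le c hΔ hq fun h' => h2 (h.trans h'.symm)
    · exact card_filter_snd_le c hΔ hp h
  have hmaps : ∀ e ∈ (Q ×ˢ Q).filter fun e => nullDist e = 0, e.1 ∈ Q := fun e he =>
    (Finset.mem_product.1 (Finset.mem_filter.1 he).1).1
  rw [Finset.card_eq_sum_card_fiberwise hmaps]
  calc _ ≤ ∑ _p ∈ Q, 2 * Δ.card := by
        refine Finset.sum_le_sum fun p _ => ?_
        have hinj : (((Q ×ˢ Q).filter fun e => nullDist e = 0).filter fun e => e.1 = p).card ≤
            (Q.filter (fun q => q.1 = p.1) ∪ Q.filter fun q => q.2 = p.2).card := by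
          refine Finset.card_le_card_of_injOn Prod.snd (fun e he => ?_) fun e he e' he' h =>
            Prod.ext ((Finset.mem_filter.1 he).2.trans (Finset.mem_filter.1 he').2.symm) h
          obtain ⟨h3, rfl⟩ := Finset.mem_filter.1 he
          obtain ⟨h4, h5⟩ := Finset.mem_filter.1 h3
          have h6 := (Finset.mem_product.1 h4).2
          rcases mul_eq_zero.1 h5 with h7 | h7
          · exact Finset.mem_union_left _ (Finset.mem_filter.2 ⟨h6, (sub_eq_zero.1 h7).symm⟩)
          · exact Finset.mem_union_right _ (Finset.mem_filter.2 ⟨h6, (sub_eq_zero.1 h7).symm⟩)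
        have := hinj.trans (Finset.card_union_le _ _)
        have := hu p.1
        have := hv p.2
        omega
    _ = _ := by rw [Finset.sum_const, smul_eq_mul]; ring

open scoped Classical in
lemma sq_card_nullDist_ne_zero_le {Q : Finset (ℝ × ℝ)} {Δ : Finset ℝ}
    (hΔ : ∀ p ∈ Q, ∀ q ∈ Q, nullDist (p, q) ∈ Δ) :
    ((Q ×ˢ Q).filter fun e => ¬ nullDist e = 0).card ^ 2 ≤
      Δ.card * (((Q ×ˢ Q) ×ˢ (Q ×ˢ Q)).filter fun e : Line × Line => Cross e.1 e.2).card := by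
  set W := (Q ×ˢ Q).filter fun e => ¬ nullDist e = 0 with hW
  have hmaps : ∀ e ∈ W, nullDist e ∈ Δ := fun e he => by
    obtain ⟨h1, h2⟩ := Finset.mem_product.1 (Finset.mem_filter.1 he).1
    exact hΔ _ h1 _ h2
  rw [Finset.card_eq_sum_card_fiberwise hmaps]
  refine sq_sum_le_card_mul_sum_sq.trans (Nat.mul_le_mul_left _ ?_)
  have hmaps' : ∀ e ∈ ((Q ×ˢ Q) ×ˢ (Q ×ˢ Q)).filter fun e : Line × Line => Cross e.1 e.2,
      nullDist (e.1.1, e.2.1) ∈ Δ := fun e he => by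
    obtain ⟨h1, h2⟩ := Finset.mem_product.1 (Finset.mem_filter.1 he).1
    exact hΔ _ (Finset.mem_product.1 h1).1 _ (Finset.mem_product.1 h2).1
  rw [Finset.card_eq_sum_card_fiberwise hmaps']
  refine Finset.sum_le_sum fun d _ => ?_
  rw [sq, ← Finset.card_product]
  refine Finset.card_le_card_of_injOn (fun w => ((w.1.1, w.2.1), (w.1.2, w.2.2)))
    (fun w hw => ?_) fun w _ w' _ h => ?_
  · obtain ⟨h1, h2⟩ := Finset.mem_product.1 hw
    obtain ⟨h3, h4⟩ := Finset.mem_filter.1 h1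
    obtain ⟨h5, h6⟩ := Finset.mem_filter.1 h2
    obtain ⟨h7, h8⟩ := Finset.mem_filter.1 h3
    obtain ⟨h9, -⟩ := Finset.mem_filter.1 h5
    obtain ⟨h10, h11⟩ := Finset.mem_product.1 h7
    obtain ⟨h12, h13⟩ := Finset.mem_product.1 h9
    exact Finset.mem_filter.2 ⟨Finset.mem_filter.2 ⟨Finset.mem_product.2
      ⟨Finset.mem_product.2 ⟨h10, h12⟩, Finset.mem_product.2 ⟨h11, h13⟩⟩,
      h4.trans h6.symm, h8⟩, h4⟩
  · simp only [Prod.mk.injEq] at h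
    exact Prod.ext (Prod.ext h.1.1 h.2.1) (Prod.ext h.1.2 h.2.2)

theorem card_nullDist_ge {Q : Finset (ℝ × ℝ)} {Δ : Finset ℝ} (hQ : 2 ≤ Q.card)
    (hΔ : ∀ p ∈ Q, ∀ q ∈ Q, nullDist (p, q) ∈ Δ)
    (hne : ∃ p ∈ Q, ∃ q ∈ Q, nullDist (p, q) ≠ 0) :
    1 / 10 ^ 30 * (Q.card : ℝ) / Real.log Q.card ≤ Δ.card := by
  classical
  have h0 := card_nullDist_eq_zero_le hΔ hne
  have h1 := sq_card_nullDist_ne_zero_le hΔ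
  have h2 := card_cross_le Q
  have h3 := Finset.card_filter_add_card_filter_not (s := Q ×ˢ Q) fun e => nullDist e = 0
  rw [Finset.card_product] at h3
  have hN : (2 : ℝ) ≤ Q.card := by exact_mod_cast hQ
  have hlog : 1 / 2 ≤ Real.log Q.card := by
    have := Real.log_two_gt_d9
    have := Real.log_le_log two_pos hN
    linarith
  have hlog0 : 0 < Real.log Q.card := by linarith
  rw [div_le_iff₀ hlog0]
  set E := (((Q ×ˢ Q) ×ˢ (Q ×ˢ Q)).filter fun e : Line × Line => Cross e.1 e.2).card
  set W := ((Q ×ˢ Q).filter fun e => ¬ nullDist e = 0).card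
  set D : ℝ := (Δ.card : ℝ) with hD
  set N : ℝ := (Q.card : ℝ) with hNd
  have hD0 : 0 ≤ D := Nat.cast_nonneg _
  by_cases h4 : N ≤ 8 * D
  · nlinarith
  push Not at h4
  have h5 : (3 / 4 : ℝ) * N ^ 2 ≤ W := by
    have e1 : ((_ : ℕ) : ℝ) ≤ _ := Nat.cast_le.2 h0
    have e2 := congrArg (Nat.cast (R := ℝ)) h3
    push_cast at e1 e2
    nlinarith
  have h6 : (W : ℝ) ^ 2 ≤ D * E := by
    have e := (Nat.cast_le (α := ℝ)).2 h1
    rwa [Nat.cast_pow, Nat.cast_mul] at e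
  have h7 : ((3 / 4 : ℝ) * N ^ 2) ^ 2 ≤ (W : ℝ) ^ 2 := pow_le_pow_left₀ (by positivity) h5 2
  have h8 : D * E ≤ D * (3 * 10 ^ 28 * N ^ 3 * (3 * Real.log N)) := by
    refine mul_le_mul_of_nonneg_left (h2.trans ?_) hD0
    exact mul_le_mul_of_nonneg_left (by linarith) (by positivity)
  have hN3 : 0 < N ^ 3 := by positivity
  have h9 : 9 / 16 * N ≤ 9 * 10 ^ 28 * (D * Real.log N) := by
    refine le_of_mul_le_mul_left ?_ hN3
    linarith [h7.trans (h6.trans h8)]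
  linarith

end Minkowski

/-- There is an absolute constant c > 0 such that for every finite
set `P ⊆ ℝ²` with `|P| ≥ 2`, if the set of squared Minkowski distances
`Δ(P) = {(p₁−q₁)² − (p₂−q₂)² : p,q ∈ P}` is not `{0}`, then
`|Δ(P)| ≥ c·|P|/log|P|`. -/
theorem minkowski_distance_problem :
    ∃ c : ℝ, 0 < c ∧
      ∀ P : Finset (ℝ × ℝ), 2 ≤ P.card →
        ∀ Δ : Finset ℝ,
          Δ = (P ×ˢ P).image
                (fun pq => (pq.1.1 - pq.2.1) ^ 2 - (pq.1.2 - pq.2.2) ^ 2) →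
          Δ ≠ {0} →
          (Δ.card : ℝ) ≥ c * P.card / Real.log P.card := by
  refine ⟨1 / 10 ^ 30, by positivity, fun P hP Δ hΔ hne => ?_⟩
  let f : ℝ × ℝ → ℝ × ℝ := fun p => (p.1 + p.2, p.1 - p.2)
  have hf : Function.Injective f := fun p q h => by
    obtain ⟨h1, h2⟩ := Prod.mk.inj h
    exact Prod.ext (by linarith) (by linarith)
  have hdist : ∀ p q, Minkowski.nullDist (f p, f q) = (p.1 - q.1) ^ 2 - (p.2 - q.2) ^ 2 :=
    fun p q => by simp only [Minkowski.nullDist, f]; ring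
  have hcard : (P.image f).card = P.card := Finset.card_image_of_injective P hf
  rw [← hcard]
  refine Minkowski.card_nullDist_ge (by rwa [hcard]) ?_ ?_
  · intro p hp q hq
    obtain ⟨p, hp', rfl⟩ := Finset.mem_image.1 hp
    obtain ⟨q, hq', rfl⟩ := Finset.mem_image.1 hq
    rw [hdist, hΔ]
    exact Finset.mem_image.2 ⟨(p, q), Finset.mem_product.2 ⟨hp', hq'⟩, rfl⟩
  · by_contra! h
    refine hne ?_
    obtain ⟨p, hp⟩ := Finset.card_pos.1 (two_pos.trans_le hP)
    rw [hΔ, Finset.eq_singleton_iff_unique_mem]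
    refine ⟨Finset.mem_image.2 ⟨(p, p), Finset.mem_product.2 ⟨hp, hp⟩, by simp⟩, fun d hd => ?_⟩
    obtain ⟨e, he, rfl⟩ := Finset.mem_image.1 hd
    obtain ⟨h1, h2⟩ := Finset.mem_product.1 he
    rw [← hdist]
    exact h _ (Finset.mem_image_of_mem f h1) _ (Finset.mem_image_of_mem f h2)
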